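/- arXiv:1707.04361 — 2 statements merged into one kernel-verified Lean document; each statement's English description precedes it below -/
import Mathlib

section
/- Let u ∈ C^∞(ℝ⁴) and set R := −6e^{−2u}(Δu + |∇u|²) and M(x) := −Hess u(x) + ∇u(x)⊗∇u(x) − (1/2)|∇u(x)|² I₄, σ₂(M) := (1/2)((tr M)² − tr(M²)). Assume: the metric e^{2u}|dx|² is complete; ∫_{ℝ⁴}|Δ²u| dx < ∞; ∫_{ℝ⁴} R² e^{4u} dx < ∞; σ₂(M(·)) is Lebesgue integrable on ℝ⁴ with ∫_{ℝ⁴} σ₂(M(x)) dx < 2π². Then the manifold (ℝ⁴, e^{2u}|dx|²) satisfies an isoperimetric inequality: there is a constant C > 0 such that for every bounded open set Ω ⊂ ℝ⁴ with smooth boundary, (∫_Ω e^{4u} dx)^{3/4} ≤ C ∫_{∂Ω} e^{3u} dH³. -/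
open MeasureTheory Metric Filter Set

noncomputable section

/-- Euclidean space `ℝⁿ`. -/
abbrev Eu (n : ℕ) := EuclideanSpace ℝ (Fin n)

/-- The Euclidean Laplacian `Δu(x) = ∑ᵢ ∂²u/∂xᵢ²`. -/
def lap {n : ℕ} (u : Eu n → ℝ) (x : Eu n) : ℝ :=
  ∑ i : Fin n, iteratedFDeriv ℝ 2 u x ![EuclideanSpace.single i 1, EuclideanSpace.single i 1]

/-- Iterated Laplacian `Δᵏ`. -/
def lapIter {n : ℕ} : ℕ → (Eu n → ℝ) → Eu n → ℝ
  | 0, u => u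
  | k + 1, u => lap (lapIter k u)

/-- A path `γ : [0,1] → ℝⁿ` which is continuous and differentiable away from
finitely many points (piecewise C¹). -/
def PiecewiseC1 {n : ℕ} (γ : ℝ → Eu n) : Prop :=
  ContinuousOn γ (Set.Icc 0 1) ∧
    ∃ S : Finset ℝ, ∀ t ∈ Set.Icc (0 : ℝ) 1, t ∉ S → DifferentiableAt ℝ γ t

/-- Length of the path `γ` in the conformal metric `e^{2u}|dx|²`. -/
def confLength {n : ℕ} (u : Eu n → ℝ) (γ : ℝ → Eu n) : ℝ :=
  ∫ t in (0 : ℝ)..1, Real.exp (u (γ t)) * ‖deriv γ t‖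

/-- The distance `d_u` induced by the conformal metric `e^{2u}|dx|²`. -/
def confDist {n : ℕ} (u : Eu n → ℝ) (x y : Eu n) : ℝ :=
  sInf { L | ∃ γ : ℝ → Eu n, γ 0 = x ∧ γ 1 = y ∧ PiecewiseC1 γ ∧ L = confLength u γ }

/-- Completeness of the conformal metric `e^{2u}|dx|²`: every sequence which is Cauchy
for `d_u` converges for `d_u`. -/
def ConfComplete {n : ℕ} (u : Eu n → ℝ) : Prop :=
  ∀ s : ℕ → Eu n,
    (∀ ε : ℝ, 0 < ε → ∃ N : ℕ, ∀ m ≥ N, ∀ l ≥ N, confDist u (s m) (s l) < ε) →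
      ∃ x : Eu n, ∀ ε : ℝ, 0 < ε → ∃ N : ℕ, ∀ m ≥ N, confDist u (s m) x < ε

/-- The matrix `M(x) = -Hess u(x) + ∇u(x) ⊗ ∇u(x) - (1/2)|∇u(x)|² I₄` of the Schouten
tensor of `e^{2u}|dx|²` in Euclidean coordinates on `ℝ⁴`. -/
def schoutenMatrix (u : Eu 4 → ℝ) (x : Eu 4) : Matrix (Fin 4) (Fin 4) ℝ :=
  fun i j =>
    -(iteratedFDeriv ℝ 2 u x ![EuclideanSpace.single i 1, EuclideanSpace.single j 1]) +
      gradient u x i * gradient u x j -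
      (1 / 2) * ‖gradient u x‖ ^ 2 * (if i = j then 1 else 0)

/-- The second elementary symmetric function of the eigenvalues of a matrix:
`σ₂(M) = (1/2)((tr M)² - tr(M²))`. -/
def sigma2 (M : Matrix (Fin 4) (Fin 4) ℝ) : ℝ :=
  (1 / 2) * ((Matrix.trace M) ^ 2 - Matrix.trace (M * M))

/-- `Ω` is a bounded open set with smooth boundary: it is the strict sublevel set of a
smooth function whose differential does not vanish on the zero level set. -/
def HasSmoothBoundary {n : ℕ} (Ω : Set (Eu n)) : Prop :=
  ∃ g : Eu n → ℝ, ContDiff ℝ (⊤ : ℕ∞) g ∧ Ω = {x | g x < 0} ∧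
    ∀ x : Eu n, g x = 0 → fderiv ℝ g x ≠ 0

section Calculus
open scoped ContDiff Topology

/-- The `i`-th partial derivative. -/
def pd {n : ℕ} (i : Fin n) (F : Eu n → ℝ) (x : Eu n) : ℝ :=
  fderiv ℝ F x (EuclideanSpace.single i 1)

variable {n : ℕ} {F G : Eu n → ℝ}

theorem ContDiff.pd (hF : ContDiff ℝ ∞ F) (i : Fin n) : ContDiff ℝ ∞ (pd i F) :=
  (hF.fderiv_right (m := ∞) le_rfl).clm_apply contDiff_const

theorem HasCompactSupport.pd (hF : HasCompactSupport F) (i : Fin n) :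
    HasCompactSupport (pd i F) :=
  hF.fderiv_apply ℝ (EuclideanSpace.single i 1)

theorem pd_add (hF : ContDiff ℝ ∞ F) (hG : ContDiff ℝ ∞ G) (i : Fin n) (x : Eu n) :
    pd i (fun y => F y + G y) x = pd i F x + pd i G x := by
  unfold pd
  rw [fderiv_fun_add (hF.differentiable (by simp) x) (hG.differentiable (by simp) x)]
  rfl

theorem pd_sub (hF : ContDiff ℝ ∞ F) (hG : ContDiff ℝ ∞ G) (i : Fin n) (x : Eu n) :
    pd i (fun y => F y - G y) x = pd i F x - pd i G x := by
  unfold pd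
  rw [fderiv_fun_sub (hF.differentiable (by simp) x) (hG.differentiable (by simp) x)]
  rfl

theorem pd_mul (hF : ContDiff ℝ ∞ F) (hG : ContDiff ℝ ∞ G) (i : Fin n) (x : Eu n) :
    pd i (fun y => F y * G y) x = F x * pd i G x + pd i F x * G x := by
  unfold pd
  rw [fderiv_fun_mul (hF.differentiable (by simp) x) (hG.differentiable (by simp) x)]
  simp [mul_comm]

theorem pd_sum {ι : Type*} {s : Finset ι} {F : ι → Eu n → ℝ} (hF : ∀ j, ContDiff ℝ ∞ (F j))
    (i : Fin n) (x : Eu n) :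
    pd i (fun y => ∑ j ∈ s, F j y) x = ∑ j ∈ s, pd i (F j) x := by
  unfold pd
  rw [fderiv_fun_sum (fun j _ => (hF j).differentiable (by simp) x)]
  simp

theorem pd_comm (hF : ContDiff ℝ ∞ F) (i j : Fin n) : pd i (pd j F) = pd j (pd i F) := by
  have hd : Differentiable ℝ (fderiv ℝ F) :=
    (hF.fderiv_right (m := ∞) le_rfl).differentiable (by simp)
  have key : ∀ (a b : Fin n) (x : Eu n), pd a (pd b F) x =
      fderiv ℝ (fderiv ℝ F) x (EuclideanSpace.single a 1) (EuclideanSpace.single b 1) := by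
    intro a b x
    change fderiv ℝ (fun y => fderiv ℝ F y (EuclideanSpace.single b 1)) x _ = _
    rw [fderiv_clm_apply (hd x) (by fun_prop)]
    simp
  funext x
  rw [key, key]
  exact (hF.contDiffAt.isSymmSndFDerivAt (by
    simp only [minSmoothness_of_isRCLikeNormedField]; exact WithTop.coe_le_coe.2 le_top)) _ _

theorem iteratedFDeriv_two_eq_pd (hF : ContDiff ℝ ∞ F) (i j : Fin n) (x : Eu n) :
    iteratedFDeriv ℝ 2 F x ![EuclideanSpace.single i 1, EuclideanSpace.single j 1] =
      pd i (pd j F) x := by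
  have hd : Differentiable ℝ (fderiv ℝ F) :=
    (hF.fderiv_right (m := ∞) le_rfl).differentiable (by simp)
  rw [iteratedFDeriv_two_apply]
  change _ = fderiv ℝ (fun y => fderiv ℝ F y (EuclideanSpace.single j 1)) x _
  rw [fderiv_clm_apply (hd x) (by fun_prop)]
  simp

theorem lap_eq (hF : ContDiff ℝ ∞ F) (x : Eu n) : lap F x = ∑ i, pd i (pd i F) x := by
  simp only [lap, iteratedFDeriv_two_eq_pd hF]

theorem ContDiff.lap (hF : ContDiff ℝ ∞ F) : ContDiff ℝ ∞ (lap F) := by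
  rw [funext (lap_eq hF)]
  exact ContDiff.sum fun i _ => (hF.pd i).pd i

theorem HasCompactSupport.lap (hF : ContDiff ℝ ∞ F) (hc : HasCompactSupport F) :
    HasCompactSupport (lap F) := by
  refine HasCompactSupport.of_support_subset_isCompact hc fun x hx => ?_
  by_contra h
  refine hx ?_
  rw [lap_eq hF]
  refine Finset.sum_eq_zero fun i _ => ?_
  have h1 : tsupport (_root_.pd i (_root_.pd i F)) ⊆ tsupport F :=
    (tsupport_fderiv_apply_subset ℝ (EuclideanSpace.single i 1)).trans
      (tsupport_fderiv_apply_subset ℝ (EuclideanSpace.single i 1))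
  exact image_eq_zero_of_notMem_tsupport fun h' => h (h1 h')

theorem gradient_apply (F : Eu n → ℝ) (x : Eu n) (i : Fin n) :
    gradient F x i = pd i F x := by
  have h : inner ℝ (gradient F x) (EuclideanSpace.single i (1 : ℝ)) = pd i F x := by
    simp [gradient, pd]
  rw [← h, EuclideanSpace.inner_single_right]
  simp

theorem norm_gradient_sq (F : Eu n → ℝ) (x : Eu n) :
    ‖gradient F x‖ ^ 2 = ∑ i, pd i F x ^ 2 := by
  rw [EuclideanSpace.norm_sq_eq]
  simp [gradient_apply]

theorem norm_fderiv_sq (F : Eu n → ℝ) (x : Eu n) :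
    ‖fderiv ℝ F x‖ ^ 2 = ∑ i, pd i F x ^ 2 := by
  rw [← norm_gradient_sq, gradient, LinearIsometryEquiv.norm_map]

theorem integral_mul_pd (hF : ContDiff ℝ ∞ F) (hG : ContDiff ℝ ∞ G)
    (hc : HasCompactSupport F) (i : Fin n) :
    ∫ x, F x * pd i G x = - ∫ x, pd i F x * G x := by
  refine integral_mul_fderiv_eq_neg_fderiv_mul_of_integrable ?_ ?_ ?_
    (fun x _ => hF.differentiable (by simp) x) (fun x _ => hG.differentiable (by simp) x)
  · exact ((hF.pd i).continuous.mul hG.continuous).integrable_of_hasCompactSupport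
      ((hc.pd i).mul_right)
  · exact (hF.continuous.mul (hG.pd i).continuous).integrable_of_hasCompactSupport hc.mul_right
  · exact (hF.continuous.mul hG.continuous).integrable_of_hasCompactSupport hc.mul_right

theorem integral_mul_div (hF : ContDiff ℝ ∞ F) (hc : HasCompactSupport F)
    {V : Fin n → Eu n → ℝ} (hV : ∀ i, ContDiff ℝ ∞ (V i)) :
    ∫ x, F x * ∑ i, pd i (V i) x = - ∫ x, ∑ i, pd i F x * V i x := by
  simp only [Finset.mul_sum]
  rw [integral_finsetSum, integral_finsetSum, ← Finset.sum_neg_distrib]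
  · exact Finset.sum_congr rfl fun i _ => integral_mul_pd hF (hV i) hc i
  · exact fun i _ => ((hF.pd i).continuous.mul (hV i).continuous).integrable_of_hasCompactSupport
      ((hc.pd i).mul_right)
  · exact fun i _ => (hF.continuous.mul ((hV i).pd i).continuous).integrable_of_hasCompactSupport
      hc.mul_right

theorem integral_lap_mul (hF : ContDiff ℝ ∞ F) (hG : ContDiff ℝ ∞ G) (hc : HasCompactSupport F) :
    ∫ x, F x * lap G x = ∫ x, lap F x * G x := by
  simp only [lap_eq hF, lap_eq hG, Finset.mul_sum, Finset.sum_mul]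
  rw [integral_finsetSum, integral_finsetSum]
  · refine Finset.sum_congr rfl fun i _ => ?_
    rw [integral_mul_pd hF (hG.pd i) hc, integral_mul_pd (hF.pd i) hG (hc.pd i), neg_neg]
  · exact fun i _ => (((hF.pd i).pd i).continuous.mul hG.continuous).integrable_of_hasCompactSupport
      (((hc.pd i).pd i).mul_right)
  · exact fun i _ => (hF.continuous.mul ((hG.pd i).pd i).continuous).integrable_of_hasCompactSupport
      hc.mul_right

theorem lap_mul (hF : ContDiff ℝ ∞ F) (hG : ContDiff ℝ ∞ G) (x : Eu n) :
    lap (fun y => F y * G y) x =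
      F x * lap G x + 2 * ∑ i, pd i F x * pd i G x + lap F x * G x := by
  rw [lap_eq (hF.mul hG), lap_eq hF, lap_eq hG]
  simp only [Finset.mul_sum, Finset.sum_mul, ← Finset.sum_add_distrib]
  refine Finset.sum_congr rfl fun i _ => ?_
  rw [show pd i (fun y => F y * G y) = fun y => F y * pd i G y + pd i F y * G y from
    funext (pd_mul hF hG i), pd_add (hF.mul (hG.pd i)) ((hF.pd i).mul hG),
    pd_mul hF (hG.pd i), pd_mul (hF.pd i) hG]
  ring

end Calculus

section Cutoff
open scoped ContDiff Topology

theorem pd_eq_zero_of_eventuallyEq {n : ℕ} {F : Eu n → ℝ} {x : Eu n} {c : ℝ}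
    (h : F =ᶠ[𝓝 x] fun _ => c) (i : Fin n) : pd i F x = 0 := by
  simp [pd, h.fderiv_eq]

theorem lap_eq_zero_of_eventuallyEq {n : ℕ} {F : Eu n → ℝ} {x : Eu n} {c : ℝ}
    (hF : ContDiff ℝ ∞ F) (h : F =ᶠ[𝓝 x] fun _ => c) : lap F x = 0 := by
  rw [lap_eq hF]
  refine Finset.sum_eq_zero fun i _ => pd_eq_zero_of_eventuallyEq (c := 0) ?_ i
  filter_upwards [h.eventuallyEq_nhds] with y hy
  exact pd_eq_zero_of_eventuallyEq hy i

theorem pd_comp_smul {n : ℕ} (F : Eu n → ℝ) (c : ℝ) (i : Fin n) :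
    pd i (fun x => F (c • x)) = fun x => c * pd i F (c • x) := by
  funext x
  unfold pd
  rw [fderiv_comp_smul]
  simp

theorem lap_comp_smul {n : ℕ} {F : Eu n → ℝ} (hF : ContDiff ℝ ∞ F) (c : ℝ) (x : Eu n) :
    lap (fun x => F (c • x)) x = c ^ 2 * lap F (c • x) := by
  have h : ContDiff ℝ ∞ fun x => F (c • x) := hF.comp (contDiff_const_smul c)
  rw [lap_eq h, lap_eq hF, Finset.mul_sum]
  refine Finset.sum_congr rfl fun i _ => ?_
  have h2 : pd i (fun x => c * pd i F (c • x)) x = c * pd i (fun x => pd i F (c • x)) x := by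
    unfold pd
    rw [fderiv_const_mul]
    · simp
    · exact ((hF.pd i).comp (contDiff_const_smul c)).differentiable (by simp) x
  rw [pd_comp_smul, h2, pd_comp_smul]
  ring

/-- A fixed smooth function equal to `1` on the unit ball and to `0` off the ball of radius `2`. -/
def unitBump : ContDiffBump (0 : Eu 4) := ⟨1, 2, one_pos, one_lt_two⟩

/-- A smooth cutoff equal to `1` on the ball of radius `r` and to `0` off that of radius `2r`. -/
def cut (r : ℝ) (x : Eu 4) : ℝ := unitBump (r⁻¹ • x)

variable {r : ℝ} {x : Eu 4}

theorem contDiff_cut (r : ℝ) : ContDiff ℝ ∞ (cut r) :=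
  unitBump.contDiff.comp (contDiff_const_smul _)

theorem cut_nonneg : 0 ≤ cut r x := unitBump.nonneg

theorem cut_le_one : cut r x ≤ 1 := unitBump.le_one

theorem cut_eq_one (hr : 0 < r) (hx : ‖x‖ ≤ r) : cut r x = 1 := by
  refine unitBump.one_of_mem_closedBall ?_
  rw [mem_closedBall_zero_iff, norm_smul, norm_inv, Real.norm_of_nonneg hr.le]
  exact (inv_mul_le_iff₀ hr).2 (by simpa [unitBump] using hx)

theorem cut_eq_zero (hr : 0 < r) (hx : 2 * r ≤ ‖x‖) : cut r x = 0 := by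
  refine unitBump.zero_of_le_dist ?_
  rw [dist_zero_right, norm_smul, norm_inv, Real.norm_of_nonneg hr.le]
  exact (le_inv_mul_iff₀ hr).2 (by simpa [unitBump, mul_comm] using hx)

theorem hasCompactSupport_cut (hr : 0 < r) : HasCompactSupport (cut r) := by
  refine HasCompactSupport.of_support_subset_isCompact (isCompact_closedBall 0 (2 * r))
    fun y hy => ?_
  rw [mem_closedBall_zero_iff]
  by_contra h
  exact hy (cut_eq_zero hr (not_le.1 h).le)

theorem cut_eventuallyEq_one (hr : 0 < r) (hx : ‖x‖ < r) : cut r =ᶠ[𝓝 x] fun _ => 1 := by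
  filter_upwards [continuous_norm.continuousAt.eventually_lt_const hx] with y hy
  exact cut_eq_one hr (le_of_lt hy)

theorem cut_eventuallyEq_zero (hr : 0 < r) (hx : 2 * r < ‖x‖) : cut r =ᶠ[𝓝 x] fun _ => 0 := by
  filter_upwards [continuous_norm.continuousAt.eventually_const_lt hx] with y hy
  exact cut_eq_zero hr (le_of_lt hy)

theorem pd_cut_eq_zero (hr : 0 < r) (hx : ‖x‖ < r ∨ 2 * r < ‖x‖) (i : Fin 4) :
    pd i (cut r) x = 0 := by
  rcases hx with hx | hx
  · exact pd_eq_zero_of_eventuallyEq (cut_eventuallyEq_one hr hx) i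
  · exact pd_eq_zero_of_eventuallyEq (cut_eventuallyEq_zero hr hx) i

theorem lap_cut_eq_zero (hr : 0 < r) (hx : ‖x‖ < r ∨ 2 * r < ‖x‖) : lap (cut r) x = 0 := by
  rcases hx with hx | hx
  · exact lap_eq_zero_of_eventuallyEq (contDiff_cut r) (cut_eventuallyEq_one hr hx)
  · exact lap_eq_zero_of_eventuallyEq (contDiff_cut r) (cut_eventuallyEq_zero hr hx)

theorem exists_cut_bound : ∃ A : ℝ, 0 < A ∧ ∀ r : ℝ, 0 < r → ∀ x : Eu 4,
    ‖fderiv ℝ (cut r) x‖ ≤ A / r ∧ |lap (cut r) x| ≤ A / r ^ 2 := by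
  have hb : ContDiff ℝ ∞ unitBump := unitBump.contDiff
  have hc : HasCompactSupport unitBump := unitBump.hasCompactSupport
  obtain ⟨C, hC⟩ := (hb.continuous_fderiv (by simp)).bounded_above_of_compact_support
    (hc.fderiv ℝ)
  obtain ⟨D, hD⟩ := hb.lap.continuous.bounded_above_of_compact_support (HasCompactSupport.lap hb hc)
  have hC0 : 0 ≤ C := (norm_nonneg _).trans (hC 0)
  have hD0 : 0 ≤ D := (norm_nonneg _).trans (hD 0)
  refine ⟨C + D + 1, by positivity, fun r hr x => ⟨?_, ?_⟩⟩
  · have : fderiv ℝ (cut r) x = r⁻¹ • fderiv ℝ unitBump (r⁻¹ • x) :=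
      fderiv_comp_smul (f := unitBump) r⁻¹
    rw [this, norm_smul, norm_inv, Real.norm_of_nonneg hr.le, div_eq_inv_mul]
    gcongr
    linarith [hC (r⁻¹ • x)]
  · have : lap (cut r) x = r⁻¹ ^ 2 * lap unitBump (r⁻¹ • x) := lap_comp_smul hb _ _
    rw [this, abs_mul, abs_of_nonneg (by positivity), div_eq_inv_mul, inv_pow]
    gcongr
    have := hD (r⁻¹ • x)
    rw [Real.norm_eq_abs] at this
    linarith

theorem sum_pd_cut_sq_le {A : ℝ} (hA : ‖fderiv ℝ (cut r) x‖ ≤ A / r) :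
    ∑ i, pd i (cut r) x ^ 2 ≤ A ^ 2 / r ^ 2 := by
  rw [← norm_fderiv_sq, ← div_pow]
  gcongr

end Cutoff

section Energy
open scoped ContDiff Topology

/-- The squared length of the gradient. -/
def gradSq (u : Eu 4 → ℝ) (x : Eu 4) : ℝ := ∑ i, pd i u x ^ 2

/-- `Δu + |∇u|²`, which is `-R e^{2u} / 6`. -/
def confLap (u : Eu 4 → ℝ) (x : Eu 4) : ℝ := lap u x + gradSq u x

theorem two_abs_mul_le (a b : ℝ) {t : ℝ} (ht : 0 < t) : 2 * |a * b| ≤ t * a ^ 2 + b ^ 2 / t := by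
  have h : 0 ≤ (t * |a| - |b|) ^ 2 / t := by positivity
  have e : (t * |a| - |b|) ^ 2 / t = t * |a| ^ 2 - 2 * (|a| * |b|) + |b| ^ 2 / t := by
    field_simp
    ring
  rw [e, sq_abs, sq_abs] at h
  rw [abs_mul]
  linarith

variable {u : Eu 4 → ℝ}

theorem gradSq_nonneg (u : Eu 4 → ℝ) (x : Eu 4) : 0 ≤ gradSq u x :=
  Finset.sum_nonneg fun _ _ => sq_nonneg _

theorem ContDiff.gradSq (hu : ContDiff ℝ ∞ u) : ContDiff ℝ ∞ (gradSq u) :=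
  ContDiff.sum fun i _ => (hu.pd i).pow 2

theorem ContDiff.confLap (hu : ContDiff ℝ ∞ u) : ContDiff ℝ ∞ (confLap u) :=
  hu.lap.add hu.gradSq

theorem volume_real_closedBall_eq {r : ℝ} (hr : 0 ≤ r) :
    volume.real (closedBall (0 : Eu 4) r) = r ^ 4 * volume.real (closedBall (0 : Eu 4) 1) := by
  rw [Measure.addHaar_real_closedBall' _ _ hr]
  simp

theorem integral_gradSq_le (hu : ContDiff ℝ ∞ u) (hS : Integrable fun x => confLap u x ^ 2) :
    ∃ C : ℝ, 0 < C ∧ ∀ r : ℝ, 0 < r → ∫ x in closedBall 0 r, gradSq u x ≤ C * r ^ 2 := by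
  obtain ⟨A, hA0, hA⟩ := exists_cut_bound
  set v := volume.real (closedBall (0 : Eu 4) 1) with hv
  have hI : 0 ≤ ∫ x, confLap u x ^ 2 := integral_nonneg fun _ => sq_nonneg _
  refine ⟨(∫ x, confLap u x ^ 2) + (1 + 4 * A ^ 2) * 16 * v + 1, by positivity, fun r hr => ?_⟩
  set η := cut r
  have hη : ContDiff ℝ ∞ η := contDiff_cut r
  have hηc : HasCompactSupport η := hasCompactSupport_cut hr
  have hη2 : ContDiff ℝ ∞ fun x => η x * η x := hη.mul hη
  have hηηc : HasCompactSupport fun x => η x * η x := hηc.mul_right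
  have i1 : Integrable fun x => η x * η x * gradSq u x :=
    (hη2.continuous.mul hu.gradSq.continuous).integrable_of_hasCompactSupport hηηc.mul_right
  have i2 : Integrable fun x => η x * η x * lap u x :=
    (hη2.continuous.mul hu.lap.continuous).integrable_of_hasCompactSupport hηηc.mul_right
  have i3 : Integrable fun x => ∑ i, pd i (fun x => η x * η x) x * pd i u x :=
    integrable_finsetSum _ fun i _ =>
      ((hη2.pd i).continuous.mul (hu.pd i).continuous).integrable_of_hasCompactSupport
        (hηηc.pd i).mul_right
  have i4 : Integrable fun x => η x * η x * lap u x
      + ∑ i, pd i (fun x => η x * η x) x * pd i u x := i2.add i3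
  have hibp := integral_mul_div hη2 hηηc (fun i => hu.pd i)
  simp only [← lap_eq hu] at hibp
  have h1 : ∫ x in closedBall 0 r, gradSq u x ≤ ∫ x, η x * η x * gradSq u x := by
    rw [← integral_indicator isClosed_closedBall.measurableSet]
    refine integral_mono ((hu.gradSq.continuous.continuousOn.integrableOn_compact
      (isCompact_closedBall 0 r)).integrable_indicator isClosed_closedBall.measurableSet) i1
      fun x => ?_
    by_cases hx : x ∈ closedBall 0 r
    · simp [hx, η, cut_eq_one hr (mem_closedBall_zero_iff.1 hx)]
    · simp only [hx, not_false_eq_true, indicator_of_notMem]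
      exact mul_nonneg (mul_self_nonneg _) (gradSq_nonneg u x)
  have h2 : ∫ x, (η x * η x * gradSq u x) / 2 ≤
      ∫ x in closedBall 0 (2 * r),
        (r ^ 2 / 2 * confLap u x ^ 2 + (1 / 2 + 2 * A ^ 2) / r ^ 2) := by
    have e : ∫ x, (η x * η x * gradSq u x) / 2 = ∫ x, (η x * η x * lap u x
        + ∑ i, pd i (fun x => η x * η x) x * pd i u x + (η x * η x * gradSq u x) / 2) := by
      rw [integral_add i4 (i1.div_const 2), integral_add i2 i3, hibp]
      ring
    rw [e, ← integral_indicator isClosed_closedBall.measurableSet]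
    refine integral_mono ((i2.add i3).add (i1.div_const 2))
      (IntegrableOn.integrable_indicator ?_ isClosed_closedBall.measurableSet) fun x => ?_
    · exact (hS.const_mul _).integrableOn.add (integrableOn_const (by
        exact measure_closedBall_lt_top.ne))
    have hp : ∑ i, pd i (fun x => η x * η x) x * pd i u x
        = 2 * η x * ∑ i, pd i η x * pd i u x := by
      rw [Finset.mul_sum]
      refine Finset.sum_congr rfl fun i _ => ?_
      rw [pd_mul hη hη]
      ring
    by_cases hx : x ∈ closedBall 0 (2 * r)
    · simp only [hx, indicator_of_mem]
      rw [hp]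
      have a1 := sum_pd_cut_sq_le (hA r hr x).1
      have a2 : 2 * η x * ∑ i, pd i η x * pd i u x ≤
          (η x * η x * gradSq u x) / 2 + 2 * ∑ i, pd i η x ^ 2 := by
        simp only [gradSq, Finset.mul_sum, Finset.sum_div, ← Finset.sum_add_distrib]
        refine Finset.sum_le_sum fun i _ => ?_
        nlinarith [sq_nonneg (η x * pd i u x - 2 * pd i η x)]
      have a3 : η x * η x * confLap u x ≤ r ^ 2 / 2 * confLap u x ^ 2 + 1 / 2 / r ^ 2 := by
        have b1 : η x * η x ≤ 1 := mul_le_one₀ cut_le_one cut_nonneg cut_le_one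
        have b2 : |confLap u x| ≤ r ^ 2 / 2 * confLap u x ^ 2 + 1 / 2 / r ^ 2 := by
          have := two_abs_mul_le (confLap u x) 1 (pow_pos hr 2)
          rw [mul_one, one_pow] at this
          have e2 : 1 / 2 / r ^ 2 = (1 / r ^ 2) / 2 := by ring
          rw [e2]
          linarith
        calc η x * η x * confLap u x ≤ η x * η x * |confLap u x| :=
              mul_le_mul_of_nonneg_left (le_abs_self _) (mul_self_nonneg _)
          _ ≤ 1 * |confLap u x| := by gcongr
          _ ≤ _ := by linarith
      have a4 : (1 / 2 + 2 * A ^ 2) / r ^ 2 = 1 / 2 / r ^ 2 + 2 * (A ^ 2 / r ^ 2) := by ring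
      rw [a4]
      have a5 : η x * η x * confLap u x = η x * η x * lap u x + η x * η x * gradSq u x := by
        simp only [confLap]
        ring
      linarith
    · simp only [hx, not_false_eq_true, indicator_of_notMem]
      rw [hp]
      have : η x = 0 := cut_eq_zero hr (by
        rw [mem_closedBall_zero_iff, not_le] at hx
        exact hx.le)
      simp [this]
  rw [integral_div, integral_add (hS.const_mul _).integrableOn (integrableOn_const (by
        exact measure_closedBall_lt_top.ne)), integral_const_mul, setIntegral_const,
        volume_real_closedBall_eq (by positivity), ← hv, smul_eq_mul] at h2
  have h3 : ∫ x in closedBall 0 (2 * r), confLap u x ^ 2 ≤ ∫ x, confLap u x ^ 2 :=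
    setIntegral_le_integral hS (ae_of_all _ fun _ => sq_nonneg _)
  have h4 : (2 * r) ^ 4 * v * ((1 / 2 + 2 * A ^ 2) / r ^ 2) =
      (1 + 4 * A ^ 2) * 16 * v * r ^ 2 / 2 := by
    field_simp
    ring
  rw [h4] at h2
  have h5 : r ^ 2 / 2 * ∫ x in closedBall 0 (2 * r), confLap u x ^ 2 ≤
      r ^ 2 / 2 * ∫ x, confLap u x ^ 2 := by gcongr
  nlinarith [sq_nonneg r]

theorem integral_abs_lap_le (hu : ContDiff ℝ ∞ u) (hS : Integrable fun x => confLap u x ^ 2) :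
    ∃ C : ℝ, 0 < C ∧ ∀ r : ℝ, 0 < r → ∫ x in closedBall 0 r, |lap u x| ≤ C * r ^ 2 := by
  obtain ⟨C, hC0, hC⟩ := integral_gradSq_le hu hS
  set v := volume.real (closedBall (0 : Eu 4) 1) with hv
  have hI : 0 ≤ ∫ x, confLap u x ^ 2 := integral_nonneg fun _ => sq_nonneg _
  refine ⟨(∫ x, confLap u x ^ 2) + v + C, by positivity, fun r hr => ?_⟩
  have hK := isCompact_closedBall (0 : Eu 4) r
  have i1 : IntegrableOn (fun x => |lap u x|) (closedBall 0 r) :=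
    hu.lap.continuous.abs.continuousOn.integrableOn_compact hK
  have i2 : IntegrableOn (fun x => gradSq u x) (closedBall 0 r) :=
    hu.gradSq.continuous.continuousOn.integrableOn_compact hK
  have i3 : IntegrableOn (fun _ => 1 / r ^ 2) (closedBall (0 : Eu 4) r) :=
    continuousOn_const.integrableOn_compact hK
  have i4 : IntegrableOn (fun x => r ^ 2 * confLap u x ^ 2 + 1 / r ^ 2) (closedBall 0 r) :=
    (hS.const_mul _).integrableOn.add i3
  calc ∫ x in closedBall 0 r, |lap u x|
      ≤ ∫ x in closedBall 0 r, (r ^ 2 * confLap u x ^ 2 + 1 / r ^ 2 + gradSq u x) := by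
        refine setIntegral_mono i1 (i4.add i2) fun x => ?_
        have := two_abs_mul_le (confLap u x) 1 (pow_pos hr 2)
        rw [mul_one, one_pow] at this
        have t : |lap u x| ≤ |confLap u x| + gradSq u x := by
          have : lap u x = confLap u x - gradSq u x := by simp [confLap]
          rw [this]
          refine (abs_sub _ _).trans ?_
          rw [abs_of_nonneg (gradSq_nonneg u x)]
        have := abs_nonneg (confLap u x)
        change |lap u x| ≤ _
        linarith
    _ = r ^ 2 * (∫ x in closedBall 0 r, confLap u x ^ 2) + v * r ^ 2
          + ∫ x in closedBall 0 r, gradSq u x := by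
        rw [integral_add i4 i2,
          integral_add (hS.const_mul _).integrableOn i3, integral_const_mul, setIntegral_const,
          volume_real_closedBall_eq hr.le, ← hv, smul_eq_mul]
        field_simp
    _ ≤ _ := by
        have h3 : ∫ x in closedBall 0 r, confLap u x ^ 2 ≤ ∫ x, confLap u x ^ 2 :=
          setIntegral_le_integral hS (ae_of_all _ fun _ => sq_nonneg _)
        have h5 : r ^ 2 * ∫ x in closedBall 0 r, confLap u x ^ 2 ≤
          r ^ 2 * ∫ x, confLap u x ^ 2 := by gcongr
        linarith [hC r hr]

end Energy

section GaussBonnet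
open scoped ContDiff Topology

theorem tendsto_setIntegral_compl_ball {F : Eu 4 → ℝ} (hF : Integrable F) :
    Tendsto (fun r : ℝ => ∫ x in (ball 0 r)ᶜ, F x) atTop (𝓝 0) := by
  have h := (aecover_ball (μ := volume) (x := (0 : Eu 4))
    (tendsto_id (α := ℝ))).integral_tendsto_of_countably_generated hF
  have e : ∀ r : ℝ, ∫ x in (ball 0 r)ᶜ, F x = (∫ x, F x) - ∫ x in ball 0 r, F x := fun r => by
    rw [← integral_add_compl (measurableSet_ball (x := (0 : Eu 4)) (ε := r)) hF]
    ring
  simp only [e]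
  simpa using h.const_sub (∫ x, F x)

theorem tendsto_integral_cut_mul {F : Eu 4 → ℝ} (hF : Integrable F) :
    Tendsto (fun r : ℝ => ∫ x, cut r x * F x) atTop (𝓝 (∫ x, F x)) := by
  refine tendsto_integral_filter_of_dominated_convergence (fun x => |F x|) ?_ ?_ hF.abs ?_
  · exact Eventually.of_forall fun r =>
      (contDiff_cut r).continuous.aestronglyMeasurable.mul hF.aestronglyMeasurable
  · refine Eventually.of_forall fun r => ae_of_all _ fun x => ?_
    rw [norm_mul, Real.norm_of_nonneg cut_nonneg, Real.norm_eq_abs]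
    exact mul_le_of_le_one_left (abs_nonneg _) cut_le_one
  · refine ae_of_all _ fun x => tendsto_const_nhds.congr' ?_
    filter_upwards [eventually_ge_atTop ‖x‖, eventually_gt_atTop 0] with r h1 h2
    rw [cut_eq_one h2 h1, one_mul]

variable {u : Eu 4 → ℝ}

theorem schoutenMatrix_apply (hu : ContDiff ℝ ∞ u) (x : Eu 4) (i j : Fin 4) :
    schoutenMatrix u x i j = -pd i (pd j u) x + pd i u x * pd j u x -
      (1 / 2) * gradSq u x * (if i = j then 1 else 0) := by
  rw [schoutenMatrix, iteratedFDeriv_two_eq_pd hu, norm_gradient_sq, gradient_apply,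
    gradient_apply]
  rfl

theorem trace_schoutenMatrix (hu : ContDiff ℝ ∞ u) (x : Eu 4) :
    Matrix.trace (schoutenMatrix u x) = -confLap u x := by
  simp only [Matrix.trace, Matrix.diag, schoutenMatrix_apply hu, confLap, lap_eq hu, gradSq,
    Fin.sum_univ_four, if_true]
  ring

theorem sum_schoutenMatrix_sq (hu : ContDiff ℝ ∞ u) (x : Eu 4) :
    ∑ i, ∑ j, schoutenMatrix u x i j ^ 2 =
      confLap u x ^ 2 - 2 * sigma2 (schoutenMatrix u x) := by
  have hs : ∀ i j, schoutenMatrix u x j i = schoutenMatrix u x i j := fun i j => by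
    rw [schoutenMatrix_apply hu, schoutenMatrix_apply hu, pd_comm hu j i]
    simp only [eq_comm (a := j) (b := i)]
    ring
  have e : Matrix.trace (schoutenMatrix u x * schoutenMatrix u x) =
      ∑ i, ∑ j, schoutenMatrix u x i j ^ 2 := by
    simp only [Matrix.trace, Matrix.diag, Matrix.mul_apply]
    refine Finset.sum_congr rfl fun i _ => Finset.sum_congr rfl fun j _ => ?_
    rw [hs i j, sq]
  rw [sigma2, trace_schoutenMatrix hu, e]
  ring

theorem pd_gradSq (hu : ContDiff ℝ ∞ u) (i : Fin 4) (x : Eu 4) :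
    pd i (gradSq u) x = 2 * ∑ j, pd j u x * pd i (pd j u) x := by
  have : gradSq u = fun y => ∑ j, pd j u y * pd j u y := by
    funext y
    simp only [gradSq, sq]
  rw [this, pd_sum fun j => (hu.pd j).mul (hu.pd j), Finset.mul_sum]
  refine Finset.sum_congr rfl fun j _ => ?_
  rw [pd_mul (hu.pd j) (hu.pd j)]
  ring

theorem pd_lap (hu : ContDiff ℝ ∞ u) (i : Fin 4) : pd i (lap u) = lap (pd i u) := by
  funext x
  rw [funext (lap_eq hu), pd_sum fun j => (hu.pd j).pd j, lap_eq (hu.pd i)]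
  refine Finset.sum_congr rfl fun j _ => ?_
  rw [pd_comm (hu.pd j) i j, pd_comm hu i j]

theorem lap_gradSq (hu : ContDiff ℝ ∞ u) (x : Eu 4) :
    lap (gradSq u) x = 2 * (∑ i, ∑ j, pd i (pd j u) x ^ 2 + ∑ j, pd j u x * pd j (lap u) x) := by
  have h : ∀ i, pd i (gradSq u) = fun y => ∑ j, (pd j u y * pd i (pd j u) y
      + pd j u y * pd i (pd j u) y) := fun i => by
    funext y
    rw [pd_gradSq hu, Finset.sum_add_distrib]
    ring
  have hs : ∀ i j, ContDiff ℝ ∞ fun y => pd j u y * pd i (pd j u) y :=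
    fun i j => (hu.pd j).mul ((hu.pd j).pd i)
  simp only [pd_lap hu]
  rw [lap_eq hu.gradSq]
  simp only [h, lap_eq (hu.pd _), Finset.mul_sum]
  rw [Finset.sum_comm (f := fun j i => pd j u x * pd i (pd i (pd j u)) x),
    ← Finset.sum_add_distrib, Finset.mul_sum]
  refine Finset.sum_congr rfl fun i _ => ?_
  rw [pd_sum fun j => (hs i j).add (hs i j), ← Finset.sum_add_distrib, Finset.mul_sum]
  refine Finset.sum_congr rfl fun j _ => ?_
  rw [pd_add (hs i j) (hs i j), pd_mul (hu.pd j) ((hu.pd j).pd i)]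
  ring

theorem four_mul_sigma2 (hu : ContDiff ℝ ∞ u) (x : Eu 4) :
    4 * sigma2 (schoutenMatrix u x) = 2 * lap u x ^ 2 - 2 * ∑ i, ∑ j, pd i (pd j u) x ^ 2 +
      2 * lap u x * gradSq u x + 4 * ∑ i, ∑ j, pd i u x * pd j u x * pd i (pd j u) x := by
  have h := sum_schoutenMatrix_sq hu x
  have h2 : 4 * sigma2 (schoutenMatrix u x) =
      2 * confLap u x ^ 2 - 2 * ∑ i, ∑ j, schoutenMatrix u x i j ^ 2 := by linarith
  rw [h2]
  simp only [schoutenMatrix_apply hu, confLap, lap_eq hu, gradSq, Fin.sum_univ_four]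
  simp
  ring

theorem lap_lap_sub_sigma2 (hu : ContDiff ℝ ∞ u) (x : Eu 4) :
    lap (lap u) x - 4 * sigma2 (schoutenMatrix u x) =
      lap (confLap u) x - 2 * ∑ i, pd i (fun y => confLap u y * pd i u y) x := by
  have h1 : lap (confLap u) x = lap (lap u) x + lap (gradSq u) x := by
    rw [lap_eq hu.confLap, lap_eq hu.lap, lap_eq hu.gradSq, ← Finset.sum_add_distrib]
    refine Finset.sum_congr rfl fun i _ => ?_
    rw [show pd i (confLap u) = fun y => pd i (lap u) y + pd i (gradSq u) y from
      funext (pd_add hu.lap hu.gradSq i), pd_add (hu.lap.pd i) (hu.gradSq.pd i)]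
  have h2 : ∀ i, pd i (fun y => confLap u y * pd i u y) x = confLap u x * pd i (pd i u) x +
      (pd i (lap u) x + pd i (gradSq u) x) * pd i u x := fun i => by
    rw [pd_mul hu.confLap (hu.pd i)]
    congr 2
    exact pd_add hu.lap hu.gradSq i x
  rw [h1, lap_gradSq hu, four_mul_sigma2 hu]
  simp only [h2, pd_gradSq hu]
  rw [Finset.sum_add_distrib, ← Finset.mul_sum, ← lap_eq hu]
  have h3 : ∑ i, (pd i (lap u) x + 2 * ∑ j, pd j u x * pd i (pd j u) x) * pd i u x =
      (∑ j, pd j u x * pd j (lap u) x) +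
        2 * ∑ i, ∑ j, pd i u x * pd j u x * pd i (pd j u) x := by
    rw [Finset.mul_sum, ← Finset.sum_add_distrib]
    refine Finset.sum_congr rfl fun i _ => ?_
    rw [add_mul, mul_comm (pd i (lap u) x), mul_assoc, Finset.sum_mul]
    congr 2
    exact Finset.sum_congr rfl fun j _ => by ring
  rw [h3, confLap]
  ring

theorem sq_sum_pd_mul_le (F u : Eu 4 → ℝ) (x : Eu 4) :
    (∑ i, pd i F x * pd i u x) ^ 2 ≤ gradSq F x * gradSq u x :=
  Finset.sum_mul_sq_le_sq_mul_sq _ _ _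

/-- The Gauss–Bonnet identity `∫ Δ²u = 4 ∫ σ₂`. -/
theorem integral_lap_lap_eq (hu : ContDiff ℝ ∞ u) (hS : Integrable fun x => confLap u x ^ 2)
    (hf : Integrable (lap (lap u))) (hs : Integrable fun x => sigma2 (schoutenMatrix u x)) :
    ∫ x, lap (lap u) x = 4 * ∫ x, sigma2 (schoutenMatrix u x) := by
  obtain ⟨A, hA0, hA⟩ := exists_cut_bound
  obtain ⟨C, hC0, hC⟩ := integral_gradSq_le hu hS
  set v := volume.real (closedBall (0 : Eu 4) 1) with hv
  have hd : Integrable fun x => lap (lap u) x - 4 * sigma2 (schoutenMatrix u x) :=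
    hf.sub (hs.const_mul 4)
  have key : ∀ t : ℝ, 0 < t → ∀ r : ℝ, 0 < r →
      |∫ x, cut r x * (lap (lap u) x - 4 * sigma2 (schoutenMatrix u x))| ≤
        2 * t * (∫ x in (ball 0 r)ᶜ, confLap u x ^ 2) + A ^ 2 * (16 * v + 4 * C) / t := by
    intro t ht r hr
    set η := cut r
    have hη : ContDiff ℝ ∞ η := contDiff_cut r
    have hηc : HasCompactSupport η := hasCompactSupport_cut hr
    have hV : ∀ i, ContDiff ℝ ∞ fun y => confLap u y * pd i u y :=
      fun i => hu.confLap.mul (hu.pd i)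
    have hdiv : ContDiff ℝ ∞ fun x => ∑ i, pd i (fun y => confLap u y * pd i u y) x :=
      ContDiff.sum fun i _ => (hV i).pd i
    have e1 : ∫ x, η x * (lap (lap u) x - 4 * sigma2 (schoutenMatrix u x)) =
        ∫ x, confLap u x * (lap η x + 2 * ∑ i, pd i η x * pd i u x) := by
      have j1 : Integrable fun x => η x * lap (confLap u) x :=
        (hη.continuous.mul hu.confLap.lap.continuous).integrable_of_hasCompactSupport
          hηc.mul_right
      have j2 : Integrable fun x =>
          2 * (η x * ∑ i, pd i (fun y => confLap u y * pd i u y) x) :=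
        ((hη.continuous.mul hdiv.continuous).integrable_of_hasCompactSupport
          hηc.mul_right).const_mul 2
      have j3 : Integrable fun x => lap η x * confLap u x :=
        (hη.lap.continuous.mul hu.confLap.continuous).integrable_of_hasCompactSupport
          (HasCompactSupport.lap hη hηc).mul_right
      have j4 : Integrable fun x => 2 * ∑ i, pd i η x * (confLap u x * pd i u x) :=
        (integrable_finsetSum _ fun i _ =>
          ((hη.pd i).continuous.mul (hV i).continuous).integrable_of_hasCompactSupport
            (hηc.pd i).mul_right).const_mul 2
      calc _ = ∫ x, (η x * lap (confLap u) x
              - 2 * (η x * ∑ i, pd i (fun y => confLap u y * pd i u y) x)) := by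
            congr 1
            funext x
            rw [lap_lap_sub_sigma2 hu]
            ring
        _ = ∫ x, (lap η x * confLap u x + 2 * ∑ i, pd i η x * (confLap u x * pd i u x)) := by
            rw [integral_sub j1 j2, integral_add j3 j4, integral_const_mul, integral_const_mul,
              integral_mul_div hη hηc hV, integral_lap_mul hη hu.confLap hηc]
            ring
        _ = _ := by
            congr 1
            funext x
            rw [mul_add, mul_comm (lap η x)]
            congr 1
            rw [Finset.mul_sum, Finset.mul_sum, Finset.mul_sum]
            exact Finset.sum_congr rfl fun i _ => by ring
    rw [e1]
    have k1 : IntegrableOn (fun x => 2 * t * confLap u x ^ 2) (ball (0 : Eu 4) r)ᶜ :=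
      (hS.const_mul _).integrableOn
    have k2 : IntegrableOn (fun x => A ^ 2 / t * (1 / r ^ 4 + gradSq u x / r ^ 2))
        (closedBall (0 : Eu 4) (2 * r)) :=
      (Continuous.continuousOn (by
        have := hu.gradSq.continuous
        fun_prop)).integrableOn_compact (isCompact_closedBall _ _)
    have k3 : IntegrableOn (fun x => gradSq u x / r ^ 2) (closedBall (0 : Eu 4) (2 * r)) :=
      (hu.gradSq.continuous.div_const _).continuousOn.integrableOn_compact
        (isCompact_closedBall _ _)
    have k4 : IntegrableOn (fun _ => 1 / r ^ 4) (closedBall (0 : Eu 4) (2 * r)) :=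
      continuousOn_const.integrableOn_compact (isCompact_closedBall _ _)
    have m1 : MeasurableSet (ball (0 : Eu 4) r)ᶜ := measurableSet_ball.compl
    have m2 : MeasurableSet (closedBall (0 : Eu 4) (2 * r)) := isClosed_closedBall.measurableSet
    have e2 : |∫ x, confLap u x * (lap η x + 2 * ∑ i, pd i η x * pd i u x)| ≤
        ∫ x, ((ball (0 : Eu 4) r)ᶜ.indicator (fun x => 2 * t * confLap u x ^ 2) x +
          (closedBall (0 : Eu 4) (2 * r)).indicator
            (fun x => A ^ 2 / t * (1 / r ^ 4 + gradSq u x / r ^ 2)) x) := by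
      rw [← Real.norm_eq_abs]
      refine norm_integral_le_of_norm_le ((k1.integrable_indicator m1).add
        (k2.integrable_indicator m2)) (ae_of_all _ fun x => ?_)
      rw [Real.norm_eq_abs]
      by_cases hx : ‖x‖ < r ∨ 2 * r < ‖x‖
      · have : confLap u x * (lap η x + 2 * ∑ i, pd i η x * pd i u x) = 0 := by
          simp [η, lap_cut_eq_zero hr hx, pd_cut_eq_zero hr hx]
        rw [this, abs_zero]
        refine add_nonneg (indicator_nonneg (fun y _ => by positivity) _)
          (indicator_nonneg (fun y _ => ?_) _)
        have := gradSq_nonneg u y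
        positivity
      · push Not at hx
        rw [indicator_of_mem (by simpa using hx.1), indicator_of_mem (by simpa using hx.2)]
        have a1 := two_abs_mul_le (confLap u x) (lap η x) ht
        have a2 := two_abs_mul_le (confLap u x) (∑ i, pd i η x * pd i u x) ht
        have a3 : lap η x ^ 2 ≤ A ^ 2 * (1 / r ^ 4) := by
          have := (hA r hr x).2
          calc lap η x ^ 2 = |lap η x| ^ 2 := (sq_abs _).symm
            _ ≤ (A / r ^ 2) ^ 2 := by gcongr
            _ = _ := by field_simp
        have a4 : (∑ i, pd i η x * pd i u x) ^ 2 ≤ A ^ 2 * (gradSq u x / r ^ 2) := by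
          refine (sq_sum_pd_mul_le η u x).trans ?_
          have := sum_pd_cut_sq_le (hA r hr x).1
          calc gradSq η x * gradSq u x ≤ A ^ 2 / r ^ 2 * gradSq u x :=
                mul_le_mul_of_nonneg_right this (gradSq_nonneg u x)
            _ = _ := by ring
        have a5 : lap η x ^ 2 / t + (∑ i, pd i η x * pd i u x) ^ 2 / t ≤
            A ^ 2 / t * (1 / r ^ 4 + gradSq u x / r ^ 2) := by
          rw [← add_div, div_mul_eq_mul_div]
          gcongr
          linarith
        have a6 : |confLap u x * (lap η x + 2 * ∑ i, pd i η x * pd i u x)| ≤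
            |confLap u x * lap η x| + 2 * |confLap u x * ∑ i, pd i η x * pd i u x| := by
          have : confLap u x * (lap η x + 2 * ∑ i, pd i η x * pd i u x) =
            confLap u x * lap η x + 2 * (confLap u x * ∑ i, pd i η x * pd i u x) := by ring
          rw [this]
          refine (abs_add_le _ _).trans ?_
          rw [abs_mul 2, abs_two]
        have a7 := abs_nonneg (confLap u x * lap η x)
        linarith
    refine e2.trans ?_
    rw [integral_add (k1.integrable_indicator m1) (k2.integrable_indicator m2),
      integral_indicator m1, integral_indicator m2, integral_const_mul, integral_const_mul,
      integral_add k4 k3, setIntegral_const, volume_real_closedBall_eq (by positivity), ← hv,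
      integral_div, smul_eq_mul]
    have h5 : (2 * r) ^ 4 * v * (1 / r ^ 4) = 16 * v := by
      field_simp
      ring
    have h6 : (∫ x in closedBall 0 (2 * r), gradSq u x) / r ^ 2 ≤ 4 * C := by
      rw [div_le_iff₀ (by positivity)]
      have := hC (2 * r) (by positivity)
      linarith
    rw [h5, div_mul_eq_mul_div]
    gcongr
  have lim : ∀ t : ℝ, 0 < t →
      |∫ x, (lap (lap u) x - 4 * sigma2 (schoutenMatrix u x))| ≤
        A ^ 2 * (16 * v + 4 * C) / t := by
    intro t ht
    have l1 := (tendsto_integral_cut_mul hd).abs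
    have l2 := ((tendsto_setIntegral_compl_ball hS).const_mul (2 * t)).add_const
      (A ^ 2 * (16 * v + 4 * C) / t)
    rw [mul_zero, zero_add] at l2
    refine le_of_tendsto_of_tendsto l1 l2 ?_
    filter_upwards [eventually_gt_atTop 0] with r hr
    exact key t ht r hr
  have h0 : |∫ x, (lap (lap u) x - 4 * sigma2 (schoutenMatrix u x))| ≤ 0 := by
    refine ge_of_tendsto (tendsto_const_nhds.div_atTop tendsto_id)
      ((eventually_gt_atTop 0).mono lim)
  have h1 := abs_nonpos_iff.1 h0
  rw [integral_sub hf (hs.const_mul 4), integral_const_mul] at h1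
  linarith

end GaussBonnet

section Kernel
open scoped ContDiff Topology

theorem pd_comp_sub {n : ℕ} (F : Eu n → ℝ) (a : Eu n) (i : Fin n) :
    pd i (fun x => F (x - a)) = fun x => pd i F (x - a) := by
  funext x
  unfold pd
  rw [fderiv_comp_sub]

theorem lap_comp_sub {n : ℕ} {F : Eu n → ℝ} (hF : ContDiff ℝ ∞ F) (a x : Eu n) :
    lap (fun x => F (x - a)) x = lap F (x - a) := by
  have h : ContDiff ℝ ∞ fun x => F (x - a) := hF.comp (contDiff_id.sub contDiff_const)
  rw [lap_eq h, lap_eq hF]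
  refine Finset.sum_congr rfl fun i _ => ?_
  rw [pd_comp_sub, pd_comp_sub]

/-- The regularized Newtonian kernel `1 / (|z|² + ε²)` of `ℝ⁴`. -/
def newt (ε : ℝ) (z : Eu 4) : ℝ := (‖z‖ ^ 2 + ε ^ 2)⁻¹

variable {ε : ℝ} {z : Eu 4}

theorem newt_denom_pos (hε : 0 < ε) (z : Eu 4) : 0 < ‖z‖ ^ 2 + ε ^ 2 := by positivity

theorem newt_pos (hε : 0 < ε) (z : Eu 4) : 0 < newt ε z := inv_pos.2 (newt_denom_pos hε z)

theorem newt_neg (z : Eu 4) : newt ε (-z) = newt ε z := by simp [newt]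

theorem newt_sub_comm (x y : Eu 4) : newt ε (x - y) = newt ε (y - x) := by
  rw [← newt_neg, neg_sub]

theorem contDiff_newt (hε : 0 < ε) : ContDiff ℝ ∞ (newt ε) :=
  ((contDiff_norm_sq ℝ).add contDiff_const).inv fun z => (newt_denom_pos hε z).ne'

theorem norm_sq_mul_newt (hε : 0 < ε) (z : Eu 4) :
    ‖z‖ ^ 2 * newt ε z = 1 - ε ^ 2 * newt ε z := by
  have := newt_denom_pos hε z
  unfold newt
  field_simp
  ring

theorem newt_le (ε : ℝ) {s : ℝ} (hs : 0 < s) (hz : s ≤ ‖z‖) : newt ε z ≤ 1 / s ^ 2 := by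
  unfold newt
  rw [← one_div]
  have : s ^ 2 ≤ ‖z‖ ^ 2 := by gcongr
  gcongr
  nlinarith

theorem contDiff_coord {n : ℕ} (i : Fin n) : ContDiff ℝ ∞ fun z : Eu n => z i :=
  (EuclideanSpace.proj i : Eu n →L[ℝ] ℝ).contDiff

theorem pd_coord {n : ℕ} (i j : Fin n) (z : Eu n) :
    pd i (fun z : Eu n => z j) z = if i = j then 1 else 0 := by
  unfold pd
  rw [show (fun z : Eu n => z j) =
    ((EuclideanSpace.proj j : Eu n →L[ℝ] ℝ) : Eu n → ℝ) from rfl,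
    ContinuousLinearMap.fderiv]
  simp [eq_comm]

theorem pd_newt (hε : 0 < ε) (i : Fin 4) (z : Eu 4) :
    pd i (newt ε) z = -2 * z i * newt ε z ^ 2 := by
  have h1 : HasFDerivAt (fun z : Eu 4 => ‖z‖ ^ 2 + ε ^ 2) (2 • innerSL ℝ z) z :=
    (HasStrictFDerivAt.hasFDerivAt (hasStrictFDerivAt_norm_sq z)).add_const _
  have h2 := (hasDerivAt_inv (newt_denom_pos hε z).ne').comp_hasFDerivAt z h1
  have h3 : fderiv ℝ (newt ε) z = _ := h2.fderiv
  rw [pd, h3]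
  simp only [newt, smul_apply, innerSL_apply_apply, smul_eq_mul, nsmul_eq_mul,
    EuclideanSpace.inner_single_right]
  simp
  ring

theorem gradSq_newt (hε : 0 < ε) (z : Eu 4) :
    gradSq (newt ε) z = 4 * ‖z‖ ^ 2 * newt ε z ^ 4 := by
  simp only [gradSq, pd_newt hε, EuclideanSpace.norm_sq_eq, Fin.sum_univ_four, Real.norm_eq_abs,
    sq_abs]
  ring

theorem gradSq_newt_le (hε : 0 < ε) (z : Eu 4) : gradSq (newt ε) z ≤ 4 * newt ε z ^ 3 := by
  have h := norm_sq_mul_newt hε z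
  have h0 := newt_pos hε z
  rw [gradSq_newt hε, show 4 * ‖z‖ ^ 2 * newt ε z ^ 4 =
    4 * (‖z‖ ^ 2 * newt ε z) * newt ε z ^ 3 by ring, h]
  have : 0 < ε ^ 2 * newt ε z := by positivity
  gcongr
  linarith

theorem lap_newt (hε : 0 < ε) (z : Eu 4) : lap (newt ε) z = -8 * ε ^ 2 * newt ε z ^ 3 := by
  have hn := contDiff_newt hε
  have h : ∀ i, pd i (pd i (newt ε)) z = -2 * newt ε z ^ 2 + 8 * z i ^ 2 * newt ε z ^ 3 := by
    intro i
    have e : pd i (newt ε) = fun z => (-2 * z i) * (newt ε z * newt ε z) := by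
      funext z
      rw [pd_newt hε]
      ring
    have e2 : pd i (fun z : Eu 4 => -2 * z i) z = -2 := by
      rw [pd_mul contDiff_const (contDiff_coord i), pd_coord]
      simp [pd]
    rw [e, pd_mul (contDiff_const.mul (contDiff_coord i)) (hn.mul hn), pd_mul hn hn, e2,
      pd_newt hε]
    ring
  have h2 := norm_sq_mul_newt hε z
  rw [EuclideanSpace.norm_sq_eq] at h2
  simp only [Fin.sum_univ_four, Real.norm_eq_abs, sq_abs] at h2
  rw [lap_eq hn]
  simp only [h, Fin.sum_univ_four]
  linear_combination 8 * newt ε z ^ 2 * h2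

/-- Hardy's inequality on `ℝ⁴`, for the square of a function `√ρ` with `|∇√ρ| ≤ |K|`. -/
theorem hardy {ρ K : Eu 4 → ℝ} (hρ : ContDiff ℝ ∞ ρ) (hρc : HasCompactSupport ρ)
    (hρ0 : ∀ x, 0 ≤ ρ x) (hK : Integrable fun x => K x ^ 2)
    (h : ∀ x, gradSq ρ x ≤ 4 * ρ x * K x ^ 2) (hε : 0 < ε) (y : Eu 4) :
    ∫ x, ρ x * newt ε (x - y) ≤ ∫ x, K x ^ 2 := by
  have hs : ContDiff ℝ ∞ fun x : Eu 4 => x - y := contDiff_id.sub contDiff_const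
  have hn : ContDiff ℝ ∞ fun x => newt ε (x - y) := (contDiff_newt hε).comp hs
  have hc : ∀ i, ContDiff ℝ ∞ fun x : Eu 4 => (x - y) i := fun i => (contDiff_coord i).comp hs
  have hV : ∀ i, ContDiff ℝ ∞ fun x : Eu 4 => (x - y) i * newt ε (x - y) :=
    fun i => (hc i).mul hn
  have hdiv : ∀ x, ∑ i, pd i (fun x : Eu 4 => (x - y) i * newt ε (x - y)) x =
      2 * newt ε (x - y) + 2 * ε ^ 2 * newt ε (x - y) ^ 2 := by
    intro x
    have h1 : ∀ i, pd i (fun x : Eu 4 => (x - y) i * newt ε (x - y)) x =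
        -2 * (x - y) i ^ 2 * newt ε (x - y) ^ 2 + newt ε (x - y) := fun i => by
      rw [pd_mul (hc i) hn, pd_comp_sub, pd_comp_sub (fun z : Eu 4 => z i)]
      simp only [pd_newt hε, pd_coord, if_true]
      ring
    have h2 := norm_sq_mul_newt hε (x - y)
    rw [EuclideanSpace.norm_sq_eq] at h2
    simp only [Fin.sum_univ_four, Real.norm_eq_abs, sq_abs] at h2
    simp only [h1, Fin.sum_univ_four]
    linear_combination -2 * newt ε (x - y) * h2
  have key := integral_mul_div hρ hρc hV
  have i1 : Integrable fun x => ρ x * newt ε (x - y) :=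
    (hρ.continuous.mul hn.continuous).integrable_of_hasCompactSupport hρc.mul_right
  have i2 : Integrable fun x =>
      ρ x * ∑ i, pd i (fun x : Eu 4 => (x - y) i * newt ε (x - y)) x :=
    (hρ.continuous.mul (continuous_finsetSum _ fun i _ =>
      ((hV i).pd i).continuous)).integrable_of_hasCompactSupport hρc.mul_right
  have a1 : 2 * ∫ x, ρ x * newt ε (x - y) ≤
      ∫ x, ρ x * ∑ i, pd i (fun x : Eu 4 => (x - y) i * newt ε (x - y)) x := by
    rw [← integral_const_mul]
    refine integral_mono (i1.const_mul 2) i2 fun x => ?_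
    have := hρ0 x
    have h2 : 0 ≤ ρ x * (2 * ε ^ 2 * newt ε (x - y) ^ 2) := by positivity
    simp only [hdiv]
    linarith
  have a2 : -∫ x, ∑ i, pd i ρ x * ((x - y) i * newt ε (x - y)) ≤
      ∫ x, (ρ x * newt ε (x - y) + K x ^ 2) := by
    rw [← integral_neg]
    refine integral_mono (Integrable.neg ?_) (i1.add hK) fun x => ?_
    · exact integrable_finsetSum _ fun i _ =>
        ((hρ.pd i).continuous.mul (hV i).continuous).integrable_of_hasCompactSupport
          (hρc.pd i).mul_right
    have b1 : (∑ i, pd i ρ x * ((x - y) i * newt ε (x - y))) ^ 2 ≤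
        gradSq ρ x * (‖x - y‖ ^ 2 * newt ε (x - y) ^ 2) := by
      refine (Finset.sum_mul_sq_le_sq_mul_sq _ _ _).trans_eq ?_
      simp only [gradSq, mul_pow, Real.norm_eq_abs, sq_abs, EuclideanSpace.norm_sq_eq,
        ← Finset.sum_mul]
    have b2 : ‖x - y‖ ^ 2 * newt ε (x - y) ^ 2 ≤ newt ε (x - y) := by
      have h2 := norm_sq_mul_newt hε (x - y)
      have h3 := newt_pos hε (x - y)
      have : 0 < ε ^ 2 * newt ε (x - y) * newt ε (x - y) := by positivity
      calc ‖x - y‖ ^ 2 * newt ε (x - y) ^ 2 = ‖x - y‖ ^ 2 * newt ε (x - y) * newt ε (x - y) := by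
            ring
        _ = newt ε (x - y) - ε ^ 2 * newt ε (x - y) * newt ε (x - y) := by rw [h2]; ring
        _ ≤ _ := by linarith
    have b3 : (∑ i, pd i ρ x * ((x - y) i * newt ε (x - y))) ^ 2 ≤
        (ρ x * newt ε (x - y) + K x ^ 2) ^ 2 := by
      calc _ ≤ _ := b1
        _ ≤ (4 * ρ x * K x ^ 2) * newt ε (x - y) :=
            mul_le_mul (h x) b2 (by positivity) ((gradSq_nonneg _ _).trans (h x))
        _ ≤ _ := by nlinarith [sq_nonneg (ρ x * newt ε (x - y) - K x ^ 2)]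
    have b4 := abs_le_of_sq_le_sq b3
      (by have := hρ0 x; have := newt_pos hε (x - y); positivity)
    exact (neg_le_abs _).trans b4
  rw [integral_add i1 hK] at a2
  rw [key] at a1
  linarith

end Kernel

section KernelMass
open scoped ContDiff Topology

theorem integrable_newt_one_pow : Integrable fun z : Eu 4 => 8 * newt 1 z ^ 3 := by
  have h := integrable_rpow_neg_one_add_norm_sq (E := Eu 4) (μ := volume) (r := 6)
    (by simp; norm_num)
  refine (h.const_mul 8).congr (ae_of_all _ fun z => ?_)
  have : (0 : ℝ) < 1 + ‖z‖ ^ 2 := by positivity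
  simp only [newt]
  rw [show (-(6 : ℝ) / 2) = -((3 : ℕ) : ℝ) by norm_num, Real.rpow_neg this.le, Real.rpow_natCast]
  simp [add_comm]

theorem volume_real_ball_one : volume.real (ball (0 : Eu 4) 1) = Real.pi ^ 2 / 2 := by
  rw [Measure.real, EuclideanSpace.volume_ball]
  have : Real.Gamma (4 / 2 + 1) = 2 := by
    rw [show (4 / 2 + 1 : ℝ) = (2 : ℕ) + 1 by norm_num, Real.Gamma_nat_eq_factorial]
    norm_num
  have h2 : √Real.pi ^ 4 = Real.pi ^ 2 := by
    rw [show √Real.pi ^ 4 = (√Real.pi ^ 2) ^ 2 by ring, Real.sq_sqrt Real.pi_pos.le]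
  simp only [Fintype.card_fin, ENNReal.ofReal_one, one_pow, one_mul, Nat.cast_ofNat, this, h2]
  rw [ENNReal.toReal_ofReal (by positivity)]

theorem integral_newt_one_pow : ∫ z : Eu 4, 8 * newt 1 z ^ 3 = 4 * Real.pi ^ 2 := by
  have h := integral_fun_norm_addHaar (E := Eu 4) volume fun t : ℝ => 8 * ((t ^ 2 + 1 ^ 2)⁻¹) ^ 3
  simp only [newt]
  rw [h, volume_real_ball_one]
  have hd : ∀ t ∈ Ici (0 : ℝ), HasDerivAt (fun t : ℝ => 2 * (t ^ 2 / (t ^ 2 + 1)) ^ 2)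
      (t ^ (Module.finrank ℝ (Eu 4) - 1) • (8 * ((t ^ 2 + 1 ^ 2)⁻¹) ^ 3)) t := by
    intro t _
    have h0 : t ^ 2 + 1 ≠ 0 := by positivity
    have e1 : HasDerivAt (fun t : ℝ => t ^ 2) (2 * t) t := by simpa using hasDerivAt_pow 2 t
    have e2 := ((e1.div (e1.add_const 1) h0).pow 2).const_mul 2
    refine e2.congr_deriv ?_
    simp
    field_simp
    ring
  have hl : Tendsto (fun t : ℝ => 2 * (t ^ 2 / (t ^ 2 + 1)) ^ 2) atTop (𝓝 (2 * 1 ^ 2)) := by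
    refine Tendsto.const_mul 2 (Tendsto.pow ?_ 2)
    have : Tendsto (fun t : ℝ => 1 - (t ^ 2 + 1)⁻¹) atTop (𝓝 (1 - 0)) :=
      (tendsto_inv_atTop_zero.comp
        (tendsto_atTop_add_const_right _ _ (tendsto_pow_atTop two_ne_zero))).const_sub 1
    rw [sub_zero] at this
    refine this.congr fun t => ?_
    have : t ^ 2 + 1 ≠ 0 := by positivity
    field_simp
    ring
  rw [integral_Ioi_of_hasDerivAt_of_nonneg' hd ?_ hl]
  · simp
  · intro t ht
    have : (0 : ℝ) < t := ht
    positivity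

variable {b ρ : Eu 4 → ℝ}

theorem integral_mul_lap_newt (ε : ℝ) (hε : 0 < ε) (x : Eu 4) :
    ∫ y, b y * lap (newt ε) (y - x) = -∫ z, b (x + ε • z) * (8 * newt 1 z ^ 3) := by
  have h1 := Measure.integral_comp_smul (μ := (volume : Measure (Eu 4)))
    (fun y => b (x + y) * (8 * ε ^ 2 * newt ε y ^ 3)) ε
  have h2 := integral_add_left_eq_self (μ := (volume : Measure (Eu 4)))
    (fun y => b y * lap (newt ε) (y - x)) x
  rw [← h2, ← integral_neg]
  simp only [add_sub_cancel_left, lap_newt hε]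
  have e : ∀ z : Eu 4, b (x + ε • z) * (8 * newt 1 z ^ 3) =
      ε ^ 4 * (b (x + ε • z) * (8 * ε ^ 2 * newt ε (ε • z) ^ 3)) := by
    intro z
    have : newt 1 z = ε ^ 2 * newt ε (ε • z) := by
      unfold newt
      rw [norm_smul, Real.norm_of_nonneg hε.le]
      have : ‖z‖ ^ 2 + 1 ^ 2 ≠ 0 := by positivity
      have : (ε * ‖z‖) ^ 2 + ε ^ 2 ≠ 0 := by positivity
      field_simp
    rw [this]
    ring
  simp only [e]
  rw [integral_neg, integral_const_mul, h1]
  simp only [finrank_euclideanSpace, Fintype.card_fin, smul_eq_mul]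
  rw [abs_of_pos (by positivity), ← mul_assoc, mul_inv_cancel₀ (by positivity), one_mul,
    ← integral_neg]
  congr 1
  funext y
  ring

theorem tendsto_integral_mul_lap_newt (hb : Continuous b) (hbc : HasCompactSupport b)
    (hρ : Continuous ρ) (hρc : HasCompactSupport ρ) :
    Tendsto (fun ε : ℝ => ∫ x, ρ x * ∫ y, b y * lap (newt ε) (y - x)) (𝓝[>] 0)
      (𝓝 (-(4 * Real.pi ^ 2) * ∫ x, ρ x * b x)) := by
  obtain ⟨B, hB⟩ := hbc.exists_bound_of_continuous hb
  have hk := integrable_newt_one_pow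
  have hk0 : ∀ z : Eu 4, 0 ≤ 8 * newt 1 z ^ 3 := fun z => by
    have := newt_pos one_pos z
    positivity
  have key : Tendsto (fun ε : ℝ => ∫ x, ρ x * ∫ z, b (x + ε • z) * (8 * newt 1 z ^ 3)) (𝓝 0)
      (𝓝 (∫ x, ρ x * ∫ z, b x * (8 * newt 1 z ^ 3))) := by
    have hi : ∀ x (ε : ℝ), |∫ z, b (x + ε • z) * (8 * newt 1 z ^ 3)| ≤
        ∫ z : Eu 4, B * (8 * newt 1 z ^ 3) := fun x ε => by
      rw [← Real.norm_eq_abs]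
      refine norm_integral_le_of_norm_le (hk.const_mul B) (ae_of_all _ fun z => ?_)
      rw [norm_mul, Real.norm_of_nonneg (hk0 z)]
      exact mul_le_mul_of_nonneg_right (hB _) (hk0 z)
    have hcx : ∀ ε : ℝ, Continuous fun x => ∫ z, b (x + ε • z) * (8 * newt 1 z ^ 3) := fun ε => by
      refine continuous_of_dominated (bound := fun z => B * (8 * newt 1 z ^ 3)) (fun x => ?_)
        (fun x => ae_of_all _ fun z => ?_) (hk.const_mul B) (ae_of_all _ fun z => by fun_prop)
      · exact (by fun_prop : Continuous fun z => b (x + ε • z)).aestronglyMeasurable.mul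
          hk.aestronglyMeasurable
      · rw [norm_mul, Real.norm_of_nonneg (hk0 z)]
        exact mul_le_mul_of_nonneg_right (hB _) (hk0 z)
    refine tendsto_integral_filter_of_dominated_convergence
      (fun x => |ρ x| * ∫ z : Eu 4, B * (8 * newt 1 z ^ 3)) ?_ ?_ ?_ ?_
    · exact Eventually.of_forall fun ε => (hρ.mul (hcx ε)).aestronglyMeasurable
    · refine Eventually.of_forall fun ε => ae_of_all _ fun x => ?_
      rw [norm_mul]
      exact mul_le_mul_of_nonneg_left (hi x ε) (abs_nonneg _)
    · exact (hρ.abs.integrable_of_hasCompactSupport hρc.abs).mul_const _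
    · refine ae_of_all _ fun x => Tendsto.const_mul _ ?_
      refine tendsto_integral_filter_of_dominated_convergence (fun z => B * (8 * newt 1 z ^ 3))
        ?_ ?_ (hk.const_mul B) ?_
      · exact Eventually.of_forall fun ε =>
          (by fun_prop : Continuous fun z => b (x + ε • z)).aestronglyMeasurable.mul
            hk.aestronglyMeasurable
      · refine Eventually.of_forall fun ε => ae_of_all _ fun z => ?_
        rw [norm_mul, Real.norm_of_nonneg (hk0 z)]
        exact mul_le_mul_of_nonneg_right (hB _) (hk0 z)
      · refine ae_of_all _ fun z => Tendsto.mul_const _ ?_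
        have : Continuous fun ε : ℝ => b (x + ε • z) := by fun_prop
        simpa using this.tendsto 0
  have k2 := (key.mono_left nhdsWithin_le_nhds : Tendsto _ (𝓝[>] (0 : ℝ)) _).neg
  have e : -(4 * Real.pi ^ 2) * ∫ x, ρ x * b x =
      -∫ x, ρ x * ∫ z, b x * (8 * newt 1 z ^ 3) := by
    have hx : ∀ x, ∫ z, b x * (8 * newt 1 z ^ 3) = b x * (4 * Real.pi ^ 2) := fun x => by
      rw [integral_const_mul, integral_newt_one_pow]
    simp only [hx]
    simp only [← mul_assoc, integral_mul_const]
    ring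
  rw [e]
  refine k2.congr' ?_
  filter_upwards [self_mem_nhdsWithin] with ε hε
  simp only [integral_mul_lap_newt ε hε, mul_neg, integral_neg]

end KernelMass

section Representation
open scoped ContDiff Topology

theorem continuous_integral_mul_comp_sub {b Φ : Eu 4 → ℝ} (hb : Continuous b)
    (hbc : HasCompactSupport b) (hΦ : Continuous Φ) :
    Continuous fun x => ∫ y, b y * Φ (y - x) := by
  rw [← continuousOn_univ]
  refine continuousOn_integral_of_compact_support (k := tsupport b) hbc
    (f := fun x y => b y * Φ (y - x)) ?_ fun p y _ hy => ?_
  · have : Continuous fun q : Eu 4 × Eu 4 => b q.2 * Φ (q.2 - q.1) := by fun_prop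
    exact this.continuousOn
  · rw [image_eq_zero_of_notMem_tsupport hy, zero_mul]

theorem integral_mul_integral_newt_comm {ρ b : Eu 4 → ℝ} (hρ : Continuous ρ)
    (hρc : HasCompactSupport ρ) (hb : Continuous b) (hbc : HasCompactSupport b) {ε : ℝ}
    (hε : 0 < ε) :
    ∫ x, ρ x * ∫ y, b y * newt ε (y - x) = ∫ y, b y * ∫ x, ρ x * newt ε (x - y) := by
  simp only [← integral_const_mul]
  have hn := (contDiff_newt hε).continuous
  rw [integral_integral_swap_of_hasCompactSupport (f := fun x y => ρ x * (b y * newt ε (y - x)))]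
  · congr 1
    funext y
    congr 1
    funext x
    rw [newt_sub_comm]
    ring
  · have : Continuous fun q : Eu 4 × Eu 4 => ρ q.1 * (b q.2 * newt ε (q.2 - q.1)) := by fun_prop
    exact this
  · refine HasCompactSupport.of_support_subset_isCompact (hρc.prod hbc) fun q hq => ?_
    have h1 : ρ q.1 * (b q.2 * newt ε (q.2 - q.1)) ≠ 0 := hq
    exact ⟨subset_tsupport _ (left_ne_zero_of_mul h1),
      subset_tsupport _ (left_ne_zero_of_mul (right_ne_zero_of_mul h1))⟩

variable {u : Eu 4 → ℝ}

theorem abs_integral_cut_newt_sub_le (hu : ContDiff ℝ ∞ u)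
    (hS : Integrable fun x => confLap u x ^ 2) :
    ∃ C : ℝ, 0 < C ∧ ∀ r : ℝ, 0 < r → ∀ ε : ℝ, 0 < ε → ∀ x : Eu 4, ‖x‖ ≤ r / 2 →
      |(∫ y, cut r y * lap u y * lap (newt ε) (y - x)) -
        ∫ y, cut r y * lap (lap u) y * newt ε (y - x)| ≤ C / r ^ 2 := by
  obtain ⟨A, hA0, hA⟩ := exists_cut_bound
  obtain ⟨C, hC0, hC⟩ := integral_abs_lap_le hu hS
  refine ⟨144 * A * C, by positivity, fun r hr ε hε x hx => ?_⟩
  set η := cut r with hηdef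
  have hη : ContDiff ℝ ∞ η := contDiff_cut r
  have hηc : HasCompactSupport η := hasCompactSupport_cut hr
  set G : Eu 4 → ℝ := fun y => newt ε (y - x) with hGdef
  have hG : ContDiff ℝ ∞ G := (contDiff_newt hε).comp (contDiff_id.sub contDiff_const)
  have hGl : ∀ y, lap G y = lap (newt ε) (y - x) := lap_comp_sub (contDiff_newt hε) x
  have e1 : ∫ y, η y * lap (lap u) y * G y = ∫ y, lap (fun y => η y * G y) y * lap u y := by
    rw [← integral_lap_mul (hη.mul hG) hu.lap hηc.mul_right]
    congr 1
    funext y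
    ring
  have i1 : Integrable fun y => η y * lap u y * lap G y :=
    ((hη.continuous.mul hu.lap.continuous).mul hG.lap.continuous).integrable_of_hasCompactSupport
      hηc.mul_right.mul_right
  have i2 : Integrable fun y => lap (fun y => η y * G y) y * lap u y :=
    ((hη.mul hG).lap.continuous.mul hu.lap.continuous).integrable_of_hasCompactSupport
      (HasCompactSupport.lap (hη.mul hG) hηc.mul_right).mul_right
  have hm : MeasurableSet (closedBall (0 : Eu 4) (2 * r)) := isClosed_closedBall.measurableSet
  have i3 : IntegrableOn (fun y => 36 * A / r ^ 4 * |lap u y|) (closedBall 0 (2 * r)) :=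
    (hu.lap.continuous.abs.const_mul _).continuousOn.integrableOn_compact
      (isCompact_closedBall _ _)
  have hb : ∀ y, |η y * lap u y * lap G y - lap (fun y => η y * G y) y * lap u y| ≤
      (closedBall 0 (2 * r)).indicator (fun y => 36 * A / r ^ 4 * |lap u y|) y := by
    intro y
    have e2 : η y * lap u y * lap G y - lap (fun y => η y * G y) y * lap u y =
        -((2 * ∑ i, pd i η y * pd i G y + lap η y * G y) * lap u y) := by
      rw [lap_mul hη hG]
      ring
    rw [e2, abs_neg, abs_mul]
    by_cases hy : ‖y‖ < r ∨ 2 * r < ‖y‖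
    · rw [show 2 * ∑ i, pd i η y * pd i G y + lap η y * G y = 0 by
        simp [η, pd_cut_eq_zero hr hy, lap_cut_eq_zero hr hy]]
      rw [abs_zero, zero_mul]
      exact indicator_nonneg (fun y _ => by positivity) _
    · push Not at hy
      rw [indicator_of_mem (by simpa using hy.2)]
      refine mul_le_mul_of_nonneg_right ?_ (abs_nonneg _)
      have d : r / 2 ≤ ‖y - x‖ := by
        have := norm_sub_norm_le y x
        linarith [hy.1]
      have g0 : 0 < G y := newt_pos hε _
      have g1 : G y ≤ 4 / r ^ 2 := by
        refine (newt_le ε (by positivity) d).trans_eq ?_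
        field_simp
        norm_num
      have g2 : gradSq G y ≤ 256 / r ^ 6 := by
        have : gradSq G y = gradSq (newt ε) (y - x) := by
          simp only [gradSq, hGdef, pd_comp_sub]
        rw [this]
        refine (gradSq_newt_le hε _).trans ?_
        calc 4 * G y ^ 3 ≤ 4 * (4 / r ^ 2) ^ 3 := by gcongr
          _ = _ := by
            field_simp
            norm_num
      have g3 : gradSq η y ≤ A ^ 2 / r ^ 2 := sum_pd_cut_sq_le (hA r hr y).1
      have g4 : |∑ i, pd i η y * pd i G y| ≤ 16 * A / r ^ 4 := by
        refine abs_le_of_sq_le_sq ?_ (by positivity)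
        calc (∑ i, pd i η y * pd i G y) ^ 2 ≤ gradSq η y * gradSq G y := sq_sum_pd_mul_le _ _ _
          _ ≤ (A ^ 2 / r ^ 2) * (256 / r ^ 6) :=
            mul_le_mul g3 g2 (gradSq_nonneg _ _) (by positivity)
          _ = _ := by
            field_simp
            norm_num
      have g5 : |lap η y * G y| ≤ 4 * A / r ^ 4 := by
        rw [abs_mul, abs_of_pos g0]
        calc |lap η y| * G y ≤ (A / r ^ 2) * (4 / r ^ 2) :=
              mul_le_mul (hA r hr y).2 g1 g0.le (by positivity)
          _ = _ := by
            field_simp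
      refine (abs_add_le _ _).trans ?_
      rw [abs_mul, abs_two]
      calc _ ≤ 2 * (16 * A / r ^ 4) + 4 * A / r ^ 4 := by gcongr
        _ = _ := by ring
  simp only [← hGl]
  have e3 : ∫ y, cut r y * lap (lap u) y * newt ε (y - x) =
      ∫ y, lap (fun y => η y * G y) y * lap u y := e1
  rw [e3, ← integral_sub i1 i2, ← Real.norm_eq_abs]
  refine (norm_integral_le_of_norm_le (i3.integrable_indicator hm)
    (ae_of_all _ fun y => (Real.norm_eq_abs _).trans_le (hb y))).trans ?_
  rw [integral_indicator hm, integral_const_mul]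
  calc _ ≤ 36 * A / r ^ 4 * (C * (2 * r) ^ 2) := by
        have := hC (2 * r) (by positivity)
        gcongr
    _ = _ := by
      field_simp
      norm_num

theorem abs_newt_sub_sub_le {ε N M : ℝ} (hε : 0 < ε) (hM : 0 < M) (hN : 2 * M ≤ N) {x y : Eu 4}
    (hx : N ≤ ‖x‖) (hy : ‖y‖ ≤ M) :
    |newt ε (x - y) - newt ε x| ≤ 12 * M / N * newt ε x := by
  have hx0 : 0 < ‖x‖ := by linarith
  have h1 : ‖x‖ / 2 ≤ ‖x - y‖ := by
    have := norm_sub_norm_le x y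
    linarith
  have h2 : newt ε (x - y) ≤ 4 / ‖x‖ ^ 2 := by
    refine (newt_le ε (by positivity) h1).trans_eq ?_
    field_simp
    norm_num
  have p1 := newt_denom_pos hε x
  have p2 := newt_denom_pos hε (x - y)
  have n1 := newt_pos hε x
  have n2 := newt_pos hε (x - y)
  have e : newt ε (x - y) - newt ε x =
      (‖x‖ ^ 2 - ‖x - y‖ ^ 2) * newt ε (x - y) * newt ε x := by
    unfold newt
    field_simp
    ring
  have h3 : |‖x‖ ^ 2 - ‖x - y‖ ^ 2| ≤ M * (3 * ‖x‖) := by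
    rw [sq_sub_sq, abs_mul, abs_of_nonneg (by positivity), mul_comm]
    have a1 : |‖x‖ - ‖x - y‖| ≤ M := by
      refine (abs_norm_sub_norm_le _ _).trans ?_
      simpa using hy
    have a2 : ‖x‖ + ‖x - y‖ ≤ 3 * ‖x‖ := by
      have := norm_sub_le x y
      linarith
    gcongr
  rw [e, abs_mul, abs_mul, abs_of_pos n1, abs_of_pos n2]
  refine mul_le_mul_of_nonneg_right ?_ n1.le
  calc |‖x‖ ^ 2 - ‖x - y‖ ^ 2| * newt ε (x - y) ≤ M * (3 * ‖x‖) * (4 / ‖x‖ ^ 2) := by gcongr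
    _ = 12 * M / ‖x‖ := by
      field_simp
      norm_num
    _ ≤ _ := by
      have : 0 < N := by linarith
      gcongr

theorem integral_cut_mul_mul_le {f : Eu 4 → ℝ} (hfc : Continuous f) (hf : Integrable f)
    (hf8 : ∫ x, f x < 8 * Real.pi ^ 2) :
    ∃ M : ℝ, 0 < M ∧ ∃ τ : ℝ, 0 < τ ∧ ∀ κ : ℝ, 0 ≤ κ → ∀ h : Eu 4 → ℝ, Continuous h →
      (∀ y, 0 ≤ h y ∧ h y ≤ κ) → (∀ y, ‖y‖ ≤ M → |h y - h 0| ≤ τ * κ) → ∀ r : ℝ, M ≤ r →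
      ∫ y, cut r y * f y * h y ≤ 8 * Real.pi ^ 2 * κ := by
  set δ := min (8 * Real.pi ^ 2 - ∫ x, f x) (8 * Real.pi ^ 2) with hδ
  have hδ0 : 0 < δ := lt_min (by linarith) (by have := Real.pi_pos; positivity)
  have hδ1 : δ ≤ 8 * Real.pi ^ 2 - ∫ x, f x := min_le_left _ _
  have hδ2 : δ ≤ 8 * Real.pi ^ 2 := min_le_right _ _
  obtain ⟨M, hM1, hM0⟩ := (((tendsto_setIntegral_compl_ball hf.abs).eventually_lt_const
    (show (0 : ℝ) < δ / 8 by positivity)).and (eventually_gt_atTop 0)).exists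
  set F := ∫ x, |f x| with hF
  have hF0 : 0 ≤ F := integral_nonneg fun _ => abs_nonneg _
  refine ⟨M, hM0, δ / (4 * (F + 1)), by positivity, fun κ hκ h hhc hh hosc r hr => ?_⟩
  set τ := δ / (4 * (F + 1)) with hτ
  have hr0 : 0 < r := hM0.trans_le hr
  set B := ball (0 : Eu 4) M with hB
  have mB : MeasurableSet B := measurableSet_ball
  have j1 : IntegrableOn (fun y => h 0 * f y + τ * κ * |f y|) B :=
    ((hf.const_mul _).add (hf.abs.const_mul _)).integrableOn
  have j2 : IntegrableOn (fun y => κ * |f y|) Bᶜ := (hf.abs.const_mul _).integrableOn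
  have j3 : Integrable fun y => cut r y * f y * h y :=
    (((contDiff_cut r).continuous.mul hfc).mul hhc).integrable_of_hasCompactSupport
      (hasCompactSupport_cut hr0).mul_right.mul_right
  have s1 : ∫ y, cut r y * f y * h y ≤
      ∫ y, (B.indicator (fun y => h 0 * f y + τ * κ * |f y|) y +
        Bᶜ.indicator (fun y => κ * |f y|) y) := by
    refine integral_mono j3 ((j1.integrable_indicator mB).add
      (j2.integrable_indicator mB.compl)) fun y => ?_
    by_cases hy : y ∈ B
    · have hy' : ‖y‖ < M := by simpa [B] using hy
      simp only [indicator_of_mem hy, indicator_of_notMem (notMem_compl_iff.2 hy)]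
      rw [cut_eq_one hr0 (hy'.le.trans hr), one_mul, add_zero]
      have h1 : f y * (h y - h 0) ≤ |f y| * (τ * κ) :=
        (le_abs_self _).trans (by
          rw [abs_mul]
          exact mul_le_mul_of_nonneg_left (hosc y hy'.le) (abs_nonneg _))
      linarith
    · simp only [indicator_of_notMem hy, indicator_of_mem (mem_compl hy)]
      rw [zero_add]
      calc cut r y * f y * h y ≤ |cut r y * f y * h y| := le_abs_self _
        _ = cut r y * h y * |f y| := by
          rw [abs_mul, abs_mul, abs_of_nonneg cut_nonneg, abs_of_nonneg (hh y).1]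
          ring
        _ ≤ κ * |f y| := by
          refine mul_le_mul_of_nonneg_right ?_ (abs_nonneg _)
          exact (mul_le_of_le_one_left (hh y).1 cut_le_one).trans (hh y).2
  rw [integral_add (j1.integrable_indicator mB) (j2.integrable_indicator mB.compl),
    integral_indicator mB, integral_indicator mB.compl,
    integral_add (hf.const_mul _).integrableOn (hf.abs.const_mul _).integrableOn,
    integral_const_mul, integral_const_mul, integral_const_mul] at s1
  have s2 : ∫ y in B, f y ≤ 8 * Real.pi ^ 2 - 7 * δ / 8 := by
    have t1 := integral_add_compl mB hf
    have t2 : |∫ y in Bᶜ, f y| ≤ ∫ y in Bᶜ, |f y| := abs_integral_le_integral_abs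
    have t3 := neg_abs_le (∫ y in Bᶜ, f y)
    linarith
  have s3 : ∫ y in B, |f y| ≤ F := setIntegral_le_integral hf.abs (ae_of_all _ fun _ => abs_nonneg _)
  have s4 : τ * F ≤ δ / 4 := by
    rw [hτ, div_mul_eq_mul_div, div_le_div_iff₀ (by positivity) (by norm_num)]
    nlinarith
  have s5 : h 0 * ∫ y in B, f y ≤ κ * (8 * Real.pi ^ 2 - 7 * δ / 8) :=
    (mul_le_mul_of_nonneg_left s2 (hh 0).1).trans
      (mul_le_mul_of_nonneg_right (hh 0).2 (by linarith))
  have s6 : τ * κ * ∫ y in B, |f y| ≤ κ * (δ / 4) := by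
    calc _ ≤ τ * κ * F := by gcongr
      _ = κ * (τ * F) := by ring
      _ ≤ _ := by gcongr
  have s7 : κ * ∫ y in Bᶜ, |f y| ≤ κ * (δ / 8) := by gcongr
  have s8 : 0 ≤ κ * δ := by positivity
  linarith

theorem neg_integral_lap_mul_le (hu : ContDiff ℝ ∞ u) (hS : Integrable fun x => confLap u x ^ 2)
    (hf : Integrable (lap (lap u))) (hf8 : ∫ x, lap (lap u) x < 8 * Real.pi ^ 2) :
    ∃ N : ℝ, 0 < N ∧ ∀ ρ K : Eu 4 → ℝ, ContDiff ℝ ∞ ρ → HasCompactSupport ρ →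
      (∀ x, 0 ≤ ρ x) → (∀ x, ‖x‖ < N → ρ x = 0) → (Integrable fun x => K x ^ 2) →
      (∀ x, gradSq ρ x ≤ 4 * ρ x * K x ^ 2) →
      -∫ x, ρ x * lap u x ≤ 2 * ∫ x, K x ^ 2 := by
  obtain ⟨M, hM, τ, hτ, hMτ⟩ := integral_cut_mul_mul_le hu.lap.lap.continuous hf hf8
  obtain ⟨C, hC0, hC⟩ := abs_integral_cut_newt_sub_le hu hS
  refine ⟨2 * M + 12 * M / τ, by positivity, fun ρ K hρ hρc hρ0 hρN hK hρK => ?_⟩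
  set N := 2 * M + 12 * M / τ with hN
  have hNM : 2 * M ≤ N := by
    have : 0 < 12 * M / τ := by positivity
    linarith
  have hN0 : 0 < N := by linarith
  have hNτ : 12 * M / N ≤ τ := by
    rw [div_le_iff₀ hN0, hN, mul_add, mul_div_cancel₀ _ hτ.ne']
    have : 0 < τ * (2 * M) := by positivity
    linarith
  set κ := ∫ x, K x ^ 2 with hκ
  have hκ0 : 0 ≤ κ := integral_nonneg fun _ => sq_nonneg _
  obtain ⟨R, hR⟩ := hρc.isBounded.subset_closedBall 0
  have hρR : ∀ x, ρ x ≠ 0 → ‖x‖ ≤ R := fun x hx => by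
    simpa using hR (subset_tsupport _ hx)
  have hρi : Integrable ρ := hρ.continuous.integrable_of_hasCompactSupport hρc
  have step : ∀ r : ℝ, M ≤ r → 2 * R ≤ r → ∀ ε : ℝ, 0 < ε →
      ∫ x, ρ x * ∫ y, cut r y * lap u y * lap (newt ε) (y - x) ≤
        8 * Real.pi ^ 2 * κ + C / r ^ 2 * ∫ x, ρ x := by
    intro r hrM hrR ε hε
    have hr0 : 0 < r := hM.trans_le hrM
    have hn := (contDiff_newt hε).continuous
    have hηc := hasCompactSupport_cut hr0
    have hb : Continuous fun y => cut r y * lap (lap u) y :=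
      (contDiff_cut r).continuous.mul hu.lap.lap.continuous
    have hc1 := continuous_integral_mul_comp_sub
      ((contDiff_cut r).continuous.mul hu.lap.continuous) hηc.mul_right
      (contDiff_newt hε).lap.continuous
    have hc2 := continuous_integral_mul_comp_sub hb hηc.mul_right hn
    have hh := continuous_integral_mul_comp_sub hρ.continuous hρc hn
    have i1 : ∀ y, Integrable fun x => ρ x * newt ε (x - y) := fun y =>
      (hρ.continuous.mul (hn.comp (continuous_id.sub continuous_const))
        ).integrable_of_hasCompactSupport hρc.mul_right
    have l1 : ∫ x, ρ x * ∫ y, cut r y * lap (lap u) y * newt ε (y - x) ≤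
        8 * Real.pi ^ 2 * κ := by
      rw [integral_mul_integral_newt_comm hρ.continuous hρc hb hηc.mul_right hε]
      have hk : ∀ y, ∫ x, ρ x * newt ε (x - y) ≤ κ := hardy hρ hρc hρ0 hK hρK hε
      refine hMτ κ hκ0 _ hh (fun y => ⟨integral_nonneg fun x =>
        mul_nonneg (hρ0 x) (newt_pos hε _).le, hk y⟩) (fun y hy => ?_) r hrM
      rw [← integral_sub (i1 y) (i1 0), ← Real.norm_eq_abs]
      refine (norm_integral_le_of_norm_le ((i1 0).const_mul τ)
        (ae_of_all _ fun x => ?_)).trans ?_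
      · rw [Real.norm_eq_abs, ← mul_sub, abs_mul, abs_of_nonneg (hρ0 x), sub_zero]
        by_cases hx : ρ x = 0
        · simp [hx]
        · have hxN : N ≤ ‖x‖ := by
            by_contra hlt
            exact hx (hρN x (not_le.1 hlt))
          have := abs_newt_sub_sub_le hε hM hNM hxN hy
          calc ρ x * |newt ε (x - y) - newt ε x| ≤ ρ x * (12 * M / N * newt ε x) :=
                mul_le_mul_of_nonneg_left this (hρ0 x)
            _ ≤ ρ x * (τ * newt ε x) := by
                have := newt_pos hε x
                have := hρ0 x
                gcongr
            _ = _ := by ring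
      · rw [integral_const_mul]
        exact mul_le_mul_of_nonneg_left (hk 0) hτ.le
    have i2 : Integrable fun x => ρ x * ∫ y, cut r y * lap (lap u) y * newt ε (y - x) :=
      (hρ.continuous.mul hc2).integrable_of_hasCompactSupport hρc.mul_right
    have l2 : ∫ x, ρ x * ∫ y, cut r y * lap u y * lap (newt ε) (y - x) ≤
        ∫ x, (ρ x * (∫ y, cut r y * lap (lap u) y * newt ε (y - x)) + C / r ^ 2 * ρ x) := by
      refine integral_mono ((hρ.continuous.mul hc1).integrable_of_hasCompactSupport hρc.mul_right)
        (i2.add (hρi.const_mul _)) fun x => ?_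
      by_cases hx : ρ x = 0
      · simp [hx]
      · have := (abs_le.1 (hC r hr0 ε hε x (by linarith [hρR x hx]))).2
        have h0 := hρ0 x
        simp only
        nlinarith
    rw [integral_add i2 (hρi.const_mul _), integral_const_mul] at l2
    linarith
  have step2 : ∀ r : ℝ, M ≤ r → 2 * R ≤ r →
      -(4 * Real.pi ^ 2) * ∫ x, ρ x * lap u x ≤ 8 * Real.pi ^ 2 * κ + C / r ^ 2 * ∫ x, ρ x := by
    intro r hrM hrR
    have hr0 : 0 < r := hM.trans_le hrM
    have t := tendsto_integral_mul_lap_newt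
      ((contDiff_cut r).continuous.mul hu.lap.continuous)
      (hasCompactSupport_cut hr0).mul_right hρ.continuous hρc
    have e : ∫ x, ρ x * (cut r x * lap u x) = ∫ x, ρ x * lap u x := by
      congr 1
      funext x
      by_cases hx : ρ x = 0
      · simp [hx]
      · have := hρR x hx
        have : 0 ≤ ‖x‖ := norm_nonneg x
        rw [cut_eq_one hr0 (by linarith), one_mul]
    rw [← e]
    refine le_of_tendsto t ?_
    filter_upwards [self_mem_nhdsWithin] with ε hε using step r hrM hrR ε hε
  have lim : Tendsto (fun r : ℝ => 8 * Real.pi ^ 2 * κ + C / r ^ 2 * ∫ x, ρ x) atTop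
      (𝓝 (8 * Real.pi ^ 2 * κ + 0 * ∫ x, ρ x)) :=
    ((tendsto_const_nhds.div_atTop (tendsto_pow_atTop two_ne_zero)).mul_const _).const_add _
  have fin := ge_of_tendsto lim (by
    filter_upwards [eventually_ge_atTop M, eventually_ge_atTop (2 * R)] with r h1 h2
      using step2 r h1 h2)
  have hpi : 0 < 4 * Real.pi ^ 2 := by have := Real.pi_pos; positivity
  refine le_of_mul_le_mul_left ?_ hpi
  linarith

end Representation

section GradientBound
open scoped ContDiff Topology

variable {u : Eu 4 → ℝ}

/-- The squared Euclidean norm of the Schouten matrix. -/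
def schoutenSq (u : Eu 4 → ℝ) (x : Eu 4) : ℝ := ∑ i, ∑ j, schoutenMatrix u x i j ^ 2

theorem schoutenSq_nonneg (u : Eu 4 → ℝ) (x : Eu 4) : 0 ≤ schoutenSq u x :=
  Finset.sum_nonneg fun _ _ => Finset.sum_nonneg fun _ _ => sq_nonneg _

theorem continuous_schoutenSq (hu : ContDiff ℝ ∞ u) : Continuous (schoutenSq u) := by
  refine continuous_finsetSum _ fun i _ => continuous_finsetSum _ fun j _ => Continuous.pow ?_ 2
  simp only [schoutenMatrix_apply hu]
  have h1 := ((hu.pd j).pd i).continuous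
  have h2 := (hu.pd i).continuous
  have h3 := (hu.pd j).continuous
  have h4 := hu.gradSq.continuous
  fun_prop

theorem norm_gradient_eq (F : Eu 4 → ℝ) (x : Eu 4) : ‖gradient F x‖ = √(gradSq F x) := by
  rw [gradSq, ← norm_gradient_sq, Real.sqrt_sq (norm_nonneg _)]

/-- The pointwise bound making `hardy` applicable to `χ² |∇u|²`. -/
theorem gradSq_sq_mul_gradSq_le (hu : ContDiff ℝ ∞ u) {χ : Eu 4 → ℝ} (hχ : ContDiff ℝ ∞ χ)
    (hχ0 : ∀ x, 0 ≤ χ x) (x : Eu 4) :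
    gradSq (fun y => χ y * χ y * gradSq u y) x ≤ 4 * (χ x * χ x * gradSq u x) *
      (χ x * (gradSq u x / 2 + √(schoutenSq u x)) + √(gradSq χ x) * √(gradSq u x)) ^ 2 := by
  set p := gradient u x with hp
  set c := gradient χ x with hc
  set q : Eu 4 := WithLp.toLp 2 fun i => ∑ j, schoutenMatrix u x i j * p j with hq
  have hpn : ‖p‖ = √(gradSq u x) := norm_gradient_eq u x
  have hcn : ‖c‖ = √(gradSq χ x) := norm_gradient_eq χ x
  have hg : ‖p‖ ^ 2 = gradSq u x := norm_gradient_sq u x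
  have hgrad : gradient (fun y => χ y * χ y * gradSq u y) x =
      (2 * χ x) • (gradSq u x • c + (χ x * gradSq u x / 2) • p - χ x • q) := by
    ext i
    rw [gradient_apply, pd_mul (hχ.mul hχ) hu.gradSq, pd_mul hχ hχ, pd_gradSq hu]
    have e : ∑ j, pd j u x * pd i (pd j u) x =
        gradSq u x / 2 * pd i u x - ∑ j, schoutenMatrix u x i j * pd j u x := by
      simp only [schoutenMatrix_apply hu, gradSq, Fin.sum_univ_four]
      fin_cases i <;> simp <;> ring
    have hqi : q i = ∑ j, schoutenMatrix u x i j * pd j u x := by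
      simp [hq, hp, gradient_apply]
    rw [e]
    simp only [PiLp.smul_apply, PiLp.sub_apply, PiLp.add_apply, smul_eq_mul, hqi, hc, hp,
      gradient_apply]
    ring
  have hqn : ‖q‖ ≤ √(schoutenSq u x) * ‖p‖ := by
    refine abs_le_of_sq_le_sq' ?_ (by positivity) |>.2
    rw [mul_pow, Real.sq_sqrt (schoutenSq_nonneg u x), EuclideanSpace.norm_sq_eq,
      EuclideanSpace.norm_sq_eq, schoutenSq, Finset.sum_mul]
    refine Finset.sum_le_sum fun i _ => ?_
    simp only [Real.norm_eq_abs, sq_abs, hq]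
    exact Finset.sum_mul_sq_le_sq_mul_sq _ _ _
  have h0 := hχ0 x
  have hV : ‖gradSq u x • c + (χ x * gradSq u x / 2) • p - χ x • q‖ ≤
      ‖p‖ * (χ x * (gradSq u x / 2 + √(schoutenSq u x)) + √(gradSq χ x) * √(gradSq u x)) := by
    have hg0 := gradSq_nonneg u x
    refine (norm_sub_le _ _).trans ((add_le_add_left (norm_add_le _ _) _).trans ?_)
    rw [norm_smul, norm_smul, norm_smul, Real.norm_of_nonneg hg0, Real.norm_of_nonneg h0,
      Real.norm_of_nonneg (by positivity), ← hcn, ← hpn, ← hg]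
    have := mul_le_mul_of_nonneg_left hqn h0
    linarith
  have e : gradSq (fun y => χ y * χ y * gradSq u y) x =
      ‖gradient (fun y => χ y * χ y * gradSq u y) x‖ ^ 2 := (norm_gradient_sq _ x).symm
  rw [e, hgrad, norm_smul, mul_pow, Real.norm_of_nonneg (by positivity)]
  calc _ ≤ (2 * χ x) ^ 2 * (‖p‖ * (χ x * (gradSq u x / 2 + √(schoutenSq u x)) +
        √(gradSq χ x) * √(gradSq u x))) ^ 2 := by gcongr
    _ = _ := by
      rw [← hg]
      ring

/-- A smooth cutoff of the annulus between the radii `2N` and `r`. -/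
def annCut (N r : ℝ) (x : Eu 4) : ℝ := (1 - cut N x) * cut r x

variable {N r : ℝ} {x : Eu 4}

theorem contDiff_annCut (N r : ℝ) : ContDiff ℝ ∞ (annCut N r) :=
  (contDiff_const.sub (contDiff_cut N)).mul (contDiff_cut r)

theorem hasCompactSupport_annCut (hr : 0 < r) : HasCompactSupport (annCut N r) :=
  (hasCompactSupport_cut hr).mul_left

theorem annCut_nonneg : 0 ≤ annCut N r x := mul_nonneg (sub_nonneg.2 cut_le_one) cut_nonneg

theorem annCut_le_one : annCut N r x ≤ 1 :=
  mul_le_one₀ (sub_le_self _ cut_nonneg) cut_nonneg cut_le_one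

theorem gradSq_annCut_le (N r : ℝ) (x : Eu 4) :
    gradSq (annCut N r) x ≤ 2 * gradSq (cut N) x + 2 * gradSq (cut r) x := by
  have h : ∀ i, pd i (annCut N r) x =
      (1 - cut N x) * pd i (cut r) x - pd i (cut N) x * cut r x := fun i => by
    have := pd_mul (contDiff_const.sub (contDiff_cut N)) (contDiff_cut r) (F := fun y => 1 - cut N y)
      i x
    rw [show annCut N r = fun y => (1 - cut N y) * cut r y from rfl, this,
      pd_sub contDiff_const (contDiff_cut N)]
    simp [pd]
    ring
  simp only [gradSq, h, Finset.mul_sum, ← Finset.sum_add_distrib]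
  refine Finset.sum_le_sum fun i _ => ?_
  have b1 := cut_nonneg (r := N) (x := x)
  have b2 := cut_le_one (r := N) (x := x)
  have b3 := cut_nonneg (r := r) (x := x)
  have b4 := cut_le_one (r := r) (x := x)
  have c1 : ((1 - cut N x) * pd i (cut r) x) ^ 2 ≤ pd i (cut r) x ^ 2 := by
    rw [mul_pow]
    exact mul_le_of_le_one_left (sq_nonneg _) (pow_le_one₀ (by linarith) (by linarith))
  have c2 : (pd i (cut N) x * cut r x) ^ 2 ≤ pd i (cut N) x ^ 2 := by
    rw [mul_pow]
    exact mul_le_of_le_one_right (sq_nonneg _) (pow_le_one₀ b3 b4)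
  nlinarith [sq_nonneg ((1 - cut N x) * pd i (cut r) x + pd i (cut N) x * cut r x)]

theorem integral_gradSq_cut_mul_le (hu : ContDiff ℝ ∞ u)
    (hS : Integrable fun x => confLap u x ^ 2) :
    ∃ C : ℝ, 0 ≤ C ∧ ∀ r : ℝ, 0 < r → ∫ x, gradSq (cut r) x * gradSq u x ≤ C := by
  obtain ⟨A, hA0, hA⟩ := exists_cut_bound
  obtain ⟨C, hC0, hC⟩ := integral_gradSq_le hu hS
  refine ⟨4 * A ^ 2 * C, by positivity, fun r hr => ?_⟩
  have hm : MeasurableSet (closedBall (0 : Eu 4) (2 * r)) := isClosed_closedBall.measurableSet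
  have i3 : IntegrableOn (fun y => A ^ 2 / r ^ 2 * gradSq u y) (closedBall 0 (2 * r)) :=
    (hu.gradSq.continuous.const_mul _).continuousOn.integrableOn_compact
      (isCompact_closedBall _ _)
  have h1 : ∫ x, gradSq (cut r) x * gradSq u x ≤
      ∫ x, (closedBall 0 (2 * r)).indicator (fun y => A ^ 2 / r ^ 2 * gradSq u y) x := by
    refine integral_mono_of_nonneg (ae_of_all _ fun x => mul_nonneg (gradSq_nonneg _ _)
      (gradSq_nonneg _ _)) (i3.integrable_indicator hm) (ae_of_all _ fun x => ?_)
    by_cases hx : 2 * r < ‖x‖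
    · have : gradSq (cut r) x = 0 := by simp [gradSq, pd_cut_eq_zero hr (Or.inr hx)]
      simp only [this, zero_mul]
      exact indicator_nonneg (fun y _ => mul_nonneg (by positivity) (gradSq_nonneg _ _)) _
    · simp only
      rw [indicator_of_mem (by simpa using hx)]
      exact mul_le_mul_of_nonneg_right (sum_pd_cut_sq_le (hA r hr x).1) (gradSq_nonneg _ _)
  refine h1.trans ?_
  rw [integral_indicator hm, integral_const_mul]
  calc _ ≤ A ^ 2 / r ^ 2 * (C * (2 * r) ^ 2) := by
        have := hC (2 * r) (by positivity)
        gcongr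
    _ = _ := by
      field_simp
      norm_num

theorem integrable_gradSq_cut_mul (hu : ContDiff ℝ ∞ u) (hr : 0 < r) :
    Integrable fun x => gradSq (cut r) x * gradSq u x := by
  simp only [gradSq, Finset.sum_mul, sq]
  refine integrable_finsetSum _ fun i _ => Continuous.integrable_of_hasCompactSupport ?_ ?_
  · have h := ((contDiff_cut r).pd i).continuous
    have h2 : Continuous fun x => ∑ j, pd j u x * pd j u x :=
      continuous_finsetSum _ fun j _ => (hu.pd j).continuous.mul (hu.pd j).continuous
    exact (h.mul h).mul h2
  · exact ((hasCompactSupport_cut hr).pd i).mul_right.mul_right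

theorem absorb_le {a g m b S : ℝ} (ha : a * a ≤ 1) :
    a * a * g * S + 2 * (a * (g / 2 + m) + b) ^ 2 ≤
      7 / 8 * (a * a * g ^ 2) + 2 * S ^ 2 + 12 * m ^ 2 + 12 * b ^ 2 := by
  have h0 : 0 ≤ a * a := mul_self_nonneg a
  have t1 : a * a * (g * S) ≤ a * a * (g ^ 2 / 8 + 2 * S ^ 2) := by
    gcongr
    nlinarith [sq_nonneg (g - 4 * S)]
  have t2 : a * a * (2 * S ^ 2) ≤ 2 * S ^ 2 := mul_le_of_le_one_left (by positivity) ha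
  have t3 : 2 * (a * (g / 2 + m) + b) ^ 2 ≤
      3 / 4 * (a * a * g ^ 2) + 12 * (a * a * m ^ 2) + 12 * b ^ 2 := by
    nlinarith [sq_nonneg (a * g / 2 - 2 * (a * m + b)), sq_nonneg (a * m - b)]
  have t4 : a * a * m ^ 2 ≤ m ^ 2 := mul_le_of_le_one_left (by positivity) ha
  linarith

/-- Under the pinching of the total `Q`-curvature, `∇u` belongs to `L⁴`. -/
theorem integrable_gradSq_sq (hu : ContDiff ℝ ∞ u) (hS : Integrable fun x => confLap u x ^ 2)
    (hm : Integrable (schoutenSq u)) (hf : Integrable (lap (lap u)))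
    (hf8 : ∫ x, lap (lap u) x < 8 * Real.pi ^ 2) : Integrable fun x => gradSq u x ^ 2 := by
  obtain ⟨N, hN, hrep⟩ := neg_integral_lap_mul_le hu hS hf hf8
  obtain ⟨C, hC0, hC⟩ := integral_gradSq_cut_mul_le hu hS
  have hgc := hu.gradSq.continuous
  set D := 8 * (2 * (∫ x, confLap u x ^ 2) + 12 * (∫ x, schoutenSq u x) + 48 * C) with hD
  have key : ∀ r : ℝ, 0 < r → ∫ x, (annCut N r x * annCut N r x) * gradSq u x ^ 2 ≤ D := by
    intro r hr
    set χ := annCut N r with hχdef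
    have hχ : ContDiff ℝ ∞ χ := contDiff_annCut N r
    have hχc : HasCompactSupport χ := hasCompactSupport_annCut hr
    set K : Eu 4 → ℝ := fun x =>
      χ x * (gradSq u x / 2 + √(schoutenSq u x)) + √(gradSq χ x) * √(gradSq u x) with hK
    have hKc : Continuous K :=
      (hχ.continuous.mul ((hgc.div_const 2).add (continuous_schoutenSq hu).sqrt)).add
        (hχ.gradSq.continuous.sqrt.mul hgc.sqrt)
    have hKs : HasCompactSupport K := by
      refine HasCompactSupport.of_support_subset_isCompact hχc fun x hx => ?_
      by_contra h
      refine hx ?_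
      have h2 : gradSq χ x = 0 := Finset.sum_eq_zero fun i _ => by
        have : pd i χ x = 0 := image_eq_zero_of_notMem_tsupport
          fun h' => h (tsupport_fderiv_apply_subset ℝ _ h')
        rw [this, sq, zero_mul]
      simp [K, image_eq_zero_of_notMem_tsupport h, h2]
    have hKi : Integrable fun x => K x ^ 2 := by
      have : Integrable fun x => K x * K x :=
        (hKc.mul hKc).integrable_of_hasCompactSupport hKs.mul_right
      simpa only [sq] using this
    have hρ : ContDiff ℝ ∞ fun y => χ y * χ y * gradSq u y := (hχ.mul hχ).mul hu.gradSq
    have hρc : HasCompactSupport fun y => χ y * χ y * gradSq u y := hχc.mul_right.mul_right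
    have h1 := hrep (fun y => χ y * χ y * gradSq u y) K hρ hρc
      (fun y => mul_nonneg (mul_self_nonneg _) (gradSq_nonneg _ _))
      (fun y hy => by simp [χ, annCut, cut_eq_one hN hy.le]) hKi
      (gradSq_sq_mul_gradSq_le hu hχ fun y => annCut_nonneg)
    have i0 : Integrable fun x => (χ x * χ x) * gradSq u x ^ 2 :=
      ((hχ.continuous.mul hχ.continuous).mul (hgc.pow 2)).integrable_of_hasCompactSupport
        hχc.mul_right.mul_right
    have i1 : Integrable fun x => χ x * χ x * gradSq u x * confLap u x :=
      (hρ.continuous.mul hu.confLap.continuous).integrable_of_hasCompactSupport hρc.mul_right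
    have i2 : Integrable fun x => χ x * χ x * gradSq u x * lap u x :=
      (hρ.continuous.mul hu.lap.continuous).integrable_of_hasCompactSupport hρc.mul_right
    have hcut : ∀ s : ℝ, 0 < s → Integrable fun x => gradSq (cut s) x * gradSq u x :=
      fun s hs => integrable_gradSq_cut_mul hu hs
    have e1 : ∫ x, (χ x * χ x) * gradSq u x ^ 2 = (∫ x, χ x * χ x * gradSq u x * confLap u x) -
        ∫ x, χ x * χ x * gradSq u x * lap u x := by
      rw [← integral_sub i1 i2]
      congr 1
      funext x
      simp only [confLap]
      ring
    have i5 : Integrable fun x => 24 * (gradSq (cut N) x * gradSq u x) +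
        24 * (gradSq (cut r) x * gradSq u x) :=
      ((hcut N hN).const_mul 24).add ((hcut r hr).const_mul 24)
    have i4 : Integrable fun x => 12 * schoutenSq u x + (24 * (gradSq (cut N) x * gradSq u x) +
        24 * (gradSq (cut r) x * gradSq u x)) := (hm.const_mul 12).add i5
    have i3 : Integrable fun x => 2 * confLap u x ^ 2 + (12 * schoutenSq u x +
        (24 * (gradSq (cut N) x * gradSq u x) + 24 * (gradSq (cut r) x * gradSq u x))) :=
      (hS.const_mul 2).add i4
    have e2 : (∫ x, χ x * χ x * gradSq u x * confLap u x) + 2 * ∫ x, K x ^ 2 ≤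
        7 / 8 * (∫ x, (χ x * χ x) * gradSq u x ^ 2) + D / 8 := by
      have : ∫ x, (χ x * χ x * gradSq u x * confLap u x + 2 * K x ^ 2) ≤
          ∫ x, (7 / 8 * ((χ x * χ x) * gradSq u x ^ 2) + (2 * confLap u x ^ 2 +
            (12 * schoutenSq u x + (24 * (gradSq (cut N) x * gradSq u x) +
              24 * (gradSq (cut r) x * gradSq u x))))) := by
        refine integral_mono (i1.add (hKi.const_mul 2)) ((i0.const_mul (7 / 8)).add i3) fun x => ?_
        have hm0 := Real.sq_sqrt (schoutenSq_nonneg u x)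
        have hg0 := gradSq_nonneg u x
        have hp0 := Real.sq_sqrt hg0
        have hc0 := Real.sq_sqrt (gradSq_nonneg χ x)
        have hc1 := mul_le_mul_of_nonneg_right (gradSq_annCut_le N r x) hg0
        have hχ1 : χ x * χ x ≤ 1 := by
          have h1 : 0 ≤ χ x := annCut_nonneg
          have h2 : χ x ≤ 1 := annCut_le_one
          nlinarith
        have hχ2 : 0 ≤ χ x * χ x := mul_self_nonneg _
        have := absorb_le (a := χ x) (g := gradSq u x) (m := √(schoutenSq u x))
          (b := √(gradSq χ x) * √(gradSq u x)) (S := confLap u x) hχ1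
        rw [mul_pow, hc0, hp0, hm0] at this
        simp only [K]
        linarith
      rw [integral_add i1 (hKi.const_mul 2), integral_const_mul,
        integral_add (i0.const_mul _) i3, integral_const_mul,
        integral_add (hS.const_mul 2) i4, integral_add (hm.const_mul 12) i5,
        integral_add ((hcut N hN).const_mul 24) ((hcut r hr).const_mul 24),
        integral_const_mul, integral_const_mul, integral_const_mul, integral_const_mul] at this
      have h3 := hC N hN
      have h4 := hC r hr
      linarith
    linarith
  have hloc : ∀ s : ℝ, IntegrableOn (fun x => gradSq u x ^ 2) (closedBall (0 : Eu 4) s) :=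
    fun s => (hgc.pow 2).continuousOn.integrableOn_compact (isCompact_closedBall _ _)
  refine (aecover_ball (μ := volume) (x := (0 : Eu 4))
    (tendsto_id (α := ℝ))).integrable_of_integral_norm_bounded
    ((∫ x in closedBall (0 : Eu 4) (2 * N), gradSq u x ^ 2) + D)
    (fun s => (hloc s).mono_set ball_subset_closedBall) ?_
  filter_upwards [eventually_gt_atTop 0] with s hs
  have m1 : MeasurableSet (closedBall (0 : Eu 4) (2 * N)) := isClosed_closedBall.measurableSet
  have i0 : Integrable fun x => (annCut N s x * annCut N s x) * gradSq u x ^ 2 :=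
    (((contDiff_annCut N s).continuous.mul (contDiff_annCut N s).continuous).mul
      (hgc.pow 2)).integrable_of_hasCompactSupport
      (hasCompactSupport_annCut hs).mul_right.mul_right
  have hle : ∫ x in ball (0 : Eu 4) s, ‖gradSq u x ^ 2‖ ≤
      ∫ x, ((closedBall (0 : Eu 4) (2 * N)).indicator (fun x => gradSq u x ^ 2) x +
        (annCut N s x * annCut N s x) * gradSq u x ^ 2) := by
    rw [← integral_indicator measurableSet_ball]
    refine integral_mono_of_nonneg (ae_of_all _ fun x => indicator_nonneg
      (fun y _ => norm_nonneg _) _) (((hloc _).integrable_indicator m1).add i0)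
      (ae_of_all _ fun x => ?_)
    have h1 : 0 ≤ (annCut N s x * annCut N s x) * gradSq u x ^ 2 :=
      mul_nonneg (mul_self_nonneg _) (sq_nonneg _)
    have h2 : 0 ≤ (closedBall (0 : Eu 4) (2 * N)).indicator (fun x => gradSq u x ^ 2) x :=
      indicator_nonneg (fun y _ => sq_nonneg _) _
    by_cases hx : x ∈ ball (0 : Eu 4) s
    · simp only [indicator_of_mem hx, Real.norm_of_nonneg (sq_nonneg (gradSq u x))]
      by_cases hx2 : x ∈ closedBall (0 : Eu 4) (2 * N)
      · rw [indicator_of_mem hx2]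
        linarith
      · have a1 : annCut N s x = 1 := by
          rw [annCut, cut_eq_one hs (by simpa using (mem_ball_zero_iff.1 hx).le),
            cut_eq_zero hN (by simpa using (not_le.1 fun h => hx2 (by simpa using h)).le)]
          norm_num
        rw [a1]
        linarith
    · simp only [indicator_of_notMem hx]
      linarith
  refine hle.trans ?_
  rw [integral_add ((hloc _).integrable_indicator m1) i0, integral_indicator m1]
  have := key s hs
  linarith

end GradientBound

section Sobolev
open scoped ContDiff Topology NNReal ENNReal

theorem hasDerivAt_sub_mul_arctan_div {k : ℝ} (hk : k ≠ 0) (t : ℝ) :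
    HasDerivAt (fun t => t - k * Real.arctan (t / k)) (1 - 1 / (1 + (t / k) ^ 2)) t := by
  have h := (hasDerivAt_id t).sub ((((hasDerivAt_id t).div_const k).arctan).const_mul k)
  have e : 1 - 1 / (1 + (t / k) ^ 2) = 1 - k * (1 / (1 + (id t / k) ^ 2) * (1 / k)) := by
    simp only [id]
    field_simp
  rw [e]
  exact h

theorem contDiff_sub_mul_arctan_div (k : ℝ) :
    ContDiff ℝ ∞ fun t => t - k * Real.arctan (t / k) :=
  contDiff_id.sub (contDiff_const.mul (contDiff_id.div_const k).arctan)

theorem abs_mul_arctan_div_le {k : ℝ} (hk : 0 < k) (t : ℝ) :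
    |k * Real.arctan (t / k)| ≤ 2 * k := by
  have h1 := Real.arctan_lt_pi_div_two (t / k)
  have h2 := Real.neg_pi_div_two_lt_arctan (t / k)
  have h3 := Real.pi_le_four
  rw [abs_mul, abs_of_pos hk, mul_comm 2]
  gcongr
  rw [abs_le]
  constructor <;> linarith

variable {u : Eu 4 → ℝ}

theorem exists_small_gradient (hu : ContDiff ℝ ∞ u)
    (h4 : Integrable fun x => gradSq u x ^ 2) {δ : ℝ≥0∞} (hδ : 0 < δ) :
    ∃ v : Eu 4 → ℝ, ContDiff ℝ ∞ v ∧ (∃ M : ℝ, ∀ x, |u x - v x| ≤ M) ∧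
      eLpNorm (fderiv ℝ v) 4 volume ≤ δ := by
  set v : ℕ → Eu 4 → ℝ := fun n x => u x - (n + 1 : ℝ) * Real.arctan (u x / (n + 1 : ℝ)) with hv
  have hvs : ∀ n, ContDiff ℝ ∞ (v n) := fun n =>
    (contDiff_sub_mul_arctan_div (n + 1 : ℝ)).comp hu
  have hd : ∀ n x, fderiv ℝ (v n) x = (1 - 1 / (1 + (u x / (n + 1 : ℝ)) ^ 2)) • fderiv ℝ u x := by
    intro n x
    exact ((hasDerivAt_sub_mul_arctan_div (by positivity : (n + 1 : ℝ) ≠ 0) (u x)).comp_hasFDerivAt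
      x (hu.differentiable (by simp) x).hasFDerivAt).fderiv
  have hlim : Tendsto (fun n => ∫⁻ x, ‖fderiv ℝ (v n) x‖ₑ ^ (4 : ℝ)) atTop
      (𝓝 (∫⁻ _ : Eu 4, 0)) := by
    refine tendsto_lintegral_of_dominated_convergence (fun x => ‖fderiv ℝ u x‖ₑ ^ (4 : ℝ)) ?_ ?_ ?_ ?_
    · intro n
      exact ((hvs n).continuous_fderiv (by simp)).measurable.enorm.pow_const _
    · intro n
      refine ae_of_all _ fun x => ?_
      dsimp only
      gcongr
      rw [hd, enorm_smul]
      refine mul_le_of_le_one_left' ?_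
      rw [Real.enorm_eq_ofReal_abs]
      refine ENNReal.ofReal_le_one.2 ?_
      have : (1 : ℝ) / (1 + (u x / (n + 1 : ℝ)) ^ 2) ≤ 1 := by
        rw [div_le_one (by positivity)]
        nlinarith [sq_nonneg (u x / (n + 1 : ℝ))]
      rw [abs_of_nonneg (by linarith)]
      have : 0 ≤ (1 : ℝ) / (1 + (u x / (n + 1 : ℝ)) ^ 2) := by positivity
      linarith
    · have e : ∀ x, ‖fderiv ℝ u x‖ₑ ^ (4 : ℝ) = ‖gradSq u x ^ 2‖ₑ := by
        intro x
        rw [gradSq, ← norm_fderiv_sq, ← pow_mul, enorm_pow, enorm_norm]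
        norm_cast
      simp only [e]
      exact h4.2.ne
    · refine ae_of_all _ fun x => ?_
      have h1 : Tendsto (fun n : ℕ => (1 - 1 / (1 + (u x / (n + 1 : ℝ)) ^ 2)) • fderiv ℝ u x) atTop
          (𝓝 ((1 - 1 / (1 + (0 : ℝ) ^ 2)) • fderiv ℝ u x)) := by
        refine Tendsto.smul_const (tendsto_const_nhds.sub (tendsto_const_nhds.div
          (tendsto_const_nhds.add (Tendsto.pow ?_ 2)) (by norm_num))) _
        exact tendsto_const_nhds.div_atTop
          (tendsto_atTop_add_const_right _ _ tendsto_natCast_atTop_atTop)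
      have h2 : Tendsto (fun n => ‖fderiv ℝ (v n) x‖ₑ ^ (4 : ℝ)) atTop
          (𝓝 (‖(1 - 1 / (1 + (0 : ℝ) ^ 2)) • fderiv ℝ u x‖ₑ ^ (4 : ℝ))) := by
        simp only [hd]
        exact h1.enorm.ennrpow_const _
      have h0 : ‖(1 - 1 / (1 + (0 : ℝ) ^ 2)) • fderiv ℝ u x‖ₑ ^ (4 : ℝ) = 0 := by
        rw [enorm_smul]
        simp
      rwa [h0] at h2
  have hδ' : 0 < δ ^ (4 : ℝ) := ENNReal.rpow_pos_of_nonneg hδ (by norm_num)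
  rw [lintegral_zero] at hlim
  obtain ⟨n, hn⟩ := (hlim.eventually_lt_const hδ').exists
  refine ⟨v n, hvs n, ⟨2 * (n + 1 : ℝ), fun x => ?_⟩, ?_⟩
  · simpa [hv] using abs_mul_arctan_div_le (by positivity : (0 : ℝ) < n + 1) (u x)
  · rw [eLpNorm_eq_lintegral_rpow_enorm_toReal (by norm_num) (by norm_num)]
    simp only [ENNReal.toReal_ofNat]
    rw [one_div, ENNReal.rpow_inv_le_iff (by norm_num)]
    exact hn.le

theorem le_of_le_mul_add {K : ℝ≥0} {X Y : ℝ≥0∞} (hX : X ≠ ⊤)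
    (h : X ≤ K * (Y + 3 * (X * ((6 * (K + 1))⁻¹ : ℝ≥0)))) : X ≤ 2 * K * Y := by
  by_cases hY : Y = ⊤
  · subst hY
    by_cases hK : K = 0
    · subst hK
      simpa using h
    · rw [ENNReal.mul_top (by simpa using hK)]
      exact le_top
  · lift X to ℝ≥0 using hX
    lift Y to ℝ≥0 using hY
    have h' : (X : ℝ) ≤ K * (Y + 3 * (X * (6 * (K + 1))⁻¹)) := by exact_mod_cast h
    have h3 : (K : ℝ) * (3 * (X * (6 * (K + 1))⁻¹)) ≤ X / 2 := by
      have e : (K : ℝ) * (3 * (X * (6 * (K + 1))⁻¹)) = X / 2 * (K / (K + 1)) := by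
        have : (K : ℝ) + 1 ≠ 0 := by positivity
        push_cast
        rw [mul_inv]
        field_simp
        ring
      rw [e]
      refine mul_le_of_le_one_right (by positivity) ?_
      rw [div_le_one (by positivity)]
      linarith
    have : (X : ℝ) ≤ 2 * K * Y := by nlinarith
    exact_mod_cast this

/-- The `L¹` Sobolev inequality of the metric `e^{2u}|dx|²` with `∇u ∈ L⁴`. -/
theorem weighted_sobolev (hu : ContDiff ℝ ∞ u) (h4 : Integrable fun x => gradSq u x ^ 2) :
    ∃ C : ℝ≥0, ∀ φ : Eu 4 → ℝ, ContDiff ℝ 1 φ → HasCompactSupport φ →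
      eLpNorm (fun x => φ x * Real.exp (3 * u x)) (4 / 3 : ℝ≥0) volume ≤
        C * eLpNorm (fun x => Real.exp (3 * u x) • fderiv ℝ φ x) 1 volume := by
  have hp : NNReal.HolderConjugate (Module.finrank ℝ (Eu 4)) (4 / 3 : ℝ≥0) := by
    rw [NNReal.holderConjugate_iff]
    constructor
    · simp
    · simp only [finrank_euclideanSpace, Fintype.card_fin]
      rw [← NNReal.coe_inj]
      push_cast
      norm_num
  set K : ℝ≥0 := eLpNormLESNormFDerivOneConst (volume : Measure (Eu 4)) (4 / 3 : ℝ≥0) with hK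
  obtain ⟨v, hv, ⟨M, hM⟩, hδ⟩ := exists_small_gradient hu h4
    (δ := ((6 * (K + 1))⁻¹ : ℝ≥0)) (by positivity)
  refine ⟨2 * K * Real.toNNReal (Real.exp (3 * M)) ^ 2, fun φ hφ hφc => ?_⟩
  set ψ : Eu 4 → ℝ := fun x => φ x * Real.exp (3 * v x) with hψ
  have hv1 : ContDiff ℝ 1 v := hv.of_le (by simp)
  have he : ContDiff ℝ 1 fun x => Real.exp (3 * v x) := (contDiff_const.mul hv1).exp
  have hψs : ContDiff ℝ 1 ψ := hφ.mul he
  have hψc : HasCompactSupport ψ := hφc.mul_right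
  have hdψ : ∀ x, fderiv ℝ ψ x =
      Real.exp (3 * v x) • fderiv ℝ φ x + (3 : ℝ) • (ψ x • fderiv ℝ v x) := by
    intro x
    have h1 := (hφ.differentiable one_ne_zero x).hasFDerivAt
    have h2 := (((hv1.differentiable one_ne_zero x).hasFDerivAt).const_mul (3 : ℝ)).exp
    have h3 : HasFDerivAt ψ _ x := h1.mul h2
    rw [h3.fderiv]
    simp only [hψ, smul_smul]
    rw [add_comm]
    congr 2
    ring
  have hX := eLpNorm_le_eLpNorm_fderiv_one (volume : Measure (Eu 4)) hψs hψc hp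
  have m1 : AEStronglyMeasurable (fun x => Real.exp (3 * v x) • fderiv ℝ φ x) volume :=
    (he.continuous.smul (hφ.continuous_fderiv one_ne_zero)).aestronglyMeasurable
  have m2 : AEStronglyMeasurable (fun x => (3 : ℝ) • (ψ x • fderiv ℝ v x)) volume :=
    ((hψs.continuous.smul (hv1.continuous_fderiv one_ne_zero)).const_smul
      (3 : ℝ)).aestronglyMeasurable
  have : ENNReal.HolderTriple ((4 / 3 : ℝ≥0) : ℝ≥0∞) 4 1 := by
    refine ⟨?_⟩
    rw [← ENNReal.coe_inv (by positivity)]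
    have : (4 : ℝ≥0∞) = ((4 : ℝ≥0) : ℝ≥0∞) := rfl
    rw [this, ← ENNReal.coe_inv (by positivity), inv_one, ← ENNReal.coe_one, ← ENNReal.coe_add,
      ENNReal.coe_inj, ← NNReal.coe_inj]
    push_cast
    norm_num
  have hH : eLpNorm (fun x => ψ x • fderiv ℝ v x) 1 volume ≤
      eLpNorm ψ (4 / 3 : ℝ≥0) volume * ((6 * (K + 1))⁻¹ : ℝ≥0) :=
    (eLpNorm_smul_le_mul_eLpNorm (hv1.continuous_fderiv one_ne_zero).aestronglyMeasurable
      hψs.continuous.aestronglyMeasurable).trans (by gcongr)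
  set X := eLpNorm ψ (4 / 3 : ℝ≥0) volume with hXdef
  set Y := eLpNorm (fun x => Real.exp (3 * v x) • fderiv ℝ φ x) 1 volume with hY
  have hXf : X ≠ ⊤ := (hψs.continuous.memLp_of_hasCompactSupport hψc).2.ne
  have hd : eLpNorm (fderiv ℝ ψ) 1 volume ≤ Y + 3 * (X * ((6 * (K + 1))⁻¹ : ℝ≥0)) := by
    have : fderiv ℝ ψ = (fun x => Real.exp (3 * v x) • fderiv ℝ φ x) +
        fun x => (3 : ℝ) • (ψ x • fderiv ℝ v x) := funext hdψ
    rw [this]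
    refine (eLpNorm_add_le m1 m2 le_rfl).trans ?_
    have h3 : eLpNorm (fun x => (3 : ℝ) • (ψ x • fderiv ℝ v x)) 1 volume ≤
        ENNReal.ofReal 3 * eLpNorm (fun x => ψ x • fderiv ℝ v x) 1 volume :=
      eLpNorm_le_mul_eLpNorm_of_ae_le_mul (ae_of_all _ fun x => by rw [norm_smul]; simp) _
    rw [ENNReal.ofReal_ofNat] at h3
    exact add_le_add_right (h3.trans (mul_le_mul_right hH _)) _
  have hXY : X ≤ 2 * K * Y := le_of_le_mul_add hXf (hX.trans (mul_le_mul_right hd _))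
  set c := Real.exp (3 * M)
  have hc : 0 < c := Real.exp_pos _
  have a1 : eLpNorm (fun x => φ x * Real.exp (3 * u x)) (4 / 3 : ℝ≥0) volume ≤
      ENNReal.ofReal c * X := by
    refine eLpNorm_le_mul_eLpNorm_of_ae_le_mul (ae_of_all _ fun x => ?_) _
    rw [norm_mul, hψ, norm_mul, Real.norm_of_nonneg (Real.exp_nonneg _),
      Real.norm_of_nonneg (Real.exp_nonneg _), mul_left_comm]
    gcongr
    rw [← Real.exp_add]
    exact Real.exp_le_exp.2 (by linarith [(abs_le.1 (hM x)).2])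
  have a2 : Y ≤ ENNReal.ofReal c * eLpNorm (fun x => Real.exp (3 * u x) • fderiv ℝ φ x) 1 volume := by
    refine eLpNorm_le_mul_eLpNorm_of_ae_le_mul (ae_of_all _ fun x => ?_) _
    rw [norm_smul, norm_smul, Real.norm_of_nonneg (Real.exp_nonneg _),
      Real.norm_of_nonneg (Real.exp_nonneg _), ← mul_assoc]
    gcongr
    rw [← Real.exp_add]
    exact Real.exp_le_exp.2 (by linarith [(abs_le.1 (hM x)).1])
  calc _ ≤ ENNReal.ofReal c * X := a1
    _ ≤ ENNReal.ofReal c * (2 * K * Y) := by gcongr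
    _ ≤ ENNReal.ofReal c * (2 * K * (ENNReal.ofReal c * _)) := by gcongr
    _ = _ := by
      simp only [ENNReal.ofReal]
      push_cast
      ring

end Sobolev

section Hypersurface
open scoped ContDiff Topology NNReal ENNReal

/-- Forgetting the `i`-th coordinate. -/
def dropCoord (i : Fin 4) (x : Eu 4) : Fin 3 → ℝ := fun j => x (i.succAbove j)

theorem norm_dropCoord_le (i : Fin 4) (x : Eu 4) : ‖dropCoord i x‖ ≤ ‖x‖ :=
  (pi_norm_le_iff_of_nonneg (norm_nonneg _)).2 fun _ => PiLp.norm_apply_le x _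

theorem dropCoord_sub (i : Fin 4) (x y : Eu 4) :
    dropCoord i (x - y) = dropCoord i x - dropCoord i y := rfl

theorem abs_apply_le_of_ne {i j : Fin 4} (hj : j ≠ i) (x : Eu 4) : |x j| ≤ ‖dropCoord i x‖ := by
  obtain ⟨k, rfl⟩ := Fin.exists_succAbove_eq hj
  exact norm_le_pi_norm (dropCoord i x) k

theorem hausdorffMeasure_lt_top_of_dropCoord {S : Set (Eu 4)} (hS : Bornology.IsBounded S)
    (i : Fin 4) (K : ℝ≥0)
    (hK : ∀ x ∈ S, ∀ y ∈ S, dist x y ≤ K * dist (dropCoord i x) (dropCoord i y)) :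
    μH[(3 : ℝ)] S < ⊤ := by
  have hinj : InjOn (dropCoord i) S := by
    intro x hx y hy hxy
    have := hK x hx y hy
    rw [hxy, dist_self, mul_zero] at this
    exact dist_le_zero.1 this
  set f := Function.invFunOn (dropCoord i) S
  have hf : ∀ x ∈ S, f (dropCoord i x) = x := fun x hx => hinj.leftInvOn_invFunOn hx
  have hL : LipschitzOnWith K f (dropCoord i '' S) := by
    refine LipschitzOnWith.of_dist_le_mul ?_
    rintro _ ⟨x, hx, rfl⟩ _ ⟨y, hy, rfl⟩
    rw [hf x hx, hf y hy]
    exact hK x hx y hy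
  have him : f '' (dropCoord i '' S) = S := by
    ext x
    constructor
    · rintro ⟨_, ⟨y, hy, rfl⟩, rfl⟩
      rwa [hf y hy]
    · exact fun hx => ⟨_, ⟨x, hx, rfl⟩, hf x hx⟩
  have hb : Bornology.IsBounded (dropCoord i '' S) := by
    obtain ⟨R, hR⟩ := hS.exists_norm_le
    refine isBounded_iff_forall_norm_le.2 ⟨R, ?_⟩
    rintro _ ⟨x, hx, rfl⟩
    exact (norm_dropCoord_le i x).trans (hR x hx)
  have hv : (μH[(3 : ℝ)] : Measure (Fin 3 → ℝ)) = volume := by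
    simpa using hausdorffMeasure_pi_real (ι := Fin 3)
  have h := hL.hausdorffMeasure_image_le (d := 3) (by norm_num)
  rw [him, hv] at h
  exact h.trans_lt (ENNReal.mul_lt_top (ENNReal.rpow_lt_top_of_nonneg (by norm_num) (by simp))
    hb.measure_lt_top)

theorem norm_le_of_norm_apply_le {L : Eu 4 →L[ℝ] ℝ} {i : Fin 4} {h : Eu 4}
    (hc : 0 < |L (EuclideanSpace.single i 1)|)
    (hL : ‖L h‖ ≤ |L (EuclideanSpace.single i 1)| / 2 * ‖h‖) :
    ‖h‖ ≤ (1 + (|L (EuclideanSpace.single i 1)| + 2 * ‖L‖) / |L (EuclideanSpace.single i 1)|) * 2 *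
      ‖dropCoord i h‖ := by
  set c := |L (EuclideanSpace.single i 1)| with hcdef
  set e : Eu 4 := EuclideanSpace.single i 1
  set p := h - h i • e with hp
  have he : ‖h i • e‖ = |h i| := by
    rw [norm_smul]
    simp [e]
  have h1 : ‖h‖ ≤ |h i| + ‖p‖ := by
    rw [← he]
    have : h = h i • e + p := by simp [hp]
    conv_lhs => rw [this]
    exact norm_add_le _ _
  have h2 : ‖p‖ ≤ 2 * ‖dropCoord i h‖ := by
    refine le_of_sq_le_sq ?_ (by positivity)
    rw [EuclideanSpace.norm_sq_eq]
    have : ∀ j, ‖p j‖ ^ 2 ≤ ‖dropCoord i h‖ ^ 2 := by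
      intro j
      gcongr
      by_cases hj : j = i
      · subst hj
        simp [hp, e]
      · simpa [hp, e, hj] using abs_apply_le_of_ne hj h
    calc ∑ j, ‖p j‖ ^ 2 ≤ ∑ _j : Fin 4, ‖dropCoord i h‖ ^ 2 := Finset.sum_le_sum fun j _ => this j
      _ = _ := by
        simp
        ring
  have h3 : c * |h i| ≤ c / 2 * ‖h‖ + ‖L‖ * ‖p‖ := by
    have e1 : h i * L e = L h - L p := by simp [hp]
    rw [hcdef, mul_comm, ← abs_mul, e1]
    exact (norm_sub_le (L h) (L p)).trans (add_le_add hL (L.le_opNorm p))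
  have h4 : c / 2 * |h i| ≤ (c / 2 + ‖L‖) * ‖p‖ := by nlinarith
  have h5 : |h i| ≤ (c + 2 * ‖L‖) / c * ‖p‖ := by
    rw [div_mul_eq_mul_div, le_div_iff₀ hc]
    linarith
  calc ‖h‖ ≤ (1 + (c + 2 * ‖L‖) / c) * ‖p‖ := by linarith
    _ ≤ (1 + (c + 2 * ‖L‖) / c) * (2 * ‖dropCoord i h‖) := by gcongr
    _ = _ := by ring

theorem exists_hausdorffMeasure_zero_lt_top {g : Eu 4 → ℝ} (hg : ContDiff ℝ ∞ g) {x₀ : Eu 4}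
    (hx₀ : fderiv ℝ g x₀ ≠ 0) : ∃ U ∈ 𝓝 x₀, μH[(3 : ℝ)] ({x | g x = 0} ∩ U) < ⊤ := by
  obtain ⟨i, hi⟩ : ∃ i, pd i g x₀ ≠ 0 := by
    by_contra! h
    refine hx₀ (norm_eq_zero.1 (pow_eq_zero_iff two_ne_zero |>.1 ?_))
    rw [norm_fderiv_sq]
    simp [h]
  set c := |pd i g x₀| with hc
  have hc0 : 0 < c := abs_pos.2 hi
  set D := ‖fderiv ℝ g x₀‖
  have hs : HasStrictFDerivAt g (fderiv ℝ g x₀) x₀ :=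
    (hg.contDiffAt).hasStrictFDerivAt (by simp)
  have hev := hs.isLittleO.def (c := c / 2) (by positivity)
  rw [nhds_prod_eq, eventually_prod_self_iff'] at hev
  obtain ⟨U, hU, hUs⟩ := hev
  refine ⟨U ∩ ball x₀ 1, inter_mem hU (ball_mem_nhds _ one_pos), ?_⟩
  set k := (1 + (c + 2 * D) / c) * 2 with hk
  have hk0 : 0 ≤ k := by positivity
  refine hausdorffMeasure_lt_top_of_dropCoord (isBounded_ball.subset fun x hx => hx.2.2) i
    k.toNNReal fun x hx y hy => ?_
  have hxy := hUs x hx.2.1 y hy.2.1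
  rw [show g x = 0 from hx.1, show g y = 0 from hy.1, sub_self, zero_sub, norm_neg] at hxy
  rw [Real.coe_toNNReal _ hk0, dist_eq_norm, dist_eq_norm, ← dropCoord_sub]
  set h := x - y
  exact norm_le_of_norm_apply_le (L := fderiv ℝ g x₀) hc0 hxy

theorem frontier_subset_of_eq_lt {g : Eu 4 → ℝ} (hg : Continuous g) {Ω : Set (Eu 4)}
    (hΩ : Ω = {x | g x < 0}) : frontier Ω ⊆ {x | g x = 0} := by
  rw [hΩ]
  exact frontier_lt_subset_eq hg continuous_const

theorem hausdorffMeasure_frontier_lt_top {Ω : Set (Eu 4)} (hb : Bornology.IsBounded Ω)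
    (hs : HasSmoothBoundary Ω) : μH[(3 : ℝ)] (frontier Ω) < ⊤ := by
  obtain ⟨g, hg, hΩ, hd⟩ := hs
  have hsub := frontier_subset_of_eq_lt hg.continuous hΩ
  have hK : IsCompact (frontier Ω) :=
    Metric.isCompact_of_isClosed_isBounded isClosed_frontier (hb.closure.subset frontier_subset_closure)
  refine hK.measure_lt_top_of_nhdsWithin fun x hx => ?_
  obtain ⟨U, hU, hUm⟩ := exists_hausdorffMeasure_zero_lt_top hg (hd x (hsub hx))
  exact ⟨frontier Ω ∩ U, inter_mem_nhdsWithin _ hU,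
    (measure_mono (inter_subset_inter_left _ hsub)).trans_lt hUm⟩

end Hypersurface

section Cover
open scoped ContDiff Topology NNReal ENNReal

theorem exists_gt_pow_three_lt {d r₀ : ℝ} (h : d < r₀) {ε : ℝ≥0∞} (hε : 0 < ε) :
    ∃ r, d < r ∧ r < r₀ ∧ ENNReal.ofReal (r ^ 3) < ENNReal.ofReal (d ^ 3) + ε := by
  have hc : Tendsto (fun r : ℝ => ENNReal.ofReal (r ^ 3)) (𝓝[>] d) (𝓝 (ENNReal.ofReal (d ^ 3))) :=
    ((ENNReal.continuous_ofReal.comp (continuous_pow 3)).tendsto d).mono_left nhdsWithin_le_nhds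
  have h1 := hc.eventually_lt_const (ENNReal.lt_add_right ENNReal.ofReal_ne_top hε.ne')
  have h2 : ∀ᶠ r in 𝓝[>] d, r < r₀ := nhdsWithin_le_nhds (eventually_lt_nhds h)
  obtain ⟨r, ⟨hr1, hr2⟩, hr3⟩ := ((h1.and h2).and self_mem_nhdsWithin).exists
  exact ⟨r, hr3, hr2, hr1⟩

theorem exists_ball_cover {E : Set (Eu 4)} (hE : μH[(3 : ℝ)] E ≠ ⊤) {r₀ : ℝ} (hr₀ : 0 < r₀)
    {ε : ℝ≥0∞} (hε : 0 < ε) :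
    ∃ (ι : Set ℕ) (x : ι → Eu 4) (r : ι → ℝ), (∀ n, x n ∈ E ∧ 0 < r n ∧ r n < r₀) ∧
      E ⊆ ⋃ n, ball (x n) (r n) ∧ ∑' n, ENNReal.ofReal (r n ^ 3) ≤ μH[(3 : ℝ)] E + ε := by
  have hε2 : 0 < ε / 2 := ENNReal.half_pos hε.ne'
  have h := ENNReal.lt_add_right hE hε2.ne'
  rw [Measure.hausdorffMeasure_apply] at h
  have hρ : 0 < ENNReal.ofReal (r₀ / 2) := by simpa using hr₀
  have h1 := (le_iSup₂ (f := fun (r : ℝ≥0∞) (_ : 0 < r) =>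
    ⨅ (t : ℕ → Set (Eu 4)) (_ : E ⊆ ⋃ n, t n) (_ : ∀ n, ediam (t n) ≤ r),
          ∑' n, ⨆ _ : (t n).Nonempty, ediam (t n) ^ (3 : ℝ)) _ hρ).trans_lt h
  rw [← Measure.hausdorffMeasure_apply] at h1
  simp only [iInf_lt_iff] at h1
  obtain ⟨t, hEt, htd, hsum⟩ := h1
  obtain ⟨η, hη, hηs⟩ := ENNReal.exists_pos_sum_of_countable' hε2.ne' ℕ
  have hfin : ∀ n, ediam (t n) ≠ ⊤ := fun n => ((htd n).trans_lt ENNReal.ofReal_lt_top).ne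
  have hr : ∀ n, ∃ r, (ediam (t n)).toReal < r ∧ r < r₀ ∧
      ENNReal.ofReal (r ^ 3) < ENNReal.ofReal ((ediam (t n)).toReal ^ 3) + η n := by
    intro n
    refine exists_gt_pow_three_lt ?_ (hη n)
    have := ENNReal.toReal_le_of_le_ofReal (by positivity) (htd n)
    linarith
  choose r hr1 hr2 hr3 using hr
  refine ⟨{n | (t n ∩ E).Nonempty}, fun n => n.2.some, fun n => r n, fun n =>
    ⟨n.2.some_mem.2, ENNReal.toReal_nonneg.trans_lt (hr1 n), hr2 n⟩, fun y hy => ?_, ?_⟩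
  · obtain ⟨n, hn⟩ := mem_iUnion.1 (hEt hy)
    refine mem_iUnion.2 ⟨⟨n, ⟨y, hn, hy⟩⟩, ?_⟩
    rw [mem_ball]
    refine lt_of_le_of_lt ?_ (hr1 n)
    rw [dist_edist]
    have hne : (t n ∩ E).Nonempty := ⟨y, hn, hy⟩
    exact ENNReal.toReal_mono (hfin n) (edist_le_ediam_of_mem hn hne.some_mem.1)
  · have h2 : ∀ n : {n | (t n ∩ E).Nonempty}, ENNReal.ofReal (r n ^ 3) ≤
        (⨆ _ : (t n).Nonempty, ediam (t n) ^ (3 : ℝ)) + η n := by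
      intro n
      have hne : (t n).Nonempty := n.2.mono inter_subset_left
      simp only [hne, iSup_pos]
      refine (hr3 n).le.trans (add_le_add_left (le_of_eq ?_) _)
      rw [ENNReal.ofReal_pow ENNReal.toReal_nonneg, ENNReal.ofReal_toReal (hfin n)]
      norm_cast
    calc ∑' n : {n | (t n ∩ E).Nonempty}, ENNReal.ofReal (r n ^ 3)
        ≤ ∑' n : {n | (t n ∩ E).Nonempty},
          ((⨆ _ : (t n).Nonempty, ediam (t n) ^ (3 : ℝ)) + η n) := ENNReal.tsum_le_tsum h2
      _ ≤ ∑' n, ((⨆ _ : (t n).Nonempty, ediam (t n) ^ (3 : ℝ)) + η n) :=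
        ENNReal.tsum_comp_le_tsum_of_injective Subtype.val_injective
          fun n => (⨆ _ : (t n).Nonempty, ediam (t n) ^ (3 : ℝ)) + η n
      _ = (∑' n, ⨆ _ : (t n).Nonempty, ediam (t n) ^ (3 : ℝ)) + ∑' n, η n := ENNReal.tsum_add
      _ ≤ (μH[(3 : ℝ)] E + ε / 2) + ε / 2 := add_le_add hsum.le hηs.le
      _ = _ := by rw [add_assoc, ENNReal.add_halves]

/-- Coverings of a compact set by small balls whose weighted content is controlled by the
weighted Hausdorff measure. -/
theorem exists_weighted_cover {u : Eu 4 → ℝ} (hu : Continuous u) {K : Set (Eu 4)}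
    (hK : IsCompact K) (hKm : μH[(3 : ℝ)] K ≠ ⊤) {r₀ : ℝ} (hr₀ : 0 < r₀) {ε : ℝ≥0∞} (hε : 0 < ε) :
    ∃ s : Finset (Eu 4 × ℝ), (∀ p ∈ s, p.1 ∈ K ∧ 0 < p.2 ∧ p.2 < r₀) ∧
      K ⊆ ⋃ p ∈ s, ball p.1 p.2 ∧
      ∑ p ∈ s, ENNReal.ofReal (p.2 ^ 3 * Real.exp (3 * u p.1)) ≤
        ENNReal.ofReal (Real.exp 3) *
          (∫⁻ x in K, ENNReal.ofReal (Real.exp (3 * u x)) ∂μH[(3 : ℝ)]) + ε := by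
  set E : ℤ → Set (Eu 4) := fun j => K ∩ {x | ⌊u x⌋ = j} with hEdef
  have hEm : ∀ j, MeasurableSet (E j) := fun j =>
    hK.measurableSet.inter (Int.measurable_floor.comp hu.measurable (measurableSet_singleton j))
  have hEK : ⋃ j, E j = K := by
    ext x
    simp [hEdef]
  have hEd : Pairwise (Function.onFun Disjoint E) := by
    intro i j hij
    refine disjoint_left.2 fun x hx hy => hij ?_
    exact hx.2.symm.trans hy.2
  have hEt : ∀ j, μH[(3 : ℝ)] (E j) ≠ ⊤ := fun j =>
    ((measure_mono inter_subset_left).trans_lt hKm.lt_top).ne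
  obtain ⟨η, hη, hηs⟩ := ENNReal.exists_pos_sum_of_countable' hε.ne' ℤ
  have hη' : ∀ j, 0 < η j / ENNReal.ofReal (Real.exp (3 * (j + 1))) := fun j =>
    ENNReal.div_pos (hη j).ne' ENNReal.ofReal_ne_top
  have hcov := fun j => exists_ball_cover (hEt j) hr₀ (hη' j)
  choose ι x r hxr hcov hsum using hcov
  have hlow : ∀ j : ℤ, ENNReal.ofReal (Real.exp (3 * (j + 1))) * μH[(3 : ℝ)] (E j) ≤
      ENNReal.ofReal (Real.exp 3) *
        ∫⁻ x in E j, ENNReal.ofReal (Real.exp (3 * u x)) ∂μH[(3 : ℝ)] := by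
    intro j
    have h1 : ENNReal.ofReal (Real.exp (3 * j)) * μH[(3 : ℝ)] (E j) ≤
        ∫⁻ x in E j, ENNReal.ofReal (Real.exp (3 * u x)) ∂μH[(3 : ℝ)] := by
      rw [← setLIntegral_const]
      refine setLIntegral_mono' (hEm j) fun y hy => ?_
      refine ENNReal.ofReal_le_ofReal (Real.exp_le_exp.2 ?_)
      have : (j : ℝ) ≤ u y := by
        rw [← hy.2]
        exact Int.floor_le _
      linarith
    have e : (3 : ℝ) * (j + 1) = 3 + 3 * j := by ring
    rw [e, Real.exp_add, ENNReal.ofReal_mul (Real.exp_nonneg _), mul_assoc]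
    gcongr
  have htot : ∑' q : Σ j, ι j, ENNReal.ofReal (r q.1 q.2 ^ 3 * Real.exp (3 * u (x q.1 q.2))) ≤
      ENNReal.ofReal (Real.exp 3) *
        (∫⁻ x in K, ENNReal.ofReal (Real.exp (3 * u x)) ∂μH[(3 : ℝ)]) + ε := by
    rw [ENNReal.tsum_sigma']
    calc ∑' j, ∑' n, ENNReal.ofReal (r j n ^ 3 * Real.exp (3 * u (x j n)))
        ≤ ∑' j : ℤ, (ENNReal.ofReal (Real.exp 3) *
          (∫⁻ x in E j, ENNReal.ofReal (Real.exp (3 * u x)) ∂μH[(3 : ℝ)]) + η j) := by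
          refine ENNReal.tsum_le_tsum fun j => ?_
          calc ∑' n, ENNReal.ofReal (r j n ^ 3 * Real.exp (3 * u (x j n)))
              ≤ ∑' n, ENNReal.ofReal (Real.exp (3 * (j + 1))) * ENNReal.ofReal (r j n ^ 3) := by
                refine ENNReal.tsum_le_tsum fun n => ?_
                rw [← ENNReal.ofReal_mul (Real.exp_nonneg _), mul_comm]
                refine ENNReal.ofReal_le_ofReal ?_
                have h0 := (hxr j n).2.1
                have : u (x j n) < j + 1 := by
                  have h1 : ⌊u (x j n)⌋ = j := (hxr j n).1.2
                  have h2 := Int.lt_floor_add_one (u (x j n))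
                  rwa [h1] at h2
                gcongr
            _ = ENNReal.ofReal (Real.exp (3 * (j + 1))) * ∑' n, ENNReal.ofReal (r j n ^ 3) :=
                ENNReal.tsum_mul_left
            _ ≤ ENNReal.ofReal (Real.exp (3 * (j + 1))) *
                (μH[(3 : ℝ)] (E j) + η j / ENNReal.ofReal (Real.exp (3 * (j + 1)))) := by
                gcongr
                exact hsum j
            _ ≤ _ := by
                rw [mul_add, ENNReal.mul_div_cancel (by simp [Real.exp_pos]) ENNReal.ofReal_ne_top]
                exact add_le_add_left (hlow j) _
      _ = ENNReal.ofReal (Real.exp 3) *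
          (∑' j, ∫⁻ x in E j, ENNReal.ofReal (Real.exp (3 * u x)) ∂μH[(3 : ℝ)]) + ∑' j, η j := by
          rw [ENNReal.tsum_add, ENNReal.tsum_mul_left]
      _ ≤ _ := by
          rw [← lintegral_iUnion hEm hEd, hEK]
          gcongr
  classical
  obtain ⟨T, hT⟩ := hK.elim_finite_subcover (fun q : Σ j, ι j => ball (x q.1 q.2) (r q.1 q.2))
    (fun _ => isOpen_ball) (by
      intro y hy
      obtain ⟨n, hn⟩ := mem_iUnion.1 (hcov _ ⟨hy, rfl⟩)
      exact mem_iUnion.2 ⟨⟨_, n⟩, hn⟩)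
  refine ⟨T.image fun q => (x q.1 q.2, r q.1 q.2), ?_, ?_, ?_⟩
  · intro p hp
    obtain ⟨q, -, rfl⟩ := Finset.mem_image.1 hp
    have := hxr q.1 q.2
    exact ⟨this.1.1, this.2⟩
  · intro y hy
    obtain ⟨q, hq, hyq⟩ := mem_iUnion₂.1 (hT hy)
    exact mem_iUnion₂.2 ⟨_, Finset.mem_image_of_mem _ hq, hyq⟩
  · refine (Finset.sum_image_le_of_nonneg (fun _ _ => zero_le)).trans ?_
    exact (ENNReal.sum_le_tsum T).trans htot

end Cover

section Sieve
open scoped ContDiff Topology NNReal ENNReal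

/-- A smooth function vanishing on the balls `B(p.1, p.2)` and equal to `1` off the balls
`B(p.1, 2 p.2)`, for `p ∈ s`. -/
def sieve (s : Finset (Eu 4 × ℝ)) (x : Eu 4) : ℝ := ∏ p ∈ s, (1 - cut p.2 (x - p.1))

variable {s : Finset (Eu 4 × ℝ)} {Ω : Set (Eu 4)} {x : Eu 4}

theorem contDiff_sieve (s : Finset (Eu 4 × ℝ)) : ContDiff ℝ 1 (sieve s) :=
  contDiff_prod fun p _ => contDiff_const.sub
    (((contDiff_cut p.2).of_le (by simp)).comp (contDiff_id.sub contDiff_const))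

theorem abs_sieve_le_one (s : Finset (Eu 4 × ℝ)) (x : Eu 4) : |sieve s x| ≤ 1 := by
  rw [sieve, Finset.abs_prod]
  refine Finset.prod_le_one (fun _ _ => abs_nonneg _) fun p _ => abs_le.2 ?_
  have h1 : 0 ≤ cut p.2 (x - p.1) := cut_nonneg
  have h2 : cut p.2 (x - p.1) ≤ 1 := cut_le_one
  constructor <;> linarith

theorem sieve_eq_zero {p : Eu 4 × ℝ} (hp : p ∈ s) (h0 : 0 < p.2) (hx : x ∈ ball p.1 p.2) :
    sieve s x = 0 := by
  refine Finset.prod_eq_zero hp ?_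
  rw [cut_eq_one h0 (by rw [← dist_eq_norm]; exact (mem_ball.1 hx).le), sub_self]

theorem sieve_eq_one (h0 : ∀ p ∈ s, 0 < p.2) (hx : ∀ p ∈ s, x ∉ ball p.1 (2 * p.2)) :
    sieve s x = 1 := by
  refine Finset.prod_eq_one fun p hp => ?_
  have := hx p hp
  rw [mem_ball, not_lt, dist_eq_norm] at this
  rw [cut_eq_zero (h0 p hp) this, sub_zero]

theorem norm_fderiv_sieve_le (s : Finset (Eu 4 × ℝ)) (x : Eu 4) :
    ‖fderiv ℝ (sieve s) x‖ ≤ ∑ p ∈ s, ‖fderiv ℝ (cut p.2) (x - p.1)‖ := by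
  classical
  induction s using Finset.induction_on with
  | empty =>
    have : sieve ∅ = fun _ => (1 : ℝ) := by
      funext y
      simp [sieve]
    simp [this]
  | insert p s hp ih =>
    have e : sieve (insert p s) = fun y => (1 - cut p.2 (y - p.1)) * sieve s y := by
      funext y
      simp [sieve, Finset.prod_insert hp]
    have h1 : HasFDerivAt (fun y => 1 - cut p.2 (y - p.1)) (-fderiv ℝ (cut p.2) (x - p.1)) x := by
      have := ((contDiff_cut p.2).differentiable (by simp) (x - p.1)).hasFDerivAt.comp x
        ((hasFDerivAt_id x).sub_const p.1)
      exact this.const_sub 1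
    have h2 := ((contDiff_sieve s).differentiable one_ne_zero x).hasFDerivAt
    have h3 : HasFDerivAt (fun y => (1 - cut p.2 (y - p.1)) * sieve s y) _ x := h1.mul h2
    rw [e, h3.fderiv, Finset.sum_insert hp, add_comm]
    refine (norm_add_le _ _).trans (add_le_add ?_ ?_)
    · rw [norm_smul, norm_neg]
      exact mul_le_of_le_one_left (norm_nonneg _) (abs_sieve_le_one s x)
    · rw [norm_smul]
      refine (mul_le_of_le_one_left (norm_nonneg _) ?_).trans ih
      have h1 : 0 ≤ cut p.2 (x - p.1) := cut_nonneg
      have h2 : cut p.2 (x - p.1) ≤ 1 := cut_le_one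
      rw [Real.norm_eq_abs, abs_le]
      constructor <;> linarith

theorem fderiv_cut_eq_zero {r : ℝ} (hr : 0 < r) (hx : 2 * r < ‖x‖) : fderiv ℝ (cut r) x = 0 := by
  rw [(cut_eventuallyEq_zero hr hx).fderiv_eq]
  simp

theorem indicator_sieve_eventuallyEq (hΩ : IsOpen Ω) (h0 : ∀ p ∈ s, 0 < p.2)
    (hcov : frontier Ω ⊆ ⋃ p ∈ s, ball p.1 p.2) (x : Eu 4) :
    Ω.indicator (sieve s) =ᶠ[𝓝 x] sieve s ∨ Ω.indicator (sieve s) =ᶠ[𝓝 x] fun _ => 0 := by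
  by_cases hx : x ∈ Ω
  · left
    filter_upwards [hΩ.mem_nhds hx] with y hy
    exact indicator_of_mem hy _
  right
  by_cases hx2 : x ∈ closure Ω
  · have hf : x ∈ frontier Ω := by
      rw [hΩ.frontier_eq]
      exact ⟨hx2, hx⟩
    obtain ⟨p, hp, hxp⟩ := mem_iUnion₂.1 (hcov hf)
    filter_upwards [isOpen_ball.mem_nhds hxp] with y hy
    exact indicator_apply_eq_zero.2 fun _ => sieve_eq_zero hp (h0 p hp) hy
  · filter_upwards [isClosed_closure.isOpen_compl.mem_nhds hx2] with y hy
    exact indicator_of_notMem (fun h => hy (subset_closure h)) _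

theorem contDiff_indicator_sieve (hΩ : IsOpen Ω) (h0 : ∀ p ∈ s, 0 < p.2)
    (hcov : frontier Ω ⊆ ⋃ p ∈ s, ball p.1 p.2) : ContDiff ℝ 1 (Ω.indicator (sieve s)) := by
  refine contDiff_iff_contDiffAt.2 fun x => ?_
  rcases indicator_sieve_eventuallyEq hΩ h0 hcov x with h | h
  · exact (contDiff_sieve s).contDiffAt.congr_of_eventuallyEq h
  · exact contDiffAt_const.congr_of_eventuallyEq h

theorem hasCompactSupport_indicator_sieve (hb : Bornology.IsBounded Ω) :
    HasCompactSupport (Ω.indicator (sieve s)) :=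
  HasCompactSupport.of_support_subset_isCompact hb.isCompact_closure
    (support_indicator_subset.trans subset_closure)

theorem norm_fderiv_indicator_sieve_le (hΩ : IsOpen Ω) (h0 : ∀ p ∈ s, 0 < p.2)
    (hcov : frontier Ω ⊆ ⋃ p ∈ s, ball p.1 p.2) (x : Eu 4) :
    ‖fderiv ℝ (Ω.indicator (sieve s)) x‖ ≤ ∑ p ∈ s, ‖fderiv ℝ (cut p.2) (x - p.1)‖ := by
  rcases indicator_sieve_eventuallyEq hΩ h0 hcov x with h | h
  · rw [h.fderiv_eq]
    exact norm_fderiv_sieve_le s x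
  · rw [h.fderiv_eq]
    simpa using Finset.sum_nonneg fun p _ => norm_nonneg (fderiv ℝ (cut p.2) (x - p.1))

/-- A uniform bound for the weighted energy of the cutoffs at small scales. -/
theorem exists_lintegral_cut_le : ∃ B : ℝ≥0, ∀ (u : Eu 4 → ℝ) (x₀ : Eu 4) (r : ℝ), 0 < r →
    (∀ x ∈ closedBall x₀ (2 * r), u x ≤ u x₀ + 1) →
      ∫⁻ x, ENNReal.ofReal (Real.exp (3 * u x) * ‖fderiv ℝ (cut r) (x - x₀)‖) ≤
        B * ENNReal.ofReal (r ^ 3 * Real.exp (3 * u x₀)) := by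
  obtain ⟨A, hA0, hA⟩ := exists_cut_bound
  set v := volume.real (closedBall (0 : Eu 4) 1)
  refine ⟨(16 * A * Real.exp 3 * v).toNNReal, fun u x₀ r hr hu => ?_⟩
  have hpt : ∀ x, ENNReal.ofReal (Real.exp (3 * u x) * ‖fderiv ℝ (cut r) (x - x₀)‖) ≤
      (closedBall x₀ (2 * r)).indicator
        (fun _ => ENNReal.ofReal (Real.exp (3 * (u x₀ + 1)) * (A / r))) x := by
    intro x
    by_cases hx : x ∈ closedBall x₀ (2 * r)
    · rw [indicator_of_mem hx]
      refine ENNReal.ofReal_le_ofReal ?_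
      gcongr
      · exact hu x hx
      · exact (hA r hr _).1
    · rw [mem_closedBall, not_le, dist_eq_norm] at hx
      rw [fderiv_cut_eq_zero hr hx]
      simp
  refine (lintegral_mono hpt).trans ?_
  rw [lintegral_indicator_const isClosed_closedBall.measurableSet,
    Measure.addHaar_closedBall' _ _ (by positivity : 0 ≤ 2 * r)]
  rw [← ofReal_measureReal measure_closedBall_lt_top.ne, ← ENNReal.ofReal_mul (by positivity),
    ← ENNReal.ofReal_mul (by positivity)]
  change _ ≤ ENNReal.ofReal (16 * A * Real.exp 3 * v) * _
  rw [← ENNReal.ofReal_mul (by positivity)]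
  refine ENNReal.ofReal_le_ofReal (le_of_eq ?_)
  rw [mul_add, mul_one, Real.exp_add]
  simp only [finrank_euclideanSpace, Fintype.card_fin]
  field_simp
  ring

theorem exists_forall_le_add_one {u : Eu 4 → ℝ} (hu : Continuous u) {K : Set (Eu 4)}
    (hK : IsCompact K) :
    ∃ r > 0, ∀ x₀ ∈ K, ∀ x, dist x x₀ < r → u x ≤ u x₀ + 1 := by
  have h := hK.uniformContinuousAt_of_continuousAt u (fun x _ => hu.continuousAt)
    (dist_mem_uniformity one_pos)
  obtain ⟨r, hr, h⟩ := Metric.mem_uniformity_dist.1 h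
  refine ⟨r, hr, fun x₀ hx₀ x hx => ?_⟩
  have : dist (u x₀) (u x) < 1 := h (by rwa [dist_comm]) hx₀
  rw [Real.dist_eq, abs_lt] at this
  linarith

theorem lintegral_diff_cthickening_le {u : Eu 4 → ℝ} (hu : ContDiff ℝ ∞ u) {C B : ℝ≥0}
    (hC : ∀ φ : Eu 4 → ℝ, ContDiff ℝ 1 φ → HasCompactSupport φ →
      eLpNorm (fun x => φ x * Real.exp (3 * u x)) (4 / 3 : ℝ≥0) volume ≤
        C * eLpNorm (fun x => Real.exp (3 * u x) • fderiv ℝ φ x) 1 volume)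
    (hB : ∀ (x₀ : Eu 4) (r : ℝ), 0 < r →
      (∀ x ∈ closedBall x₀ (2 * r), u x ≤ u x₀ + 1) →
      ∫⁻ x, ENNReal.ofReal (Real.exp (3 * u x) * ‖fderiv ℝ (cut r) (x - x₀)‖) ≤
        B * ENNReal.ofReal (r ^ 3 * Real.exp (3 * u x₀)))
    (hΩ : IsOpen Ω) (hb : Bornology.IsBounded Ω) (hm : μH[(3 : ℝ)] (frontier Ω) ≠ ⊤)
    {δ : ℝ} (hδ : 0 < δ) :
    (∫⁻ x in Ω \ cthickening δ (frontier Ω), ENNReal.ofReal (Real.exp (4 * u x))) ^ (3 / 4 : ℝ) ≤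
      C * (B * (ENNReal.ofReal (Real.exp 3) *
        ∫⁻ x in frontier Ω, ENNReal.ofReal (Real.exp (3 * u x)) ∂μH[(3 : ℝ)])) := by
  have hK : IsCompact (frontier Ω) :=
    Metric.isCompact_of_isClosed_isBounded isClosed_frontier
      (hb.closure.subset frontier_subset_closure)
  obtain ⟨r₁, hr₁, hr⟩ := exists_forall_le_add_one hu.continuous hK
  set W := ENNReal.ofReal (Real.exp 3) *
        ∫⁻ x in frontier Ω, ENNReal.ofReal (Real.exp (3 * u x)) ∂μH[(3 : ℝ)]
  refine ENNReal.le_of_forall_pos_le_add fun ε hε _ => ?_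
  obtain ⟨s, hs, hcov, hsum⟩ := exists_weighted_cover hu.continuous hK hm
    (r₀ := min (r₁ / 2) (δ / 2)) (by positivity) (ε := (ε / (C * B + 1) : ℝ≥0))
    (by positivity)
  have h0 : ∀ p ∈ s, 0 < p.2 := fun p hp => (hs p hp).2.1
  set φ := Ω.indicator (sieve s) with hφ
  have hmain := hC φ (contDiff_indicator_sieve hΩ h0 hcov) (hasCompactSupport_indicator_sieve hb)
  have hright : eLpNorm (fun x => Real.exp (3 * u x) • fderiv ℝ φ x) 1 volume ≤
      B * (W + (ε / (C * B + 1) : ℝ≥0)) := by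
    rw [eLpNorm_one_eq_lintegral_enorm]
    calc ∫⁻ x, ‖Real.exp (3 * u x) • fderiv ℝ φ x‖ₑ
        ≤ ∫⁻ x, ∑ p ∈ s, ENNReal.ofReal
            (Real.exp (3 * u x) * ‖fderiv ℝ (cut p.2) (x - p.1)‖) := by
          refine lintegral_mono fun x => ?_
          rw [← ENNReal.ofReal_sum_of_nonneg fun _ _ => by positivity, ← ofReal_norm, norm_smul,
            Real.norm_of_nonneg (Real.exp_nonneg _), ← Finset.mul_sum]
          refine ENNReal.ofReal_le_ofReal ?_
          gcongr
          exact norm_fderiv_indicator_sieve_le hΩ h0 hcov x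
      _ = ∑ p ∈ s, ∫⁻ x, ENNReal.ofReal
            (Real.exp (3 * u x) * ‖fderiv ℝ (cut p.2) (x - p.1)‖) := by
          refine lintegral_finsetSum _ fun p _ => ?_
          exact ((Real.continuous_exp.comp (continuous_const.mul hu.continuous)).mul
            (((contDiff_cut p.2).continuous_fderiv (by simp)).comp
              (continuous_id.sub continuous_const)).norm).measurable.ennreal_ofReal
      _ ≤ ∑ p ∈ s, B * ENNReal.ofReal (p.2 ^ 3 * Real.exp (3 * u p.1)) := by
          refine Finset.sum_le_sum fun p hp => hB p.1 p.2 (h0 p hp) fun x hx => ?_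
          obtain ⟨hp1, -, hp3⟩ := hs p hp
          refine hr p.1 hp1 x ((mem_closedBall.1 hx).trans_lt ?_)
          linarith [min_le_left (r₁ / 2) (δ / 2)]
      _ ≤ _ := by
          rw [← Finset.mul_sum]
          gcongr
  have hleft : (∫⁻ x in Ω \ cthickening δ (frontier Ω),
      ENNReal.ofReal (Real.exp (4 * u x))) ^ (3 / 4 : ℝ) ≤
      eLpNorm (fun x => φ x * Real.exp (3 * u x)) (4 / 3 : ℝ≥0) volume := by
    rw [eLpNorm_eq_lintegral_rpow_enorm_toReal (by simp) ENNReal.coe_ne_top]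
    have e1 : 1 / ((4 / 3 : ℝ≥0) : ℝ≥0∞).toReal = (3 / 4 : ℝ) := by
      rw [ENNReal.coe_toReal]
      push_cast
      norm_num
    rw [e1]
    refine ENNReal.rpow_le_rpow ?_ (by norm_num)
    rw [← lintegral_indicator (hΩ.measurableSet.diff isClosed_cthickening.measurableSet)]
    refine lintegral_mono fun x => ?_
    by_cases hx : x ∈ Ω \ cthickening δ (frontier Ω)
    · have h1 : φ x = 1 := by
        rw [hφ, indicator_of_mem hx.1]
        refine sieve_eq_one h0 fun p hp hxp => hx.2 ?_
        obtain ⟨hp1, -, hp3⟩ := hs p hp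
        refine mem_cthickening_of_dist_le x p.1 δ _ hp1 ((mem_ball.1 hxp).le.trans ?_)
        linarith [min_le_right (r₁ / 2) (δ / 2)]
      rw [indicator_of_mem hx, h1, one_mul, Real.enorm_eq_ofReal (Real.exp_nonneg _),
        ENNReal.ofReal_rpow_of_pos (Real.exp_pos _), ← Real.exp_mul]
      refine ENNReal.ofReal_le_ofReal (Real.exp_le_exp.2 (le_of_eq ?_))
      simp
      ring
    · rw [indicator_of_notMem hx]
      exact zero_le
  calc _ ≤ C * (B * (W + (ε / (C * B + 1) : ℝ≥0))) := hleft.trans (hmain.trans (by gcongr))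
    _ = C * (B * W) + (C * B * (ε / (C * B + 1)) : ℝ≥0) := by
      push_cast
      ring
    _ ≤ _ := by
      gcongr
      rw [mul_div_assoc', div_le_iff₀ (by positivity)]
      nlinarith [hε.le, mul_comm ε (C * B)]

theorem lintegral_rpow_le_frontier {u : Eu 4 → ℝ} {C : ℝ≥0∞}
    (hΩ : IsOpen Ω)
    (h : ∀ δ : ℝ, 0 < δ → (∫⁻ x in Ω \ cthickening δ (frontier Ω),
      ENNReal.ofReal (Real.exp (4 * u x))) ^ (3 / 4 : ℝ) ≤ C) :
    (∫⁻ x in Ω, ENNReal.ofReal (Real.exp (4 * u x))) ^ (3 / 4 : ℝ) ≤ C := by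
  have hU : ⋃ n : ℕ, Ω \ cthickening (1 / (n + 1 : ℝ)) (frontier Ω) = Ω := by
    refine (iUnion_subset fun n => sdiff_subset).antisymm fun x hx => ?_
    have hx2 : x ∉ frontier Ω := fun h => by
      rw [hΩ.frontier_eq] at h
      exact h.2 hx
    rw [mem_iff_infEDist_zero_of_closed isClosed_frontier] at hx2
    have hlim := ENNReal.tendsto_ofReal (tendsto_one_div_add_atTop_nhds_zero_nat (𝕜 := ℝ))
    rw [ENNReal.ofReal_zero] at hlim
    obtain ⟨n, hn⟩ := (hlim.eventually_lt_const (pos_iff_ne_zero.2 hx2)).exists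
    exact mem_iUnion.2 ⟨n, hx, fun h => hn.not_ge h⟩
  have hmono : Monotone fun n : ℕ => Ω \ cthickening (1 / (n + 1 : ℝ)) (frontier Ω) := by
    intro m n hmn
    refine sdiff_subset_sdiff_right (cthickening_mono ?_ _)
    gcongr
  have hlim := tendsto_measure_iUnion_atTop
    (μ := volume.withDensity fun x => ENNReal.ofReal (Real.exp (4 * u x))) hmono
  rw [hU, withDensity_apply _ hΩ.measurableSet] at hlim
  refine le_of_tendsto ((ENNReal.continuous_rpow_const.tendsto _).comp hlim)
    (Eventually.of_forall fun n => ?_)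
  simp only [Function.comp_apply]
  rw [withDensity_apply _ (hΩ.measurableSet.diff isClosed_cthickening.measurableSet)]
  exact h _ (by positivity)

end Sieve

/-- **Isoperimetric inequality from `σ₂` pinching.** On `(ℝ⁴, e^{2u}|dx|²)` complete,
with `∫|Δ²u| < ∞`, `∫ R² e^{4u} < ∞` and `∫ σ₂(M) dx < 2π²`, every bounded smooth
domain `Ω` satisfies `Vol_g(Ω)^{3/4} ≤ C Area_g(∂Ω)`. -/
theorem isoperimetric_of_sigma2
    (u : Eu 4 → ℝ) (hu : ContDiff ℝ (⊤ : ℕ∞) u)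
    (R : Eu 4 → ℝ)
    (hR : ∀ x, R x = -6 * Real.exp (-2 * u x) * (lap u x + ‖gradient u x‖ ^ 2))
    (hcomplete : ConfComplete u)
    (hQL1 : Integrable (fun x => lapIter 2 u x))
    (hRL2 : Integrable (fun x => R x ^ 2 * Real.exp (4 * u x)))
    (hsigmaL1 : Integrable (fun x => sigma2 (schoutenMatrix u x)))
    (hsigma : (∫ x, sigma2 (schoutenMatrix u x)) < 2 * Real.pi ^ 2) :
    ∃ C : ℝ, 0 < C ∧
      ∀ Ω : Set (Eu 4), IsOpen Ω → Bornology.IsBounded Ω → HasSmoothBoundary Ω →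
        (∫ x in Ω, Real.exp (4 * u x)) ^ ((3 : ℝ) / 4) ≤
          C * ∫ x in frontier Ω, Real.exp (3 * u x) ∂μH[(3 : ℝ)] := by
  have hf : Integrable (lap (lap u)) := hQL1
  have hS : Integrable fun x => confLap u x ^ 2 := by
    refine (hRL2.const_mul (1 / 36)).congr (ae_of_all _ fun x => ?_)
    have h1 : Real.exp (-2 * u x) ^ 2 * Real.exp (4 * u x) = 1 := by
      rw [← Real.exp_nat_mul, ← Real.exp_add, ← Real.exp_zero]
      congr 1
      push_cast
      ring
    simp only [hR, confLap, gradSq, norm_gradient_sq]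
    linear_combination (lap u x + ∑ i, pd i u x ^ 2) ^ 2 * h1
  have hm : Integrable (schoutenSq u) := by
    refine (hS.sub (hsigmaL1.const_mul 2)).congr (ae_of_all _ fun x => ?_)
    exact (sum_schoutenMatrix_sq hu x).symm
  have hf8 : ∫ x, lap (lap u) x < 8 * Real.pi ^ 2 := by
    rw [integral_lap_lap_eq hu hS hf hsigmaL1]
    linarith
  obtain ⟨C, hC⟩ := weighted_sobolev hu (integrable_gradSq_sq hu hS hm hf hf8)
  obtain ⟨B, hB⟩ := exists_lintegral_cut_le
  refine ⟨C * (B * Real.exp 3) + 1, by positivity, fun Ω hΩ hb hs => ?_⟩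
  have hmf := hausdorffMeasure_frontier_lt_top hb hs
  have hK : IsCompact (frontier Ω) :=
    Metric.isCompact_of_isClosed_isBounded isClosed_frontier
      (hb.closure.subset frontier_subset_closure)
  have hc4 : Continuous fun x => Real.exp (4 * u x) :=
    Real.continuous_exp.comp (continuous_const.mul hu.continuous)
  have hc3 : Continuous fun x => Real.exp (3 * u x) :=
    Real.continuous_exp.comp (continuous_const.mul hu.continuous)
  have hmain := lintegral_rpow_le_frontier hΩ fun δ hδ =>
    lintegral_diff_cthickening_le hu hC (hB u) hΩ hb hmf.ne hδ
  have hW_int : IntegrableOn (fun x => Real.exp (3 * u x)) (frontier Ω) μH[(3 : ℝ)] :=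
    hc3.continuousOn.integrableOn_of_subset_isCompact hK isClosed_frontier.measurableSet
      Subset.rfl hmf.ne
  rw [integral_eq_lintegral_of_nonneg_ae (ae_of_all _ fun x => Real.exp_nonneg _)
    hc4.aestronglyMeasurable, integral_eq_lintegral_of_nonneg_ae
    (ae_of_all _ fun x => Real.exp_nonneg _) hc3.aestronglyMeasurable, ENNReal.toReal_rpow]
  set W := ∫⁻ x in frontier Ω, ENNReal.ofReal (Real.exp (3 * u x)) ∂μH[(3 : ℝ)] with hW
  have hWt : W ≠ ⊤ := by
    have := hW_int.2.ne
    simpa [hW, Real.enorm_eq_ofReal (Real.exp_nonneg _)] using this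
  refine (ENNReal.toReal_mono (by finiteness) hmain).trans ?_
  simp only [ENNReal.toReal_mul, ENNReal.coe_toReal, ENNReal.toReal_ofReal (Real.exp_nonneg _)]
  have : 0 ≤ W.toReal := ENNReal.toReal_nonneg
  nlinarith
end
end

section
/- Let n = 2k ≥ 4 be even and let u ∈ C^∞(ℝⁿ). Set f := (−Δ)^k u and R := −2(n−1)e^{−2u}(Δu + ((n−2)/2)|∇u|²). Assume ∫_{ℝⁿ}|f(x)| dx < ∞ and ∫_{ℝⁿ}(max(−R(x),0))^{n/2} e^{nu(x)} dx < ∞. Let v(x) := (1/(2c_n)) ∫_{ℝⁿ} log(|y|/|x−y|) f(y) dy (which is a well-defined smooth function) and h := u − v. Then limsup_{r→∞} ⨍_{B_{2r}(0)∖B_r(0)} Δh dx ≤ 0 and limsup_{r→∞} ⨍_{B_r(0)} Δh dx ≤ 0. -/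
open MeasureTheory Metric Filter Set

noncomputable section

/-- The constant `c_n = 2^(n-2) ((n-2)/2)! π^(n/2)`. -/
def cQ (n : ℕ) : ℝ := 2 ^ (n - 2) * (Nat.factorial ((n - 2) / 2)) * Real.pi ^ (n / 2)

/-- The scalar curvature of the conformal metric `e^{2u}|dx|²`:
`R = -2(n-1) e^{-2u} (Δu + ((n-2)/2)|∇u|²)`. -/
def scal {n : ℕ} (u : Eu n → ℝ) (x : Eu n) : ℝ :=
  -2 * ((n : ℝ) - 1) * Real.exp (-2 * u x) *
    (lap u x + ((n : ℝ) - 2) / 2 * ‖gradient u x‖ ^ 2)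

section Kernel

set_option maxSynthPendingDepth 3

variable {E : Type*} [NormedAddCommGroup E]

/-- The kernel `½ log (|z|² + a)`; it is `log |z|` for `a = 0` and smooth for `a > 0`. -/
def logKernel (a : ℝ) (z : E) : ℝ := 1 / 2 * Real.log (‖z‖ ^ 2 + a)

lemma measurable_logKernel [MeasurableSpace E] [BorelSpace E] (a : ℝ) :
    Measurable (logKernel a : E → ℝ) := by
  unfold logKernel
  fun_prop

lemma norm_logKernel_sub_le {e : ℝ} (he : 0 < e) {z : E} (hz : z ≠ 0) :
    ‖logKernel (e ^ 2) z - logKernel 0 z‖ ≤ e * ‖z‖⁻¹ := by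
  have hz' : 0 < ‖z‖ := norm_pos_iff.2 hz
  have h0 : logKernel (0 : ℝ) z = Real.log ‖z‖ := by
    rw [logKernel, add_zero, Real.log_pow]; push_cast; ring
  have h1 : Real.log (‖z‖ ^ 2) ≤ Real.log (‖z‖ ^ 2 + e ^ 2) :=
    Real.log_le_log (by positivity) (by linarith [sq_nonneg e])
  have h2 : Real.log (‖z‖ ^ 2 + e ^ 2) ≤ Real.log ((‖z‖ * (1 + e * ‖z‖⁻¹)) ^ 2) := by
    refine Real.log_le_log (by positivity) ?_
    have : ‖z‖ * (1 + e * ‖z‖⁻¹) = ‖z‖ + e := by field_simp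
    rw [this]
    nlinarith
  have h3 : Real.log (1 + e * ‖z‖⁻¹) ≤ e * ‖z‖⁻¹ :=
    (Real.log_le_sub_one_of_pos (by positivity)).trans (by linarith)
  rw [Real.log_pow] at h1 h2
  rw [Real.log_mul hz'.ne' (by positivity)] at h2
  push_cast at h1 h2
  rw [h0, logKernel, Real.norm_eq_abs, abs_le]
  constructor <;> nlinarith [mul_pos he (inv_pos.2 hz')]

lemma inv_norm_sq_sub_nonneg (e : ℝ) {z : E} (hz : z ≠ 0) :
    0 ≤ (‖z‖ ^ 2)⁻¹ - (‖z‖ ^ 2 + e ^ 2)⁻¹ := by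
  have hz' : 0 < ‖z‖ := norm_pos_iff.2 hz
  rw [sub_nonneg]
  gcongr
  linarith [sq_nonneg e]

lemma inv_norm_sq_sub_le {e : ℝ} (he : 0 < e) {z : E} (hz : z ≠ 0) :
    (‖z‖ ^ 2)⁻¹ - (‖z‖ ^ 2 + e ^ 2)⁻¹ ≤ e * ‖z‖⁻¹ ^ 3 := by
  have hz' : 0 < ‖z‖ := norm_pos_iff.2 hz
  rw [← sub_nonneg]
  have : e * ‖z‖⁻¹ ^ 3 - ((‖z‖ ^ 2)⁻¹ - (‖z‖ ^ 2 + e ^ 2)⁻¹) =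
      e * (‖z‖ ^ 2 + e ^ 2 - e * ‖z‖) * (‖z‖⁻¹ ^ 3 * (‖z‖ ^ 2 + e ^ 2)⁻¹) := by
    field_simp
    ring
  rw [this]
  have : 0 ≤ ‖z‖ ^ 2 + e ^ 2 - e * ‖z‖ := by nlinarith [sq_nonneg (‖z‖ - e), mul_pos he hz']
  positivity

variable [InnerProductSpace ℝ E]

/-- The inner product of a real inner product space as a continuous bilinear map. -/
def innerBilin (E : Type*) [NormedAddCommGroup E] [InnerProductSpace ℝ E] : E →L[ℝ] E →L[ℝ] ℝ :=
  innerSL ℝ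

lemma norm_innerBilin_apply (z : E) : ‖innerBilin E z‖ = ‖z‖ :=
  innerSL_apply_norm (𝕜 := ℝ) z

lemma norm_innerBilin_le : ‖innerBilin E‖ ≤ 1 :=
  ContinuousLinearMap.opNorm_le_bound _ zero_le_one fun z => by
    rw [norm_innerBilin_apply, one_mul]

/-- The derivative of `logKernel`. -/
def logKernelDeriv (a : ℝ) (z : E) : E →L[ℝ] ℝ := (‖z‖ ^ 2 + a)⁻¹ • innerBilin E z

/-- The second derivative of `logKernel`. -/
def logKernelHess (a : ℝ) (z : E) : E →L[ℝ] E →L[ℝ] ℝ :=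
  (‖z‖ ^ 2 + a)⁻¹ • innerBilin E -
    (2 * ((‖z‖ ^ 2 + a)⁻¹) ^ 2) • (innerBilin E z).smulRight (innerBilin E z)

lemma hasFDerivAt_norm_sq_add (a : ℝ) (z : E) :
    HasFDerivAt (fun z : E => ‖z‖ ^ 2 + a) ((2 : ℝ) • innerBilin E z) z := by
  have := ((hasStrictFDerivAt_norm_sq z).hasFDerivAt).add_const a
  refine this.congr_fderiv ?_
  ext y
  simp [innerBilin, two_smul]
  rfl

lemma hasFDerivAt_logKernel {a : ℝ} (ha : 0 < a) (z : E) :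
    HasFDerivAt (logKernel a) (logKernelDeriv a z) z := by
  have h := ((hasFDerivAt_norm_sq_add a z).log (by positivity)).const_mul (1 / 2 : ℝ)
  refine h.congr_fderiv ?_
  ext y
  simp [logKernelDeriv]
  ring

lemma hasFDerivAt_logKernelDeriv {a : ℝ} (ha : 0 < a) (z : E) :
    HasFDerivAt (logKernelDeriv a) (logKernelHess a z) z := by
  have hq : ‖z‖ ^ 2 + a ≠ 0 := by positivity
  have h := ((hasDerivAt_inv hq).comp_hasFDerivAt z (hasFDerivAt_norm_sq_add a z)).smul
    (innerBilin E).hasFDerivAt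
  refine h.congr_fderiv ?_
  ext y w
  simp [logKernelHess]
  ring

lemma norm_smulRight_innerBilin_le (z : E) :
    ‖(innerBilin E z).smulRight (innerBilin E z)‖ ≤ ‖z‖ ^ 2 := by
  rw [ContinuousLinearMap.norm_smulRight_apply, norm_innerBilin_apply, sq]

lemma norm_logKernelDeriv_le {e : ℝ} (he : 0 < e) (z : E) :
    ‖logKernelDeriv (e ^ 2) z‖ ≤ e⁻¹ := by
  rw [logKernelDeriv, norm_smul, norm_innerBilin_apply, Real.norm_of_nonneg (by positivity),
    inv_mul_le_iff₀ (by positivity), ← div_eq_mul_inv, le_div_iff₀ he]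
  nlinarith [sq_nonneg (‖z‖ - e), norm_nonneg z]

lemma norm_logKernelHess_le_inv {a : ℝ} (ha : 0 ≤ a) (z : E) :
    ‖logKernelHess a z‖ ≤ 3 * (‖z‖ ^ 2 + a)⁻¹ := by
  have hq : 0 ≤ ‖z‖ ^ 2 + a := by positivity
  rw [logKernelHess]
  refine (norm_sub_le _ _).trans ?_
  rw [norm_smul, norm_smul, Real.norm_of_nonneg (by positivity),
    Real.norm_of_nonneg (by positivity)]
  have h1 := norm_innerBilin_le (E := E)
  have h2 := norm_smulRight_innerBilin_le z
  have h3 : (‖z‖ ^ 2 + a)⁻¹ * ‖z‖ ^ 2 ≤ 1 :=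
    (mul_le_mul_of_nonneg_left (by linarith) (by positivity)).trans inv_mul_le_one
  calc _ ≤ (‖z‖ ^ 2 + a)⁻¹ * 1 + (2 * ((‖z‖ ^ 2 + a)⁻¹) ^ 2) * ‖z‖ ^ 2 := by gcongr
    _ = (‖z‖ ^ 2 + a)⁻¹ + 2 * (‖z‖ ^ 2 + a)⁻¹ * ((‖z‖ ^ 2 + a)⁻¹ * ‖z‖ ^ 2) := by ring
    _ ≤ (‖z‖ ^ 2 + a)⁻¹ + 2 * (‖z‖ ^ 2 + a)⁻¹ * 1 := by gcongr
    _ = _ := by ring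

lemma norm_logKernelHess_le {e : ℝ} (he : 0 < e) (z : E) :
    ‖logKernelHess (e ^ 2) z‖ ≤ 3 * (e ^ 2)⁻¹ := by
  refine (norm_logKernelHess_le_inv (by positivity) z).trans ?_
  gcongr
  linarith [sq_nonneg ‖z‖]

lemma norm_logKernelDeriv_sub_le {e : ℝ} (he : 0 < e) {z : E} (hz : z ≠ 0) :
    ‖logKernelDeriv (e ^ 2) z - logKernelDeriv 0 z‖ ≤ e * ‖z‖⁻¹ ^ 2 := by
  have hz' : 0 < ‖z‖ := norm_pos_iff.2 hz
  have key : logKernelDeriv (e ^ 2) z - logKernelDeriv 0 z =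
      ((‖z‖ ^ 2 + e ^ 2)⁻¹ - (‖z‖ ^ 2)⁻¹) • innerBilin E z := by
    simp only [logKernelDeriv, add_zero]
    module
  rw [key, norm_smul, norm_innerBilin_apply, norm_sub_rev,
    Real.norm_of_nonneg (inv_norm_sq_sub_nonneg e hz)]
  calc _ ≤ e * ‖z‖⁻¹ ^ 3 * ‖z‖ := by gcongr; exact inv_norm_sq_sub_le he hz
    _ = _ := by field_simp

lemma norm_logKernelHess_sub_le {e : ℝ} (he : 0 < e) {z : E} (hz : z ≠ 0) :
    ‖logKernelHess (e ^ 2) z - logKernelHess 0 z‖ ≤ 5 * e * ‖z‖⁻¹ ^ 3 := by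
  have hz' : 0 < ‖z‖ := norm_pos_iff.2 hz
  set p := (‖z‖ ^ 2)⁻¹ with hp
  set q := (‖z‖ ^ 2 + e ^ 2)⁻¹ with hq
  have hq0 : 0 < q := by positivity
  have h1 : 0 ≤ p - q := inv_norm_sq_sub_nonneg e hz
  have h2 : p - q ≤ e * ‖z‖⁻¹ ^ 3 := inv_norm_sq_sub_le he hz
  have hp1 : p * ‖z‖ ^ 2 = 1 := inv_mul_cancel₀ (by positivity)
  have key : logKernelHess (e ^ 2) z - logKernelHess 0 z =
      -((p - q) • innerBilin E) +
        (2 * (p ^ 2 - q ^ 2)) • (innerBilin E z).smulRight (innerBilin E z) := by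
    simp only [logKernelHess, add_zero, ← hp, ← hq]
    module
  have h3 : 0 ≤ p ^ 2 - q ^ 2 := by nlinarith
  rw [key]
  refine (norm_add_le _ _).trans ?_
  rw [norm_neg, norm_smul, norm_smul, Real.norm_of_nonneg h1, Real.norm_of_nonneg (by positivity)]
  calc _ ≤ (p - q) * 1 + 2 * (p ^ 2 - q ^ 2) * ‖z‖ ^ 2 := by
        gcongr
        · exact norm_innerBilin_le
        · exact norm_smulRight_innerBilin_le z
    _ = (p - q) + 2 * (p - q) * (p * ‖z‖ ^ 2) + 2 * (p - q) * (q * ‖z‖ ^ 2) := by ring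
    _ ≤ (p - q) + 2 * (p - q) * 1 + 2 * (p - q) * 1 := by
        rw [hp1]
        gcongr
        rw [← hp1]
        gcongr
        linarith
    _ ≤ _ := by linarith

end Kernel

section Potential

open scoped Topology

set_option maxSynthPendingDepth 3

variable {E : Type*} [NormedAddCommGroup E] [NormedSpace ℝ E] [FiniteDimensional ℝ E]
  [MeasurableSpace E] [BorelSpace E] {μ : Measure E} [μ.IsAddHaarMeasure]

lemma integrable_indicator_ball_inv_norm_pow {p : ℕ} (hp : p < Module.finrank ℝ E) (ρ : ℝ) :
    Integrable ((ball (0 : E) ρ).indicator fun z => ‖z‖⁻¹ ^ p) μ := by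
  rw [integrable_indicator_iff measurableSet_ball]
  refine integrableOn_ball_of_norm_le_rpow (C := 1) (α := p) (by omega) (by exact_mod_cast hp)
    (ae_of_all _ fun z => ?_) (by fun_prop)
  rw [Real.norm_of_nonneg (by positivity), Real.rpow_neg (norm_nonneg z), Real.rpow_natCast,
    one_mul, inv_pow]

lemma inv_pow_le_one_add_inv_pow_three {t : ℝ} (ht : 0 ≤ t) {p : ℕ} (hp : p ≤ 3) :
    t⁻¹ ^ p ≤ 1 + t⁻¹ ^ 3 := by
  have h0 : 0 ≤ t⁻¹ := inv_nonneg.2 ht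
  rcases le_total t⁻¹ 1 with h | h
  · linarith [pow_le_one₀ h0 h (n := p), pow_nonneg h0 3]
  · linarith [pow_le_pow_right₀ h hp]

/-- The Riesz-type potentials `∫ (1 + |x - y|⁻³) |f y| dy` are locally bounded in `x`. -/
lemma exists_bound_integral_riesz (hE : 4 ≤ Module.finrank ℝ E) {f : E → ℝ} (hf : Continuous f)
    (hfi : Integrable f μ) (x₀ : E) :
    ∃ B, ∀ x ∈ ball x₀ 1, Integrable (fun y => (1 + ‖x - y‖⁻¹ ^ 3) * ‖f y‖) μ ∧
      ∫ y, (1 + ‖x - y‖⁻¹ ^ 3) * ‖f y‖ ∂μ ≤ B := by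
  obtain ⟨M, hM⟩ := (isCompact_closedBall x₀ 2).exists_bound_of_continuousOn hf.continuousOn
  set κ : E → ℝ := (ball (0 : E) 1).indicator fun z => ‖z‖⁻¹ ^ 3 with hκ
  have hκi : Integrable κ μ := integrable_indicator_ball_inv_norm_pow (by omega) 1
  refine ⟨2 * (∫ y, ‖f y‖ ∂μ) + M * ∫ z, κ z ∂μ, fun x hx => ?_⟩
  have hdom : Integrable (fun y => 2 * ‖f y‖ + M * κ (x - y)) μ :=
    (hfi.norm.const_mul 2).add ((hκi.comp_sub_left x).const_mul M)
  have hM0 : 0 ≤ M := (norm_nonneg _).trans (hM x₀ (mem_closedBall_self zero_le_two))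
  have hle : ∀ y, (1 + ‖x - y‖⁻¹ ^ 3) * ‖f y‖ ≤ 2 * ‖f y‖ + M * κ (x - y) := by
    intro y
    have hf0 := norm_nonneg (f y)
    by_cases hy : ‖x - y‖ < 1
    · have h1 : κ (x - y) = ‖x - y‖⁻¹ ^ 3 := indicator_of_mem (by simpa using hy) _
      have h2 : ‖f y‖ ≤ M := hM y <| by
        rw [mem_closedBall, dist_comm]
        have := dist_triangle_left x₀ y x
        rw [mem_ball] at hx
        rw [← dist_eq_norm] at hy
        linarith
      have h3 : 0 ≤ ‖x - y‖⁻¹ ^ 3 := by positivity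
      rw [h1]
      nlinarith
    · have h1 : κ (x - y) = 0 := indicator_of_notMem (by simpa using hy) _
      have h2 : ‖x - y‖⁻¹ ^ 3 ≤ 1 :=
        pow_le_one₀ (by positivity) (inv_le_one_of_one_le₀ (not_lt.1 hy))
      rw [h1]
      nlinarith
  have hint : Integrable (fun y => (1 + ‖x - y‖⁻¹ ^ 3) * ‖f y‖) μ := by
    refine hdom.mono' (by fun_prop) (ae_of_all _ fun y => ?_)
    rw [Real.norm_of_nonneg (by positivity)]
    exact hle y
  refine ⟨hint, (integral_mono hint hdom hle).trans_eq ?_⟩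
  rw [integral_add (hfi.norm.const_mul 2) ((hκi.comp_sub_left x).const_mul M),
    integral_const_mul, integral_const_mul, integral_sub_left_eq_self κ μ x]

lemma integrable_riesz (hE : 4 ≤ Module.finrank ℝ E) {f : E → ℝ} (hf : Continuous f)
    (hfi : Integrable f μ) (x : E) : Integrable (fun y => (1 + ‖x - y‖⁻¹ ^ 3) * ‖f y‖) μ := by
  obtain ⟨B, hB⟩ := exists_bound_integral_riesz hE hf hfi x
  exact (hB x (mem_ball_self one_pos)).1

variable {G : Type*} [NormedAddCommGroup G] [NormedSpace ℝ G]

/-- A kernel within a multiple of `1 + |z|⁻³` of a bounded kernel is integrable against `f`. -/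
lemma integrable_smul_kernel (hE : 4 ≤ Module.finrank ℝ E) {f : E → ℝ} (hf : Continuous f)
    (hfi : Integrable f μ) {ψ : E → G} {A : ℝ} (hψ : AEStronglyMeasurable ψ μ)
    (hA : ∀ z, z ≠ 0 → ‖ψ z‖ ≤ A * (1 + ‖z‖⁻¹ ^ 3)) (x : E) :
    Integrable (fun y => f y • ψ (x - y)) μ := by
  have : Nontrivial E := Module.nontrivial_of_finrank_pos (R := ℝ) (by omega)
  refine ((integrable_riesz hE hf hfi x).const_mul A).mono'
    (hf.aestronglyMeasurable.smul
      (hψ.comp_quasiMeasurePreserving (quasiMeasurePreserving_sub_left μ x))) ?_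
  filter_upwards [compl_mem_ae_iff.2 (measure_singleton x)] with y hy
  rw [norm_smul]
  have h1 := hA (x - y) (sub_ne_zero.2 (Ne.symm hy))
  nlinarith [norm_nonneg (f y)]

lemma norm_integral_smul_kernel_le (hE : 4 ≤ Module.finrank ℝ E) {f : E → ℝ} (hf : Continuous f)
    (hfi : Integrable f μ) {ψ : E → G} {A : ℝ}
    (hA : ∀ z, z ≠ 0 → ‖ψ z‖ ≤ A * (1 + ‖z‖⁻¹ ^ 3)) (x : E) :
    ‖∫ y, f y • ψ (x - y) ∂μ‖ ≤ A * ∫ y, (1 + ‖x - y‖⁻¹ ^ 3) * ‖f y‖ ∂μ := by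
  have : Nontrivial E := Module.nontrivial_of_finrank_pos (R := ℝ) (by omega)
  rw [← integral_const_mul]
  refine norm_integral_le_of_norm_le ((integrable_riesz hE hf hfi x).const_mul _) ?_
  filter_upwards [compl_mem_ae_iff.2 (measure_singleton x)] with y hy
  rw [norm_smul]
  have h1 := hA (x - y) (sub_ne_zero.2 (Ne.symm hy))
  nlinarith [norm_nonneg (f y)]

/-- Differentiation of the potential of `f` with a weakly singular kernel `ψ`, itself a limit of
the regular kernels `φ m`. The function `b` renormalises the potential at infinity. -/
lemma hasFDerivAt_potential (hE : 4 ≤ Module.finrank ℝ E) {f : E → ℝ} (hf : Continuous f)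
    (hfi : Integrable f μ) {φ : ℕ → E → G} {φ' : ℕ → E → E →L[ℝ] G} {ψ b : E → G}
    {ψ' : E → E →L[ℝ] G} {e C : ℕ → ℝ} (he : Tendsto e atTop (𝓝 0))
    (hφ : ∀ m z, HasFDerivAt (φ m) (φ' m z) z) (hC : ∀ m z, ‖φ' m z‖ ≤ C m)
    (hφψ : ∀ m z, z ≠ 0 → ‖φ m z - ψ z‖ ≤ e m * (1 + ‖z‖⁻¹ ^ 3))
    (hφψ' : ∀ m z, z ≠ 0 → ‖φ' m z - ψ' z‖ ≤ e m * (1 + ‖z‖⁻¹ ^ 3))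
    (hφm' : ∀ m, AEStronglyMeasurable (φ' m) μ)
    (hψm : AEStronglyMeasurable ψ μ) (hψm' : AEStronglyMeasurable ψ' μ)
    (hb : Integrable (fun y => f y • (ψ (0 - y) - b y)) μ) (x : E) :
    HasFDerivAt (fun x => ∫ y, f y • (ψ (x - y) - b y) ∂μ) (∫ y, f y • ψ' (x - y) ∂μ) x := by
  have : Nontrivial E := Module.nontrivial_of_finrank_pos (R := ℝ) (by omega)
  have hcont : ∀ m, Continuous (φ m) := fun m =>
    continuous_iff_continuousAt.2 fun z => (hφ m z).continuousAt
  have hdiff : ∀ m x, Integrable (fun y => f y • (φ m (x - y) - ψ (x - y))) μ := fun m x =>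
    integrable_smul_kernel hE hf hfi (ψ := fun z => φ m z - ψ z)
      ((hcont m).aestronglyMeasurable.sub hψm) (hφψ m) x
  have hdiff' : ∀ m x, Integrable (fun y => f y • (φ' m (x - y) - ψ' (x - y))) μ := fun m x =>
    integrable_smul_kernel hE hf hfi (ψ := fun z => φ' m z - ψ' z)
      ((hφm' m).sub hψm') (hφψ' m) x
  have hφi' : ∀ m x, Integrable (fun y => f y • φ' m (x - y)) μ := fun m x => by
    refine (hfi.norm.mul_const (C m)).mono' (hf.aestronglyMeasurable.smul
      ((hφm' m).comp_quasiMeasurePreserving (quasiMeasurePreserving_sub_left μ x)))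
      (ae_of_all _ fun y => ?_)
    rw [norm_smul]
    exact mul_le_mul_of_nonneg_left (hC m _) (norm_nonneg _)
  have hψi' : ∀ x, Integrable (fun y => f y • ψ' (x - y)) μ := fun x => by
    refine ((hφi' 0 x).sub (hdiff' 0 x)).congr (ae_of_all _ fun y => ?_)
    simp [smul_sub]
  have hlip : ∀ m x, Integrable (fun y => f y • (φ m (x - y) - φ m (0 - y))) μ := fun m x => by
    refine (hfi.norm.mul_const (C m * ‖x‖)).mono' (hf.aestronglyMeasurable.smul
      (by have := hcont m; fun_prop)) (ae_of_all _ fun y => ?_)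
    rw [norm_smul]
    refine mul_le_mul_of_nonneg_left ?_ (norm_nonneg _)
    have := convex_univ.norm_image_sub_le_of_norm_hasFDerivWithin_le
      (fun z _ => (hφ m z).hasFDerivWithinAt) (fun z _ => hC m z) (mem_univ (0 - y))
      (mem_univ (x - y))
    simpa using this
  have hφi : ∀ m x, Integrable (fun y => f y • (φ m (x - y) - b y)) μ := fun m x => by
    refine (((hlip m x).add (hdiff m 0)).add hb).congr (ae_of_all _ fun y => ?_)
    simp only [Pi.add_apply, ← smul_add]
    congr 1
    abel
  have hψi : ∀ x, Integrable (fun y => f y • (ψ (x - y) - b y)) μ := fun x => by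
    refine ((hφi 0 x).sub (hdiff 0 x)).congr (ae_of_all _ fun y => ?_)
    simp only [Pi.sub_apply, ← smul_sub]
    congr 1
    abel
  obtain ⟨B, hB⟩ := exists_bound_integral_riesz hE hf hfi x
  refine hasFDerivAt_of_tendstoUniformlyOn (l := atTop) (isOpen_ball (x := x) (ε := 1))
    (f := fun m x => ∫ y, f y • (φ m (x - y) - b y) ∂μ)
    (f' := fun m x => ∫ y, f y • φ' m (x - y) ∂μ) (g' := fun x => ∫ y, f y • ψ' (x - y) ∂μ)
    ?_ (fun m x _ => ?_) (fun x _ => ?_) (mem_ball_self one_pos)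
  · rw [Metric.tendstoUniformlyOn_iff]
    intro δ hδ
    have hlim : Tendsto (fun m => |e m| * B) atTop (𝓝 0) := by
      simpa using he.abs.mul_const B
    filter_upwards [hlim.eventually_lt_const hδ] with m hm x hx
    rw [dist_comm, dist_eq_norm, ← integral_sub (hφi' m x) (hψi' x)]
    simp only [← smul_sub]
    refine (norm_integral_smul_kernel_le hE hf hfi (ψ := fun z => φ' m z - ψ' z) (hφψ' m)
      x).trans_lt (lt_of_le_of_lt ?_ hm)
    refine mul_le_mul (le_abs_self _) (hB x hx).2 (integral_nonneg fun y => ?_) (abs_nonneg _)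
    positivity
  · refine hasFDerivAt_integral_of_dominated_of_fderiv_le (s := univ)
      (F' := fun x y => f y • φ' m (x - y))
      (bound := fun y => ‖f y‖ * C m) univ_mem
      (Eventually.of_forall fun x => (hφi m x).aestronglyMeasurable) (hφi m x)
      (hφi' m x).aestronglyMeasurable (ae_of_all _ fun y x _ => ?_) (hfi.norm.mul_const _)
      (ae_of_all _ fun y x _ => ?_)
    · rw [norm_smul]
      exact mul_le_mul_of_nonneg_left (hC m _) (norm_nonneg _)
    · have h1 : HasFDerivAt (fun x => φ m (x - y)) (φ' m (x - y)) x :=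
        (hasFDerivAt_comp_sub y).2 (hφ m _)
      exact (h1.sub_const (b y)).const_smul (f y)
  · rw [tendsto_iff_norm_sub_tendsto_zero]
    have hlim : Tendsto (fun m => e m * ∫ y, (1 + ‖x - y‖⁻¹ ^ 3) * ‖f y‖ ∂μ) atTop (𝓝 0) := by
      simpa using he.mul_const _
    refine squeeze_zero (fun m => norm_nonneg _) (fun m => ?_) hlim
    rw [← integral_sub (hφi m x) (hψi x)]
    simp only [← smul_sub, sub_sub_sub_cancel_right]
    exact norm_integral_smul_kernel_le hE hf hfi (ψ := fun z => φ m z - ψ z) (hφψ m) x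

end Potential

section LogPotential

open scoped Topology

set_option maxSynthPendingDepth 3

variable {E : Type*} [NormedAddCommGroup E] [InnerProductSpace ℝ E] [FiniteDimensional ℝ E]
  [MeasurableSpace E] [BorelSpace E] {μ : Measure E} [μ.IsAddHaarMeasure]

lemma stronglyMeasurable_logKernelDeriv (a : ℝ) :
    StronglyMeasurable (logKernelDeriv a : E → E →L[ℝ] ℝ) := by
  have h : Measurable fun z : E => (‖z‖ ^ 2 + a)⁻¹ := by fun_prop
  exact h.stronglyMeasurable.smul (innerBilin E).continuous.stronglyMeasurable

lemma stronglyMeasurable_logKernelHess (a : ℝ) :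
    StronglyMeasurable (logKernelHess a : E → E →L[ℝ] E →L[ℝ] ℝ) := by
  have h : Measurable fun z : E => (‖z‖ ^ 2 + a)⁻¹ := by fun_prop
  have h' : Measurable fun z : E => 2 * ((‖z‖ ^ 2 + a)⁻¹) ^ 2 := by fun_prop
  have hc : Continuous fun z : E => (innerBilin E z).smulRight (innerBilin E z) := by fun_prop
  exact (h.stronglyMeasurable.smul stronglyMeasurable_const).sub
    (h'.stronglyMeasurable.smul hc.stronglyMeasurable)

/-- The logarithmic potential `∫ (log |x - y| - log |y|) f y dy`. -/
def logPotential (μ : Measure E) (f : E → ℝ) (x : E) : ℝ :=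
  ∫ y, f y • (logKernel 0 (x - y) - logKernel 0 y) ∂μ

/-- The derivative of `logPotential`. -/
def logPotentialDeriv (μ : Measure E) (f : E → ℝ) (x : E) : E →L[ℝ] ℝ :=
  ∫ y, f y • logKernelDeriv 0 (x - y) ∂μ

/-- The second derivative of `logPotential`. -/
def logPotentialHess (μ : Measure E) (f : E → ℝ) (x : E) : E →L[ℝ] E →L[ℝ] ℝ :=
  ∫ y, f y • logKernelHess 0 (x - y) ∂μ

lemma tendsto_const_mul_one_div_add_one (c : ℝ) :
    Tendsto (fun m : ℕ => c * (1 / ((m : ℝ) + 1))) atTop (𝓝 0) := by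
  simpa using (tendsto_one_div_add_atTop_nhds_zero_nat (𝕜 := ℝ)).const_mul c

lemma hasFDerivAt_logPotential (hE : 4 ≤ Module.finrank ℝ E) {f : E → ℝ} (hf : Continuous f)
    (hfi : Integrable f μ) (x : E) :
    HasFDerivAt (logPotential μ f) (logPotentialDeriv μ f x) x := by
  have hpos : ∀ m : ℕ, 0 < 1 / ((m : ℝ) + 1) := fun m => by positivity
  refine hasFDerivAt_potential hE hf hfi (tendsto_const_mul_one_div_add_one 1)
    (φ := fun m => logKernel ((1 / ((m : ℝ) + 1)) ^ 2))
    (φ' := fun m => logKernelDeriv ((1 / ((m : ℝ) + 1)) ^ 2))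
    (fun m z => hasFDerivAt_logKernel (pow_pos (hpos m) 2) z)
    (fun m z => norm_logKernelDeriv_le (hpos m) z) (fun m z hz => ?_) (fun m z hz => ?_)
    (fun m => (stronglyMeasurable_logKernelDeriv _).aestronglyMeasurable)
    (measurable_logKernel 0).aestronglyMeasurable
    (stronglyMeasurable_logKernelDeriv 0).aestronglyMeasurable ?_ x
  · refine (norm_logKernel_sub_le (hpos m) hz).trans ?_
    rw [one_mul]
    have := inv_pow_le_one_add_inv_pow_three (norm_nonneg z) (p := 1) (by norm_num)
    rw [pow_one] at this
    exact mul_le_mul_of_nonneg_left this (hpos m).le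
  · refine (norm_logKernelDeriv_sub_le (hpos m) hz).trans ?_
    rw [one_mul]
    exact mul_le_mul_of_nonneg_left
      (inv_pow_le_one_add_inv_pow_three (norm_nonneg z) (by norm_num)) (hpos m).le
  · simp [logKernel]

lemma hasFDerivAt_logPotentialDeriv (hE : 4 ≤ Module.finrank ℝ E) {f : E → ℝ} (hf : Continuous f)
    (hfi : Integrable f μ) (x : E) :
    HasFDerivAt (logPotentialDeriv μ f) (logPotentialHess μ f x) x := by
  have hpos : ∀ m : ℕ, 0 < 1 / ((m : ℝ) + 1) := fun m => by positivity
  have key := hasFDerivAt_potential (b := 0) hE hf hfi (tendsto_const_mul_one_div_add_one 5)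
    (φ := fun m => logKernelDeriv ((1 / ((m : ℝ) + 1)) ^ 2))
    (φ' := fun m => logKernelHess ((1 / ((m : ℝ) + 1)) ^ 2)) (ψ := logKernelDeriv 0)
    (ψ' := logKernelHess 0)
    (fun m z => hasFDerivAt_logKernelDeriv (pow_pos (hpos m) 2) z)
    (fun m z => norm_logKernelHess_le (hpos m) z) (fun m z hz => ?_) (fun m z hz => ?_)
    (fun m => (stronglyMeasurable_logKernelHess _).aestronglyMeasurable)
    (stronglyMeasurable_logKernelDeriv 0).aestronglyMeasurable
    (stronglyMeasurable_logKernelHess 0).aestronglyMeasurable ?_ x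
  · simp only [Pi.zero_apply, sub_zero] at key
    exact key
  · refine (norm_logKernelDeriv_sub_le (hpos m) hz).trans ?_
    have h1 := inv_pow_le_one_add_inv_pow_three (norm_nonneg z) (p := 2) (by norm_num)
    have h2 : 0 ≤ ‖z‖⁻¹ ^ 3 := by positivity
    nlinarith [hpos m]
  · refine (norm_logKernelHess_sub_le (hpos m) hz).trans ?_
    nlinarith [hpos m]
  · simp only [Pi.zero_apply, sub_zero]
    refine integrable_smul_kernel hE hf hfi (A := 1)
      (stronglyMeasurable_logKernelDeriv 0).aestronglyMeasurable (fun z hz => ?_) 0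
    have hz' : 0 < ‖z‖ := norm_pos_iff.2 hz
    have h1 := inv_pow_le_one_add_inv_pow_three (norm_nonneg z) (p := 1) (by norm_num)
    rw [logKernelDeriv, norm_smul, norm_innerBilin_apply, Real.norm_of_nonneg (by positivity),
      one_mul]
    refine le_trans (le_of_eq ?_) h1
    field_simp
    ring

/-- The Hessian of the logarithmic potential of an integrable function is small up to an
integrable error. -/
lemma exists_integrable_bound_logPotentialHess (hE : 4 ≤ Module.finrank ℝ E) {f : E → ℝ}
    (hf : Continuous f) (hfi : Integrable f μ) {ε : ℝ} (hε : 0 < ε) :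
    ∃ P : E → ℝ, Integrable P μ ∧ (∀ x, 0 ≤ P x) ∧ ∀ x, ‖logPotentialHess μ f x‖ ≤ ε + P x := by
  have : Nontrivial E := Module.nontrivial_of_finrank_pos (R := ℝ) (by omega)
  set I := ∫ y, ‖f y‖ ∂μ with hI
  have hI0 : 0 ≤ I := integral_nonneg fun y => norm_nonneg _
  obtain ⟨ρ, hρ, hρε⟩ : ∃ ρ : ℝ, 0 < ρ ∧ 3 * ρ⁻¹ ^ 2 * I ≤ ε := by
    have hlim : Tendsto (fun ρ : ℝ => 3 * ρ⁻¹ ^ 2 * I) atTop (𝓝 0) := by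
      simpa using ((tendsto_inv_atTop_zero (𝕜 := ℝ)).pow 2).const_mul 3 |>.mul_const I
    obtain ⟨ρ, h1, h2⟩ := ((eventually_gt_atTop 0).and (hlim.eventually_le_const hε)).exists
    exact ⟨ρ, h1, h2⟩
  set κ : E → ℝ := (ball (0 : E) ρ).indicator fun z => ‖z‖⁻¹ ^ 2 with hκ
  have hκi : Integrable κ μ := integrable_indicator_ball_inv_norm_pow (by omega) ρ
  have hκ0 : ∀ z, 0 ≤ κ z := indicator_nonneg fun z _ => by positivity
  refine ⟨fun x => 3 * ∫ y, ‖f y‖ * κ (x - y) ∂μ, ?_, fun x => ?_, fun x => ?_⟩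
  · exact (hfi.norm.integrable_convolution (ContinuousLinearMap.mul ℝ ℝ) hκi).const_mul 3
  · exact mul_nonneg zero_le_three
      (integral_nonneg fun y => mul_nonneg (norm_nonneg _) (hκ0 _))
  · have h1 : Integrable (fun y => f y * κ (x - y)) μ := by
      refine integrable_smul_kernel hE hf hfi (A := 1) hκi.aestronglyMeasurable
        (fun z _ => ?_) x
      rw [Real.norm_of_nonneg (hκ0 z), one_mul]
      refine le_trans (indicator_le_self' (fun z _ => by positivity) z)
        (inv_pow_le_one_add_inv_pow_three (norm_nonneg z) (by norm_num))
    have h2 : Integrable (fun y => ‖f y‖ * κ (x - y)) μ := by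
      refine h1.norm.congr (ae_of_all _ fun y => ?_)
      simp only [norm_mul, Real.norm_of_nonneg (hκ0 _)]
    have h3 : ∀ z, ‖logKernelHess 0 z‖ ≤ 3 * (ρ⁻¹ ^ 2 + κ z) := fun z => by
      refine (norm_logKernelHess_le_inv le_rfl z).trans ?_
      rw [add_zero, ← inv_pow]
      gcongr
      by_cases hz : ‖z‖ < ρ
      · rw [hκ, indicator_of_mem (by simpa using hz)]
        exact le_add_of_nonneg_left (by positivity)
      · have : ‖z‖⁻¹ ^ 2 ≤ ρ⁻¹ ^ 2 := by
          gcongr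
          exact not_lt.1 hz
        linarith [hκ0 z]
    have h4 : ‖logPotentialHess μ f x‖ ≤
        ∫ y, (3 * ρ⁻¹ ^ 2 * ‖f y‖ + 3 * (‖f y‖ * κ (x - y))) ∂μ := by
      refine norm_integral_le_of_norm_le ((hfi.norm.const_mul _).add (h2.const_mul 3))
        (ae_of_all _ fun y => ?_)
      rw [norm_smul]
      nlinarith [h3 (x - y), norm_nonneg (f y)]
    rw [integral_add (hfi.norm.const_mul _) (h2.const_mul 3), integral_const_mul,
      integral_const_mul] at h4
    linarith

end LogPotential

section Average

open scoped Topology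

variable {E : Type*} [MeasurableSpace E] {μ : Measure E}

/-- If `g` is bounded above by every positive constant up to an integrable error, then its averages
over sets of diverging measure have nonpositive upper limit. -/
lemma limsup_setAverage_nonpos {g : E → ℝ}
    (hg : ∀ ε > 0, ∃ P : E → ℝ, Integrable P μ ∧ (∀ x, 0 ≤ P x) ∧ ∀ x, g x ≤ ε + P x)
    {S : ℝ → Set E} (hfin : ∀ r, μ (S r) ≠ ⊤)
    (hS : Tendsto (fun r => μ.real (S r)) atTop atTop) :
    limsup (fun r => ⨍ x in S r, g x ∂μ) atTop ≤ 0 := by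
  have key : ∀ ε > 0, ∀ᶠ r in atTop, ⨍ x in S r, g x ∂μ ≤ ε := by
    intro ε hε
    obtain ⟨P, hPi, hP0, hgP⟩ := hg (ε / 2) (half_pos hε)
    have hlim : Tendsto (fun r => (μ.real (S r))⁻¹ * ∫ x, P x ∂μ) atTop (𝓝 0) := by
      simpa using hS.inv_tendsto_atTop.mul_const (∫ x, P x ∂μ)
    filter_upwards [hlim.eventually_le_const (half_pos hε), hS.eventually_gt_atTop 0]
      with r hr hr0
    rw [setAverage_eq, smul_eq_mul]
    by_cases hint : IntegrableOn g (S r) μ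
    · have hc : IntegrableOn (fun _ => ε / 2) (S r) μ := integrableOn_const (hfin r)
      have h1 : ∫ x in S r, g x ∂μ ≤ ∫ x in S r, (ε / 2 + P x) ∂μ :=
        integral_mono hint (hc.add hPi.integrableOn) hgP
      rw [integral_add hc hPi.integrableOn, setIntegral_const, smul_eq_mul] at h1
      have h2 : ∫ x in S r, P x ∂μ ≤ ∫ x, P x ∂μ :=
        setIntegral_le_integral hPi (ae_of_all _ hP0)
      calc _ ≤ (μ.real (S r))⁻¹ * (μ.real (S r) * (ε / 2) + ∫ x, P x ∂μ) := by
            gcongr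
            linarith
        _ = ε / 2 + (μ.real (S r))⁻¹ * ∫ x, P x ∂μ := by field_simp
        _ ≤ ε := by linarith
    · rw [integral_undef hint, mul_zero]
      exact hε.le
  rw [limsup_eq]
  by_cases hbdd : BddBelow {a | ∀ᶠ r in atTop, ⨍ x in S r, g x ∂μ ≤ a}
  · exact le_of_forall_pos_le_add fun ε hε => (csInf_le hbdd (key ε hε)).trans (by simp)
  · rw [Real.sInf_of_not_bddBelow hbdd]

end Average

section Volume

variable {E : Type*} [NormedAddCommGroup E] [NormedSpace ℝ E] [FiniteDimensional ℝ E]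
  [Nontrivial E] [MeasurableSpace E] [BorelSpace E] {μ : Measure E} [μ.IsAddHaarMeasure]

lemma measureReal_ball_zero {r : ℝ} (hr : 0 ≤ r) :
    μ.real (ball (0 : E) r) = r ^ Module.finrank ℝ E * μ.real (ball (0 : E) 1) := by
  rw [measureReal_def, measureReal_def, Measure.addHaar_ball μ 0 hr, ENNReal.toReal_mul,
    ENNReal.toReal_ofReal (by positivity)]

lemma tendsto_measureReal_ball_atTop :
    Tendsto (fun r => μ.real (ball (0 : E) r)) atTop atTop := by
  have h1 : 0 < μ.real (ball (0 : E) 1) := 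
    ENNReal.toReal_pos (measure_ball_pos μ 0 one_pos).ne' measure_ball_lt_top.ne
  refine Tendsto.congr' ?_
    ((tendsto_pow_atTop (Module.finrank_pos (R := ℝ) (M := E)).ne').atTop_mul_const h1)
  filter_upwards [eventually_ge_atTop 0] with r hr
  exact (measureReal_ball_zero hr).symm

lemma tendsto_measureReal_annulus_atTop :
    Tendsto (fun r => μ.real (ball (0 : E) (2 * r) \ ball 0 r)) atTop atTop := by
  refine tendsto_atTop_mono' _ ?_ (tendsto_measureReal_ball_atTop (E := E) (μ := μ))
  filter_upwards [eventually_ge_atTop 0] with r hr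
  rw [measureReal_sdiff (ball_subset_ball (by linarith)) measurableSet_ball,
    measureReal_ball_zero hr, measureReal_ball_zero (r := 2 * r) (by positivity), mul_pow]
  have h2 : (2 : ℝ) ≤ 2 ^ Module.finrank ℝ E := by
    simpa using pow_le_pow_right₀ (one_le_two (α := ℝ)) (Module.finrank_pos (R := ℝ) (M := E))
  have h3 : 0 ≤ r ^ Module.finrank ℝ E * μ.real (ball (0 : E) 1) := by positivity
  nlinarith

end Volume

section Laplacian

set_option maxSynthPendingDepth 3

variable {n : ℕ}

lemma lap_eq_sum_fderiv (u : Eu n → ℝ) (x : Eu n) :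
    lap u x = ∑ i : Fin n, fderiv ℝ (fderiv ℝ u) x (EuclideanSpace.single i 1)
      (EuclideanSpace.single i 1) := by
  simp [lap, iteratedFDeriv_two_apply]

lemma contDiff_lap {u : Eu n → ℝ} (hu : ContDiff ℝ (⊤ : ℕ∞) u) :
    ContDiff ℝ (⊤ : ℕ∞) (lap u) := by
  have h2 : ContDiff ℝ (⊤ : ℕ∞) (fderiv ℝ (fderiv ℝ u)) :=
    (hu.fderiv_right (m := (⊤ : ℕ∞)) le_rfl).fderiv_right le_rfl
  rw [funext (lap_eq_sum_fderiv u)]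
  exact ContDiff.sum fun i _ => (h2.clm_apply contDiff_const).clm_apply contDiff_const

lemma contDiff_lapIter {u : Eu n → ℝ} (hu : ContDiff ℝ (⊤ : ℕ∞) u) (k : ℕ) :
    ContDiff ℝ (⊤ : ℕ∞) (lapIter k u) := by
  induction k with
  | zero => exact hu
  | succ k ih => exact contDiff_lap ih

lemma lap_add_smul_le {u w : Eu n → ℝ} {w' : Eu n → Eu n →L[ℝ] ℝ}
    {w'' : Eu n → Eu n →L[ℝ] Eu n →L[ℝ] ℝ} (hu : ContDiff ℝ (⊤ : ℕ∞) u)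
    (hw : ∀ x, HasFDerivAt w (w' x) x) (hw' : ∀ x, HasFDerivAt w' (w'' x) x) (c : ℝ) (x : Eu n) :
    lap (fun x => u x + c * w x) x ≤ lap u x + n * |c| * ‖w'' x‖ := by
  have hu1 : Differentiable ℝ u := hu.differentiable (by simp)
  have hu2 : Differentiable ℝ (fderiv ℝ u) :=
    (hu.fderiv_right (m := (⊤ : ℕ∞)) le_rfl).differentiable (by simp)
  have h1 : fderiv ℝ (fun x => u x + c * w x) = fun x => fderiv ℝ u x + c • w' x :=
    funext fun x => ((hu1 x).hasFDerivAt.add ((hw x).const_mul c)).fderiv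
  have h2 : fderiv ℝ (fun x => fderiv ℝ u x + c • w' x) x =
      fderiv ℝ (fderiv ℝ u) x + c • w'' x :=
    ((hu2 x).hasFDerivAt.add ((hw' x).const_smul c)).fderiv
  rw [lap_eq_sum_fderiv, lap_eq_sum_fderiv, h1, h2]
  simp only [_root_.add_apply, _root_.smul_apply,
    Finset.sum_add_distrib, smul_eq_mul]
  gcongr
  calc _ ≤ ∑ _i : Fin n, |c| * ‖w'' x‖ := by
        refine Finset.sum_le_sum fun i _ => (le_abs_self _).trans ?_
        rw [abs_mul]
        gcongr
        simpa using (w'' x).le_opNorm₂ (EuclideanSpace.single i 1) (EuclideanSpace.single i 1)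
    _ = _ := by simp; ring

/-- Young's inequality in the form `q ≤ δ + δ^(1-k) q^k`. -/
lemma le_add_mul_pow {q δ : ℝ} (hq : 0 ≤ q) (hδ : 0 < δ) {k : ℕ} (hk : 1 ≤ k) :
    q ≤ δ + δ * δ⁻¹ ^ k * q ^ k := by
  rcases le_total q δ with h | h
  · have : 0 ≤ δ * δ⁻¹ ^ k * q ^ k := by positivity
    linarith
  · have h1 : 1 ≤ δ⁻¹ * q := by rwa [inv_mul_eq_div, one_le_div hδ]
    have h2 : δ⁻¹ * q ≤ (δ⁻¹ * q) ^ k := le_self_pow₀ h1 (by omega)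
    calc q = δ * (δ⁻¹ * q) := by field_simp
      _ ≤ δ * (δ⁻¹ * q) ^ k := by gcongr
      _ = δ * δ⁻¹ ^ k * q ^ k := by rw [mul_pow]; ring
      _ ≤ _ := by linarith

/-- The Laplacian of a conformal factor is controlled by the negative part of the scalar
curvature. -/
lemma lap_le_neg_scal (hn : 2 ≤ n) (u : Eu n → ℝ) (x : Eu n) :
    lap u x ≤ max (-scal u x) 0 * Real.exp (2 * u x) := by
  have hn' : (2 : ℝ) ≤ n := by exact_mod_cast hn
  have h0 : 0 ≤ max (-scal u x) 0 * Real.exp (2 * u x) := by positivity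
  rcases le_or_gt (lap u x) 0 with h | h
  · exact h.trans h0
  · have h1 : -scal u x * Real.exp (2 * u x) =
        2 * (n - 1) * (lap u x + ((n : ℝ) - 2) / 2 * ‖gradient u x‖ ^ 2) := by
      have : Real.exp (-2 * u x) * Real.exp (2 * u x) = 1 := by
        rw [← Real.exp_add]
        simp
      rw [scal]
      linear_combination (2 * (n - 1) * (lap u x + ((n : ℝ) - 2) / 2 * ‖gradient u x‖ ^ 2)) * this
    have h2 : 0 ≤ ((n : ℝ) - 2) / 2 * ‖gradient u x‖ ^ 2 :=
      mul_nonneg (by linarith) (sq_nonneg _)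
    calc lap u x ≤ 2 * (n - 1) * (lap u x + ((n : ℝ) - 2) / 2 * ‖gradient u x‖ ^ 2) := by
          nlinarith
      _ = -scal u x * Real.exp (2 * u x) := h1.symm
      _ ≤ _ := by gcongr; exact le_max_left _ _

lemma integral_log_div_mul_eq_neg_logPotential (hn : 0 < n) (f : Eu n → ℝ) (x : Eu n) :
    ∫ y, Real.log (‖y‖ / ‖x - y‖) * f y = -logPotential volume f x := by
  have : Nontrivial (Eu n) := Module.nontrivial_of_finrank_pos (R := ℝ) (by simpa using hn)
  rw [logPotential, ← integral_neg]
  refine integral_congr_ae ?_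
  filter_upwards [compl_mem_ae_iff.2 (measure_singleton x),
    compl_mem_ae_iff.2 (measure_singleton 0)] with y hy hy0
  have h1 : ‖x - y‖ ≠ 0 := norm_ne_zero_iff.2 (sub_ne_zero.2 (Ne.symm hy))
  have h2 : ‖y‖ ≠ 0 := norm_ne_zero_iff.2 hy0
  rw [Real.log_div h2 h1, logKernel, logKernel, add_zero, add_zero, Real.log_pow, Real.log_pow,
    smul_eq_mul]
  push_cast
  ring

/-- The Laplacian of `u` plus a multiple of a logarithmic potential is bounded above by every
positive constant up to an integrable error. -/
lemma exists_integrable_bound_lap {k : ℕ} (hk : 2 ≤ k) (hnk : n = 2 * k) {u f : Eu n → ℝ}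
    (hu : ContDiff ℝ (⊤ : ℕ∞) u) (hf : Continuous f) (hfi : Integrable f)
    (hRneg : Integrable
      (fun x => max (-(scal u x)) 0 ^ ((n : ℝ) / 2) * Real.exp ((n : ℝ) * u x)))
    (c : ℝ) {ε : ℝ} (hε : 0 < ε) :
    ∃ P : Eu n → ℝ, Integrable P ∧ (∀ x, 0 ≤ P x) ∧
      ∀ x, lap (fun x => u x + c * logPotential volume f x) x ≤ ε + P x := by
  have hE : 4 ≤ Module.finrank ℝ (Eu n) := by
    rw [finrank_euclideanSpace_fin]
    omega
  set A : ℝ := n * |c| with hA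
  have hA0 : 0 ≤ A := by positivity
  obtain ⟨P, hPi, hP0, hP⟩ := exists_integrable_bound_logPotentialHess hE hf hfi
    (ε := ε / 2 / (A + 1)) (by positivity)
  set δ := ε / 2 with hδ
  have hδ0 : 0 < δ := half_pos hε
  set G := fun x => max (-(scal u x)) 0 ^ ((n : ℝ) / 2) * Real.exp ((n : ℝ) * u x) with hG
  have hGk : ∀ x, G x = (max (-scal u x) 0 * Real.exp (2 * u x)) ^ k := by
    intro x
    have hnk' : (n : ℝ) = 2 * k := by exact_mod_cast hnk
    rw [mul_pow, ← Real.exp_nat_mul, hG]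
    simp only [hnk']
    rw [mul_div_cancel_left₀ _ two_ne_zero, Real.rpow_natCast]
    ring_nf
  have hG0 : ∀ x, 0 ≤ G x := fun x => by
    rw [hGk]
    positivity
  refine ⟨fun x => δ * δ⁻¹ ^ k * G x + A * P x, (hRneg.const_mul _).add (hPi.const_mul A),
    fun x => add_nonneg (mul_nonneg (by positivity) (hG0 x)) (mul_nonneg hA0 (hP0 x)),
    fun x => ?_⟩
  have h1 := lap_add_smul_le hu (hasFDerivAt_logPotential hE hf hfi)
    (hasFDerivAt_logPotentialDeriv hE hf hfi) c x
  have h2 : lap u x ≤ δ + δ * δ⁻¹ ^ k * G x := by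
    rw [hGk]
    exact (lap_le_neg_scal (by omega) u x).trans (le_add_mul_pow (by positivity) hδ0 (by omega))
  have h3 : A * ‖logPotentialHess volume f x‖ ≤ δ + A * P x := by
    have h4 : A * (δ / (A + 1)) ≤ δ := by
      rw [mul_div_assoc', div_le_iff₀ (by positivity)]
      nlinarith
    nlinarith [mul_le_mul_of_nonneg_left (hP x) hA0]
  linarith

end Laplacian

/-- **Lemma (decay of the average of `Δh`).** With `f = (-Δ)ᵏu` integrable and
`∫ (R⁻)^{n/2} e^{nu} dx < ∞`, the function `h = u - v`, where
`v(x) = (1/(2cₙ)) ∫ log(|y|/|x-y|) f(y) dy`, satisfies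
`limsup_{r→∞} ⨍_{B_{2r}∖B_r} Δh ≤ 0` and `limsup_{r→∞} ⨍_{B_r} Δh ≤ 0`. -/
theorem limsup_average_lap_h_nonpos
    (n k : ℕ) (hk : 2 ≤ k) (hnk : n = 2 * k)
    (u : Eu n → ℝ) (hu : ContDiff ℝ (⊤ : ℕ∞) u)
    (f : Eu n → ℝ) (hf : ∀ x, f x = (-1 : ℝ) ^ k * lapIter k u x)
    (hfL1 : Integrable f)
    (hRneg : Integrable
      (fun x => max (-(scal u x)) 0 ^ ((n : ℝ) / 2) * Real.exp ((n : ℝ) * u x)))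
    (v : Eu n → ℝ)
    (hv : ∀ x, v x = (1 / (2 * cQ n)) * ∫ y, Real.log (‖y‖ / ‖x - y‖) * f y)
    (h : Eu n → ℝ) (hh : ∀ x, h x = u x - v x) :
    Filter.limsup
        (fun r : ℝ => ⨍ x in ball (0 : Eu n) (2 * r) \ ball 0 r, lap h x) Filter.atTop ≤ 0 ∧
      Filter.limsup (fun r : ℝ => ⨍ x in ball (0 : Eu n) r, lap h x) Filter.atTop ≤ 0 := by
  have hfc : Continuous f := by
    rw [funext hf]
    exact continuous_const.mul (contDiff_lapIter hu k).continuous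
  have hn : 0 < n := by omega
  have : Nontrivial (Eu n) := Module.nontrivial_of_finrank_pos (R := ℝ) (by simpa using hn)
  have heq : h = fun x => u x + 1 / (2 * cQ n) * logPotential volume f x := by
    funext x
    rw [hh, hv, integral_log_div_mul_eq_neg_logPotential hn]
    ring
  have hbound : ∀ ε > 0, ∃ P : Eu n → ℝ, Integrable P ∧ (∀ x, 0 ≤ P x) ∧
      ∀ x, lap h x ≤ ε + P x := fun ε hε => by
    rw [heq]
    exact exists_integrable_bound_lap hk hnk hu hfc hfL1 hRneg _ hε
  exact ⟨limsup_setAverage_nonpos hbound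
      (fun r => measure_ne_top_of_subset sdiff_subset measure_ball_lt_top.ne)
      tendsto_measureReal_annulus_atTop,
    limsup_setAverage_nonpos hbound (fun r => measure_ball_lt_top.ne)
      tendsto_measureReal_ball_atTop⟩
end
end
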